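/- arXiv:0908.4481 — 6 statements merged into one kernel-verified Lean document; each statement's English description precedes it below -/
import Mathlib

section
/- Let ν > 0 and L ∈ ℝ. Let f : (0,∞) × (0,1) → ℝ be bounded and measurable such that for every u > 0, f(λ, u/λ) → L as λ → ∞. Let φ ∈ C¹((0,1)) satisfy φ'(x) > 0 for all x ∈ (0,1), lim_{x→0+} φ(x) = a ∈ ℝ, and lim_{x→0+} φ'(x) = b > 0. Then lim_{λ→∞} λ^ν e^{aλ} ∫₀¹ e^{−λφ(x)} f(λ,x) x^{ν−1} dx = L·Γ(ν)/b^ν; that is, ∫₀¹ e^{−λφ(x)} f(λ,x) x^{ν−1} dx ∼ L·(Γ(ν)/b^ν)·λ^{−ν} e^{−aλ} as λ → ∞. -/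
open MeasureTheory Filter Set Topology

theorem aux_slope (a b : ℝ) (φ φ' : ℝ → ℝ)
    (hφ_deriv : ∀ x ∈ Ioo (0 : ℝ) 1, HasDerivAt φ (φ' x) x)
    (hφ_a : Tendsto φ (𝓝[>] 0) (𝓝 a))
    (hφ'_b : Tendsto φ' (𝓝[>] 0) (𝓝 b)) :
    Tendsto (fun x => (φ x - a) / x) (𝓝[>] 0) (𝓝 b) := by
  refine HasDerivAt.lhopital_zero_nhdsGT (f' := φ') (g' := fun _ => 1) ?_ ?_ ?_ ?_ ?_ ?_
  · filter_upwards [Ioo_mem_nhdsGT (zero_lt_one (α := ℝ))] with x hx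
    exact (hφ_deriv x hx).sub_const a
  · exact Eventually.of_forall fun x => hasDerivAt_id' x
  · exact Eventually.of_forall fun x => one_ne_zero
  · simpa using hφ_a.sub_const a
  · exact tendsto_nhdsWithin_of_tendsto_nhds tendsto_id
  · simpa using hφ'_b

theorem aux_lower (a b : ℝ) (hb : 0 < b) (φ φ' : ℝ → ℝ)
    (hφ_deriv : ∀ x ∈ Ioo (0 : ℝ) 1, HasDerivAt φ (φ' x) x)
    (hφ'_pos : ∀ x ∈ Ioo (0 : ℝ) 1, 0 < φ' x)
    (hφ_a : Tendsto φ (𝓝[>] 0) (𝓝 a))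
    (hφ'_b : Tendsto φ' (𝓝[>] 0) (𝓝 b)) :
    ∃ c : ℝ, 0 < c ∧ ∀ x ∈ Ioo (0:ℝ) 1, c * x ≤ φ x - a := by
  have hs := aux_slope a b φ φ' hφ_deriv hφ_a hφ'_b
  have hev := hs.eventually_const_lt (half_lt_self hb)
  obtain ⟨d, hd, hd'⟩ := mem_nhdsGT_iff_exists_Ioo_subset.1
    (inter_mem hev (Ioo_mem_nhdsGT (zero_lt_one (α := ℝ))))
  have hd : 0 < d := hd
  have hmono : StrictMonoOn φ (Ioo 0 1) := by
    apply strictMonoOn_of_deriv_pos (convex_Ioo 0 1)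
    · exact fun x hx => (hφ_deriv x hx).continuousAt.continuousWithinAt
    · intro x hx
      rw [interior_Ioo] at hx
      rw [(hφ_deriv x hx).deriv]
      exact hφ'_pos x hx
  have key : ∀ x ∈ Ioo (0:ℝ) d, b / 2 * x ≤ φ x - a := by
    intro x hx
    have h := (hd' hx).1
    have h : b / 2 < (φ x - a) / x := h
    exact ((lt_div_iff₀ hx.1).1 h).le
  have hm : d / 2 ∈ Ioo (0:ℝ) d := ⟨by linarith, by linarith⟩
  have hm1 := (hd' hm).2
  have hk := key _ hm
  refine ⟨b * d / 4, by positivity, ?_⟩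
  intro x hx
  rcases le_or_gt (d / 2) x with h | h
  · have := hmono.monotoneOn hm1 hx h
    have : b * d / 4 * x ≤ b * d / 4 * 1 := by
      apply mul_le_mul_of_nonneg_left hx.2.le; positivity
    linarith
  · have := key x ⟨hx.1, by linarith⟩
    have hd2 : d / 2 < 1 := hm1.2
    have : b * d / 4 * x ≤ b / 2 * x := by
      apply mul_le_mul_of_nonneg_right _ hx.1.le
      nlinarith
    linarith

/-- **Theorem (Statement 6, Lemma 4.1).** Let `ν > 0`. Let `f(λ,·)` for `λ > 0` be bounded
measurable on `(0,1)` with `f(λ, u/λ) → L` as `λ → ∞` for every `u > 0`. Let `φ ∈ C¹((0,1))`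
with `φ' > 0` on `(0,1)`, `φ(0+) = a` and `φ'(0+) = b > 0`. Then
`∫₀¹ e^{−λφ(x)} f(λ,x) x^{ν−1} dx ∼ L·Γ(ν)/b^ν · λ^{−ν} e^{−aλ}` as `λ → ∞`. -/
theorem statement6 (ν L a b : ℝ) (hν : 0 < ν) (hb : 0 < b)
    (f : ℝ → ℝ → ℝ) (hf_meas : Measurable (Function.uncurry f))
    (hf_bdd : ∃ C : ℝ, ∀ lam x : ℝ, 0 < lam → x ∈ Ioo (0 : ℝ) 1 → |f lam x| ≤ C)
    (hf_lim : ∀ u : ℝ, 0 < u → Tendsto (fun lam => f lam (u / lam)) atTop (𝓝 L))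
    (φ φ' : ℝ → ℝ)
    (hφ_deriv : ∀ x ∈ Ioo (0 : ℝ) 1, HasDerivAt φ (φ' x) x)
    (hφ'_cont : ContinuousOn φ' (Ioo 0 1))
    (hφ'_pos : ∀ x ∈ Ioo (0 : ℝ) 1, 0 < φ' x)
    (hφ_a : Tendsto φ (𝓝[>] 0) (𝓝 a))
    (hφ'_b : Tendsto φ' (𝓝[>] 0) (𝓝 b)) :
    Tendsto (fun lam : ℝ => lam ^ ν * Real.exp (a * lam) *
        ∫ x in Ioo (0 : ℝ) 1, Real.exp (-lam * φ x) * f lam x * x ^ (ν - 1))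
      atTop (𝓝 (L * Real.Gamma ν / b ^ ν)) := by
  
  obtain ⟨C, hC⟩ := hf_bdd
  have hcont : ContinuousOn φ (Ioo 0 1) := fun x hx => (hφ_deriv x hx).continuousAt.continuousWithinAt
  obtain ⟨c, hc, hcφ⟩ := aux_lower a b hb φ φ' hφ_deriv hφ'_pos hφ_a hφ'_b
  have hlim := aux_slope a b φ φ' hφ_deriv hφ_a hφ'_b
  obtain ⟨ψ, hψm, hψ⟩ : ∃ ψ : ℝ → ℝ, Measurable ψ ∧ ∀ x ∈ Ioo (0:ℝ) 1, ψ x = φ x := by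
    classical
    refine ⟨(Ioo (0:ℝ) 1).piecewise φ (fun _ => 0), ?_, ?_⟩
    · exact hcont.measurable_piecewise continuousOn_const measurableSet_Ioo
    · intro x hx
      exact Set.piecewise_eq_of_mem _ _ _ hx
  let H : ℝ → ℝ → ℝ := fun lam => (Ioo (0:ℝ) 1).indicator
    (fun x => Real.exp (-lam * (ψ x - a)) * f lam x)
  have hHm : ∀ lam, Measurable (H lam) := by
    intro lam
    refine Measurable.indicator ?_ measurableSet_Ioo
    have : Measurable (f lam) := hf_meas.comp measurable_prodMk_left
    fun_prop
  have hHin : ∀ lam x, x ∈ Ioo (0:ℝ) 1 → H lam x = Real.exp (-lam * (φ x - a)) * f lam x := by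
    intro lam x hx
    simp only [H, Set.indicator_of_mem hx, hψ x hx]
  have hHout : ∀ lam x, x ∉ Ioo (0:ℝ) 1 → H lam x = 0 := by
    intro lam x hx
    simp only [H, Set.indicator_of_notMem hx]
  have hcv : ∀ lam : ℝ, 0 < lam → lam ^ ν * Real.exp (a * lam) *
      (∫ x in Ioo (0 : ℝ) 1, Real.exp (-lam * φ x) * f lam x * x ^ (ν - 1))
      = ∫ u in Ioi (0:ℝ), H lam (u / lam) * u ^ (ν - 1) := by
    intro lam hlam
    have h1 := MeasureTheory.integral_comp_mul_left_Ioi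
      (fun u => H lam (u / lam) * u ^ (ν - 1)) 0 hlam
    rw [mul_zero, smul_eq_mul] at h1
    have h2 : ∫ u in Ioi (0:ℝ), H lam (u / lam) * u ^ (ν - 1)
        = lam * ∫ x in Ioi (0:ℝ), H lam (lam * x / lam) * (lam * x) ^ (ν - 1) := by
      rw [h1]; field_simp
    rw [h2, ← integral_const_mul, ← integral_const_mul]
    rw [← MeasureTheory.integral_indicator measurableSet_Ioo,
      ← MeasureTheory.integral_indicator measurableSet_Ioi]
    congr 1
    funext x
    by_cases hx : x ∈ Ioo (0:ℝ) 1
    · rw [Set.indicator_of_mem hx, Set.indicator_of_mem (show x ∈ Ioi (0:ℝ) from hx.1),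
        mul_div_cancel_left₀ _ hlam.ne', hHin _ _ hx, Real.mul_rpow hlam.le hx.1.le]
      have e1 : Real.exp (-lam * (φ x - a)) = Real.exp (a * lam) * Real.exp (-lam * φ x) := by
        rw [← Real.exp_add]; ring_nf
      have e2 : lam ^ ν = lam * lam ^ (ν - 1) := by
        rw [Real.rpow_sub_one hlam.ne']; field_simp
      rw [e1, e2]; ring
    · rw [Set.indicator_of_notMem hx]
      by_cases hx0 : x ∈ Ioi (0:ℝ)
      · rw [Set.indicator_of_mem hx0, mul_div_cancel_left₀ _ hlam.ne', hHout _ _ hx]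
        ring
      · rw [Set.indicator_of_notMem hx0]
  have hGamma : L * Real.Gamma ν / b ^ ν
      = ∫ u in Ioi (0:ℝ), (Real.exp (-(b * u)) * L) * u ^ (ν - 1) := by
    have := Real.integral_rpow_mul_exp_neg_mul_Ioi hν hb
    rw [show (∫ u in Ioi (0:ℝ), (Real.exp (-(b * u)) * L) * u ^ (ν - 1))
      = ∫ u in Ioi (0:ℝ), L * (u ^ (ν - 1) * Real.exp (-(b * u))) from by
        congr 1; funext u; ring, integral_const_mul, this,
        Real.div_rpow zero_le_one hb.le, Real.one_rpow]
    ring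
  rw [hGamma]
  refine Tendsto.congr' (f₁ := fun lam => ∫ u in Ioi (0:ℝ), H lam (u / lam) * u ^ (ν - 1)) ?_ ?_
  · filter_upwards [eventually_gt_atTop 0] with lam hlam
    exact (hcv lam hlam).symm
  have hC0 : 0 ≤ C := (abs_nonneg _).trans (hC 1 (1/2) one_pos (by norm_num))
  refine tendsto_integral_filter_of_dominated_convergence
    (fun u => C * (u ^ (ν - 1) * Real.exp (-c * u))) ?_ ?_ ?_ ?_
  · refine Eventually.of_forall fun lam => ?_
    have := hHm lam
    have : Measurable fun u : ℝ => H lam (u / lam) * u ^ (ν - 1) := by fun_prop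
    exact this.aestronglyMeasurable
  · filter_upwards [eventually_gt_atTop 0] with lam hlam
    filter_upwards [ae_restrict_mem measurableSet_Ioi] with u hu
    have hu : 0 < u := hu
    have hp : 0 ≤ u ^ (ν - 1) := Real.rpow_nonneg hu.le _
    rw [norm_mul, Real.norm_eq_abs, Real.norm_of_nonneg hp]
    by_cases hx : u / lam ∈ Ioo (0:ℝ) 1
    · rw [hHin _ _ hx, abs_mul, Real.abs_exp]
      have h1 : Real.exp (-lam * (φ (u / lam) - a)) ≤ Real.exp (-c * u) := by
        apply Real.exp_le_exp.2
        have := mul_le_mul_of_nonneg_left (hcφ _ hx) hlam.le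
        have e : lam * (c * (u / lam)) = c * u := by field_simp
        linarith
      have h2 := mul_le_mul h1 (hC lam _ hlam hx) (abs_nonneg _) (Real.exp_pos _).le
      have h3 := mul_le_mul_of_nonneg_right h2 hp
      linarith
    · rw [hHout _ _ hx, abs_zero, zero_mul]
      positivity
  · apply Integrable.const_mul
    have := integrableOn_rpow_mul_exp_neg_mul_rpow (p := 1) (s := ν - 1) (b := c) (by linarith) one_pos hc
    simpa [IntegrableOn] using this
  · filter_upwards [ae_restrict_mem measurableSet_Ioi] with u hu
    have hu : 0 < u := hu
    apply Tendsto.mul_const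
    have hto0 : Tendsto (fun lam : ℝ => u / lam) atTop (𝓝[>] 0) := by
      rw [tendsto_nhdsWithin_iff]
      refine ⟨tendsto_const_nhds.div_atTop tendsto_id, ?_⟩
      filter_upwards [eventually_gt_atTop 0] with lam hlam
      exact div_pos hu hlam
    have h1 : Tendsto (fun lam : ℝ => Real.exp (-(((φ (u / lam) - a) / (u / lam)) * u)) * f lam (u / lam))
        atTop (𝓝 (Real.exp (-(b * u)) * L)) := by
      refine Tendsto.mul ?_ (hf_lim u hu)
      exact (Real.continuous_exp.tendsto _).comp (((hlim.comp hto0).mul_const u).neg)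
    refine h1.congr' ?_
    filter_upwards [eventually_gt_atTop 0, eventually_gt_atTop u] with lam hlam hlu
    rw [hHin _ _ ⟨div_pos hu hlam, (div_lt_one hlam).2 hlu⟩]
    congr 2
    field_simp
end

section
/- Let 0 < c < 1, δ₁, δ₂ > 0 and z₁, z₂, z₃ > 0. Then lim_{ε→0+} q(z₂,z₃;ε,z₁)/q(z₂;ε,z₁) = q(z₂,z₃;z₁)/q(z₂;z₁), where the functions q are defined in the context. -/
open MeasureTheory Filter Set Topology

/-- The modified Bessel function of the first kind `I_ν(x)`. -/
noncomputable def besselI (ν x : ℝ) : ℝ :=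
  ∑' k : ℕ, (x / 2) ^ (2 * (k : ℝ) + ν) / ((Nat.factorial k : ℝ) * Real.Gamma ((k : ℝ) + ν + 1))

/-- The squared Bessel transition density `p_t^δ(x, y)` for `x, y > 0`. -/
noncomputable def sqBesselP (δ t x y : ℝ) : ℝ :=
  (2 * t)⁻¹ * (y / x) ^ ((δ - 2) / 4) * Real.exp (-(x + y) / (2 * t)) *
    besselI ((δ - 2) / 2) (Real.sqrt (x * y) / t)

/-- The squared Bessel entrance density from `0`, `p_t^δ(0+, y)`. -/
noncomputable def sqBesselP0 (δ t y : ℝ) : ℝ :=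
  y ^ (δ / 2 - 1) / ((2 * t) ^ (δ / 2) * Real.Gamma (δ / 2)) * Real.exp (-y / (2 * t))

/-- The joint density `q(z₂, z₃; ε, z₁)` of `(Z^c(ε), Z^c(1), Z^c(2))`. -/
noncomputable def qThreeE (c δ₁ δ₂ ε z₁ z₂ z₃ : ℝ) : ℝ :=
  ∫ x₁ in Ioo (0 : ℝ) z₁, ∫ x₂ in Ioo (0 : ℝ) z₂, ∫ x₃ in Ioo (0 : ℝ) z₃,
    sqBesselP0 δ₁ ε x₁ * sqBesselP0 δ₂ ε (z₁ - c * x₁) *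
    sqBesselP δ₁ (1 - ε) x₁ x₂ * sqBesselP δ₂ (1 - ε) (z₁ - c * x₁) (z₂ - c * x₂) *
    sqBesselP δ₁ 1 x₂ x₃ * sqBesselP δ₂ 1 (z₂ - c * x₂) (z₃ - c * x₃)

/-- The joint density `q(z₂; ε, z₁)` of `(Z^c(ε), Z^c(1))`. -/
noncomputable def qTwoE (c δ₁ δ₂ ε z₁ z₂ : ℝ) : ℝ :=
  ∫ x₁ in Ioo (0 : ℝ) z₁, ∫ x₂ in Ioo (0 : ℝ) z₂,
    sqBesselP0 δ₁ ε x₁ * sqBesselP0 δ₂ ε (z₁ - c * x₁) *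
    sqBesselP δ₁ (1 - ε) x₁ x₂ * sqBesselP δ₂ (1 - ε) (z₁ - c * x₁) (z₂ - c * x₂)

/-- The limit density `q(z₂, z₃; z₁)` from Lemma 4.2. -/
noncomputable def qThree (c δ₁ δ₂ z₁ z₂ z₃ : ℝ) : ℝ :=
  ∫ x₂ in Ioo (0 : ℝ) z₂, ∫ x₃ in Ioo (0 : ℝ) z₃,
    sqBesselP0 δ₁ 1 x₂ * sqBesselP δ₂ 1 z₁ (z₂ - c * x₂) *
    sqBesselP δ₁ 1 x₂ x₃ * sqBesselP δ₂ 1 (z₂ - c * x₂) (z₃ - c * x₃)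

/-- The limit density `q(z₂; z₁)` from Lemma 4.2. -/
noncomputable def qTwo (c δ₁ δ₂ z₁ z₂ : ℝ) : ℝ :=
  ∫ x₂ in Ioo (0 : ℝ) z₂, sqBesselP0 δ₁ 1 x₂ * sqBesselP δ₂ 1 z₁ (z₂ - c * x₂)

/-- The function `q̃(z₂; z₁)` from Lemma 4.3. -/
noncomputable def qTilde (c δ₁ δ₂ z₁ z₂ : ℝ) : ℝ :=
  ∫ x₂ in Ioo (0 : ℝ) z₂,
    x₂ ^ (1 - δ₁ / 2) * (z₂ - c * x₂) ^ (1 - δ₂ / 2) *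
    sqBesselP0 δ₁ 1 x₂ ^ 2 * sqBesselP δ₂ 1 z₁ (z₂ - c * x₂) * sqBesselP0 δ₂ 1 (z₂ - c * x₂)


/-- Entire function underlying the Bessel function. -/
noncomputable def besB (a s : ℝ) : ℝ :=
  ∑' k : ℕ, s ^ k / ((Nat.factorial k : ℝ) * Real.Gamma ((k : ℝ) + a))

lemma besB_den_pos {a : ℝ} (ha : 0 < a) (k : ℕ) :
    0 < (Nat.factorial k : ℝ) * Real.Gamma ((k : ℝ) + a) := by
  have : 0 < Real.Gamma ((k : ℝ) + a) := Real.Gamma_pos_of_pos (by positivity)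
  positivity

lemma besB_summable_pos {a : ℝ} (ha : 0 < a) {s : ℝ} (hs : 0 < s) :
    Summable (fun k : ℕ => s ^ k / ((Nat.factorial k : ℝ) * Real.Gamma ((k : ℝ) + a))) := by
  apply summable_of_ratio_test_tendsto_lt_one (l := 0) one_pos
  · filter_upwards with k
    exact (div_pos (pow_pos hs k) (besB_den_pos ha k)).ne'
  · have h1 : Tendsto (fun k : ℕ => s * (((k : ℝ) + 1)⁻¹ * ((k : ℝ) + a)⁻¹)) atTop (𝓝 (s * (0 * 0))) := by
      refine Tendsto.const_mul _ (Tendsto.mul ?_ ?_)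
      · exact tendsto_inv_atTop_zero.comp (tendsto_atTop_add_const_right _ _ tendsto_natCast_atTop_atTop)
      · exact tendsto_inv_atTop_zero.comp (tendsto_atTop_add_const_right _ _ tendsto_natCast_atTop_atTop)
    simp only [mul_zero] at h1
    refine h1.congr (fun k => ?_)
    have hk : 0 < (k : ℝ) + a := by positivity
    have hG : 0 < Real.Gamma ((k : ℝ) + a) := Real.Gamma_pos_of_pos hk
    have h2 : Real.Gamma (((k + 1 : ℕ) : ℝ) + a) = ((k : ℝ) + a) * Real.Gamma ((k : ℝ) + a) := by
      rw [← Real.Gamma_add_one hk.ne']; congr 1; push_cast; ring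
    rw [h2, Real.norm_of_nonneg (by positivity), Real.norm_of_nonneg (by positivity),
      Nat.factorial_succ]
    have : (0:ℝ) < (Nat.factorial k : ℝ) := by positivity
    push_cast
    field_simp
    ring

lemma besB_continuous {a : ℝ} (ha : 0 < a) : Continuous (besB a) := by
  rw [continuous_iff_continuousAt]
  intro s
  have hR : 0 < |s| + 1 := by positivity
  have : ContinuousOn (besB a) (Icc (-(|s| + 1)) (|s| + 1)) := by
    unfold besB
    refine continuousOn_tsum (fun k => by fun_prop) (besB_summable_pos ha hR) ?_
    intro k x hx
    rw [norm_div, norm_pow, Real.norm_of_nonneg (besB_den_pos ha k).le]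
    have hx' : ‖x‖ ≤ |s| + 1 := abs_le.mpr hx
    have := besB_den_pos ha k
    gcongr
  refine this.continuousAt (Icc_mem_nhds ?_ ?_)
  · linarith [neg_abs_le s]
  · linarith [le_abs_self s]

lemma besB_zero {a : ℝ} : besB a 0 = 1 / Real.Gamma a := by
  unfold besB
  rw [tsum_eq_single 0]
  · simp
  · intro k hk
    simp [hk]

lemma besB_summable {a : ℝ} (ha : 0 < a) {s : ℝ} (hs : 0 ≤ s) :
    Summable (fun k : ℕ => s ^ k / ((Nat.factorial k : ℝ) * Real.Gamma ((k : ℝ) + a))) := by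
  refine Summable.of_nonneg_of_le (fun k => ?_) (fun k => ?_) (besB_summable_pos ha (show 0 < s + 1 by positivity))
  · have := besB_den_pos ha k
    positivity
  · have := besB_den_pos ha k
    gcongr
    linarith

lemma besB_mono {a : ℝ} (ha : 0 < a) {s r : ℝ} (hs : 0 ≤ s) (hr : s ≤ r) : besB a s ≤ besB a r := by
  unfold besB
  refine Summable.tsum_le_tsum (fun k => ?_) (besB_summable ha hs) (besB_summable ha (hs.trans hr))
  have := besB_den_pos ha k
  gcongr

lemma besB_pos {a : ℝ} (ha : 0 < a) {s : ℝ} (hs : 0 ≤ s) : 0 < besB a s := by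
  refine lt_of_lt_of_le ?_ (besB_mono ha le_rfl hs)
  rw [besB_zero]
  exact one_div_pos.mpr (Real.Gamma_pos_of_pos ha)

/-- Unified density. -/
noncomputable def besP (a t x y : ℝ) : ℝ :=
  (2 * t) ^ (-a) * y ^ (a - 1) * Real.exp (-(x + y) / (2 * t)) * besB a (x * y / (4 * t ^ 2))

lemma besselI_eq {ν x : ℝ} (hx : 0 < x) : besselI ν x = (x / 2) ^ ν * besB (ν + 1) (x ^ 2 / 4) := by
  unfold besselI besB
  rw [← tsum_mul_left]
  congr 1
  ext k
  rw [Real.rpow_add (by positivity), ← add_assoc]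
  have : (x / 2) ^ (2 * (k : ℝ)) = (x ^ 2 / 4) ^ k := by
    rw [show (2 * (k : ℝ)) = ((2 * k : ℕ) : ℝ) by push_cast; ring, Real.rpow_natCast, pow_mul]
    congr 1; ring
  rw [this]; ring

lemma sqBesselP_eq {δ t x y : ℝ} (ht : 0 < t) (hx : 0 < x) (hy : 0 < y) :
    sqBesselP δ t x y = besP (δ / 2) t x y := by
  unfold sqBesselP besP
  rw [besselI_eq (by positivity)]
  have e1 : (Real.sqrt (x * y) / t) ^ 2 / 4 = x * y / (4 * t ^ 2) := by
    rw [div_pow, Real.sq_sqrt (by positivity)]; field_simp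
  have e2 : (δ - 2) / 2 + 1 = δ / 2 := by ring
  rw [e1, e2]
  have e3 : (2 * t)⁻¹ * (y / x) ^ ((δ - 2) / 4) * (Real.sqrt (x * y) / t / 2) ^ ((δ - 2) / 2)
      = (2 * t) ^ (-(δ / 2)) * y ^ (δ / 2 - 1) := by
    have f1 : Real.sqrt (x * y) / t / 2 = Real.sqrt (x * y) * (2 * t)⁻¹ := by field_simp
    rw [f1, Real.mul_rpow (by positivity) (by positivity), Real.sqrt_eq_rpow, ← Real.rpow_mul (by positivity),
      Real.inv_rpow (by positivity), ← Real.rpow_neg (by positivity)]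
    have f2 : (y / x) ^ ((δ - 2) / 4) * (x * y) ^ (1 / 2 * ((δ - 2) / 2)) = y ^ (δ / 2 - 1) := by
      rw [show 1 / 2 * ((δ - 2) / 2) = (δ - 2) / 4 by ring, ← Real.mul_rpow (by positivity) (by positivity),
        show y / x * (x * y) = y ^ (2 : ℝ) by field_simp; norm_num, ← Real.rpow_mul hy.le]
      congr 1; ring
    have f3 : (2 * t)⁻¹ * (2 * t) ^ (-((δ - 2) / 2)) = (2 * t) ^ (-(δ / 2)) := by
      rw [← Real.rpow_neg_one, ← Real.rpow_add (by positivity)]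
      congr 1; ring
    rw [← f2, ← f3]; ring
  rw [← e3]; ring

lemma sqBesselP0_eq {δ t y : ℝ} (ht : 0 < t) :
    sqBesselP0 δ t y = besP (δ / 2) t 0 y := by
  unfold sqBesselP0 besP
  rw [zero_mul, zero_div, besB_zero, Real.rpow_neg (by positivity), zero_add, div_eq_mul_inv, mul_inv]
  ring

lemma besP_nonneg {a t x y : ℝ} (ha : 0 < a) (ht : 0 < t) (hx : 0 ≤ x) (hy : 0 < y) : 0 < besP a t x y := by
  have := besB_pos ha (show 0 ≤ x * y / (4 * t ^ 2) by positivity)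
  unfold besP
  positivity

lemma besP_le {a t x y M : ℝ} (ha : 0 < a) (ht : 1 / 2 ≤ t) (hx : 0 ≤ x) (hxM : x ≤ M)
    (hy : 0 < y) (hyM : y ≤ M) : besP a t x y ≤ besB a (M ^ 2) * y ^ (a - 1) := by
  have ht0 : 0 < t := by linarith
  have h1 : (2 * t) ^ (-a) ≤ 1 := Real.rpow_le_one_of_one_le_of_nonpos (by linarith) (by linarith)
  have h2 : Real.exp (-(x + y) / (2 * t)) ≤ 1 := by
    rw [Real.exp_le_one_iff]
    apply div_nonpos_of_nonpos_of_nonneg <;> linarith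
  have h3 : besB a (x * y / (4 * t ^ 2)) ≤ besB a (M ^ 2) := by
    apply besB_mono ha (by positivity)
    have : x * y ≤ M ^ 2 := by nlinarith
    refine le_trans (div_le_self (by positivity) ?_) this
    nlinarith
  have h0 := besB_pos ha (show 0 ≤ x * y / (4 * t ^ 2) by positivity)
  have hp : 0 ≤ y ^ (a - 1) := by positivity
  unfold besP
  calc _ ≤ 1 * y ^ (a - 1) * 1 * besB a (M ^ 2) := by gcongr
    _ = _ := by ring

lemma besP_measurable {a : ℝ} (ha : 0 < a) {α : Type*} [MeasurableSpace α] (t : ℝ) {f g : α → ℝ}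
    (hf : Measurable f) (hg : Measurable g) : Measurable (fun p => besP a t (f p) (g p)) := by
  unfold besP
  have := (besB_continuous ha).measurable
  refine Measurable.mul (by fun_prop) (this.comp (by fun_prop))

/-- Joint kernel. -/
noncomputable def besR (c a₁ a₂ z₁ z₂ t x₁ x₂ : ℝ) : ℝ :=
  besP a₁ t x₁ x₂ * besP a₂ t (z₁ - c * x₁) (z₂ - c * x₂)

lemma sub_mem_aux {c z x : ℝ} (hc0 : 0 < c) (hc1 : c < 1) (hx0 : 0 ≤ x) (hxz : x ≤ z) :
    (1 - c) * z ≤ z - c * x ∧ z - c * x ≤ z := by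
  constructor <;> nlinarith

lemma besR_bound {c a₁ a₂ z₁ z₂ : ℝ} (hc0 : 0 < c) (hc1 : c < 1) (ha₁ : 0 < a₁) (ha₂ : 0 < a₂)
    (hz₁ : 0 < z₁) (hz₂ : 0 < z₂) : ∃ K : ℝ, 0 ≤ K ∧ ∀ t, 1 / 2 ≤ t → ∀ x₁, 0 ≤ x₁ → x₁ ≤ z₁ →
      ∀ x₂ ∈ Ioo 0 z₂, 0 < besR c a₁ a₂ z₁ z₂ t x₁ x₂ ∧
        besR c a₁ a₂ z₁ z₂ t x₁ x₂ ≤ K * x₂ ^ (a₁ - 1) := by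
  have hl : 0 < (1 - c) * z₂ := mul_pos (by linarith) hz₂
  obtain ⟨C, hC⟩ := (isCompact_Icc (a := (1 - c) * z₂) (b := z₂)).exists_bound_of_continuousOn
    (f := fun y : ℝ => y ^ (a₂ - 1))
    (ContinuousOn.rpow_const continuousOn_id (fun x hx => Or.inl (lt_of_lt_of_le hl hx.1).ne'))
  have hC0 : 0 ≤ C := (norm_nonneg _).trans (hC z₂ ⟨by nlinarith, le_rfl⟩)
  set M := z₁ + z₂
  have hB1 := besB_pos ha₁ (sq_nonneg M)
  have hB2 := besB_pos ha₂ (sq_nonneg M)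
  refine ⟨besB a₁ (M ^ 2) * (besB a₂ (M ^ 2) * C), by positivity, ?_⟩
  intro t ht x₁ hx₁ hx₁' x₂ hx₂
  have ht0 : 0 < t := by linarith
  have A := sub_mem_aux hc0 hc1 hx₁ hx₁'
  have B := sub_mem_aux hc0 hc1 hx₂.1.le hx₂.2.le
  have hy : 0 < z₂ - c * x₂ := lt_of_lt_of_le hl B.1
  have hx : 0 < z₁ - c * x₁ := lt_of_lt_of_le (mul_pos (by linarith) hz₁) A.1
  have p1 := besP_nonneg ha₁ ht0 hx₁ hx₂.1
  have p2 := besP_nonneg ha₂ ht0 hx.le hy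
  have q1 := besP_le (M := M) ha₁ ht hx₁ (by simp only [M]; linarith) hx₂.1 (by simp only [M]; linarith [hx₂.2])
  have q2 := besP_le (M := M) ha₂ ht hx.le (by simp only [M]; linarith) hy (by simp only [M]; linarith)
  have q3 := (le_abs_self _).trans (hC (z₂ - c * x₂) B)
  refine ⟨mul_pos p1 p2, ?_⟩
  unfold besR
  have hp := Real.rpow_nonneg hx₂.1.le (a₁ - 1)
  calc _ ≤ (besB a₁ (M ^ 2) * x₂ ^ (a₁ - 1)) * (besB a₂ (M ^ 2) * C) := by
        refine mul_le_mul q1 (q2.trans ?_) p2.le (by positivity)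
        gcongr
    _ = _ := by ring

lemma besR_measurable {c a₁ a₂ z₁ z₂ t : ℝ} (ha₁ : 0 < a₁) (ha₂ : 0 < a₂) :
    Measurable (fun p : ℝ × ℝ => besR c a₁ a₂ z₁ z₂ t p.1 p.2) := by
  unfold besR
  exact (besP_measurable ha₁ t measurable_fst measurable_snd).mul
    (besP_measurable ha₂ t (by fun_prop) (by fun_prop))

lemma besP_tendsto {a y x0 : ℝ} (ha : 0 < a) {f : ℝ → ℝ}
    (hf : Tendsto f (𝓝[>] 0) (𝓝 x0)) :
    Tendsto (fun ε => besP a (1 - ε) (f ε) y) (𝓝[>] 0) (𝓝 (besP a 1 x0 y)) := by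
  unfold besP
  have ht : Tendsto (fun ε : ℝ => 1 - ε) (𝓝[>] 0) (𝓝 1) := by
    have : Tendsto (fun ε : ℝ => 1 - ε) (𝓝 0) (𝓝 (1 - 0)) := by
      exact (continuous_const.sub continuous_id).tendsto 0
    simp only [sub_zero] at this
    exact this.mono_left nhdsWithin_le_nhds
  refine Tendsto.mul (Tendsto.mul (Tendsto.mul ?_ tendsto_const_nhds) ?_) ?_
  · exact (ht.const_mul 2).rpow_const (Or.inl (by norm_num))
  · refine (Real.continuous_exp.tendsto _).comp (Tendsto.div ?_ (ht.const_mul 2) (by norm_num))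
    exact (hf.add_const y).neg
  · refine ((besB_continuous ha).tendsto _).comp (Tendsto.div (hf.mul_const y) ((ht.pow 2).const_mul 4) (by norm_num))

/-- Laplace type lemma. -/
lemma laplace_aux {a b z K L : ℝ} (ha : 0 < a) (hb : 0 < b) (hz : 0 < z) (F : ℝ → ℝ → ℝ)
    (hm : ∀ ε, Measurable (F ε)) (hK : ∀ ε, 0 < ε → ε ≤ 1 / 2 → ∀ x ∈ Ioo 0 z, |F ε x| ≤ K)
    (hL : ∀ u, 0 < u → Tendsto (fun ε => F ε (ε * u)) (𝓝[>] 0) (𝓝 L)) :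
    Tendsto (fun ε => ε ^ (-a) * ∫ x in Ioo 0 z, x ^ (a - 1) * Real.exp (-b * x / ε) * F ε x) (𝓝[>] 0)
      (𝓝 ((∫ u in Ioi (0:ℝ), u ^ (a - 1) * Real.exp (-(b * u))) * L)) := by
  rw [← integral_mul_const]
  have hev : ∀ᶠ ε : ℝ in 𝓝[>] 0, 0 < ε ∧ ε ≤ 1 / 2 := by
    filter_upwards [Ioo_mem_nhdsGT (show (0:ℝ) < 1 / 2 by norm_num)] with ε hε
    exact ⟨hε.1, hε.2.le⟩
  have hK0 : 0 ≤ K := (abs_nonneg _).trans (hK (1/2) (by norm_num) le_rfl (z / 2) ⟨by linarith, by linarith⟩)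
  have key : Tendsto (fun ε => ∫ u in Ioi (0:ℝ), u ^ (a - 1) * Real.exp (-(b * u)) *
      (Ioo 0 z).indicator (F ε) (ε * u)) (𝓝[>] 0)
      (𝓝 (∫ u in Ioi (0:ℝ), u ^ (a - 1) * Real.exp (-(b * u)) * L)) := by
    refine tendsto_integral_filter_of_dominated_convergence
      (fun u => u ^ (a - 1) * Real.exp (-(b * u)) * K) ?_ ?_ ?_ ?_
    · filter_upwards with ε
      refine Measurable.aestronglyMeasurable ?_
      refine Measurable.mul (by fun_prop) ?_
      exact ((hm ε).indicator measurableSet_Ioo).comp (by fun_prop)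
    · filter_upwards [hev] with ε hε
      filter_upwards [ae_restrict_mem measurableSet_Ioi] with u hu
      have hu' : (0:ℝ) < u := hu
      rw [norm_mul, Real.norm_of_nonneg (by positivity)]
      gcongr
      by_cases h : ε * u ∈ Ioo 0 z
      · rw [indicator_of_mem h]; exact hK ε hε.1 hε.2 _ h
      · rw [indicator_of_notMem h]; simpa using hK0
    · refine Integrable.mul_const ?_ K
      have := integrableOn_rpow_mul_exp_neg_mul_rpow (p := 1) (s := a - 1) (b := b) (by linarith) (by norm_num) hb
      refine this.congr_fun (fun u hu => ?_) measurableSet_Ioi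
      simp
    · filter_upwards [ae_restrict_mem measurableSet_Ioi] with u hu
      have hu' : (0:ℝ) < u := hu
      refine Tendsto.const_mul _ ((hL u hu').congr' ?_)
      have : ∀ᶠ ε : ℝ in 𝓝[>] 0, ε < z / u := by
        filter_upwards [Ioo_mem_nhdsGT (show (0:ℝ) < z / u by positivity)] with ε hε
        exact hε.2
      filter_upwards [hev, this] with ε hε h2
      rw [indicator_of_mem]
      exact ⟨mul_pos hε.1 hu', (lt_div_iff₀ hu').mp h2⟩
  refine key.congr' ?_
  filter_upwards [hev] with ε hε
  have h0 := hε.1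
  have e1 : ∫ x in Ioo 0 z, x ^ (a - 1) * Real.exp (-b * x / ε) * F ε x =
      ∫ x in Ioi (0:ℝ), x ^ (a - 1) * Real.exp (-b * x / ε) * (Ioo 0 z).indicator (F ε) x := by
    rw [← integral_indicator measurableSet_Ioo, ← integral_indicator measurableSet_Ioi]
    congr 1
    ext x
    by_cases h : x ∈ Ioo 0 z
    · simp [indicator_of_mem h, indicator_of_mem (show x ∈ Ioi (0:ℝ) from h.1)]
    · rw [indicator_of_notMem h]
      by_cases h' : x ∈ Ioi (0:ℝ)
      · rw [indicator_of_mem h', indicator_of_notMem h, mul_zero]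
      · rw [indicator_of_notMem h']
  have e2 := integral_comp_mul_left_Ioi
    (fun x => x ^ (a - 1) * Real.exp (-b * x / ε) * (Ioo 0 z).indicator (F ε) x) 0 h0
  rw [mul_zero, smul_eq_mul] at e2
  rw [e1]
  have e3 : ∀ I : ℝ, ε ^ (-a) * I = ε ^ (1 - a) * (ε⁻¹ * I) := by
    intro I
    rw [← mul_assoc, ← Real.rpow_neg_one ε, ← Real.rpow_add h0]
    congr 2; ring
  rw [e3, ← e2, ← integral_const_mul]
  refine setIntegral_congr_fun measurableSet_Ioi (fun u hu => ?_)
  have hu' : (0:ℝ) < u := hu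
  have f1 : -b * (ε * u) / ε = -(b * u) := by field_simp
  have f2 : ε ^ (1 - a) * ε ^ (a - 1) = 1 := by
    rw [← Real.rpow_add h0]; simp
  simp only [f1]
  rw [Real.mul_rpow h0.le hu'.le]
  calc _ = (ε ^ (1 - a) * ε ^ (a - 1)) * (u ^ (a - 1) * Real.exp (-(b * u)) * (Ioo 0 z).indicator (F ε) (ε * u)) := by
        rw [f2, one_mul]
    _ = _ := by ring

lemma rpow_intOn {a z : ℝ} (ha : 0 < a) (hz : 0 < z) :
    IntegrableOn (fun x : ℝ => x ^ (a - 1)) (Ioo 0 z) :=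
  (intervalIntegral.integrableOn_Ioo_rpow_iff hz).mpr (by linarith)

lemma besR_int_measurable {c a₁ a₂ z₁ z₂ t : ℝ} (ha₁ : 0 < a₁) (ha₂ : 0 < a₂)
    {g : ℝ → ℝ} (hg : Measurable g) :
    Measurable (fun x₁ => ∫ x₂ in Ioo 0 z₂, besR c a₁ a₂ z₁ z₂ t x₁ x₂ * g x₂) := by
  have h : StronglyMeasurable (Function.uncurry fun x₁ x₂ => besR c a₁ a₂ z₁ z₂ t x₁ x₂ * g x₂) := by
    refine Measurable.stronglyMeasurable ?_
    exact (besR_measurable ha₁ ha₂).mul (hg.comp measurable_snd)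
  exact (h.integral_prod_right (ν := volume.restrict (Ioo 0 z₂))).measurable

lemma besR_int_bound {c a₁ a₂ z₁ z₂ : ℝ} (hc0 : 0 < c) (hc1 : c < 1) (ha₁ : 0 < a₁) (ha₂ : 0 < a₂)
    (hz₁ : 0 < z₁) (hz₂ : 0 < z₂) {g : ℝ → ℝ} {Kg : ℝ} (hK0 : 0 ≤ Kg)
    (hKg : ∀ x ∈ Ioo 0 z₂, |g x| ≤ Kg) : ∃ K : ℝ, ∀ t, 1 / 2 ≤ t → ∀ x₁, 0 ≤ x₁ → x₁ ≤ z₁ →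
      |∫ x₂ in Ioo 0 z₂, besR c a₁ a₂ z₁ z₂ t x₁ x₂ * g x₂| ≤ K := by
  obtain ⟨K, hK, h⟩ := besR_bound hc0 hc1 ha₁ ha₂ hz₁ hz₂
  refine ⟨∫ x₂ in Ioo 0 z₂, K * x₂ ^ (a₁ - 1) * Kg, fun t ht x₁ hx hx' => ?_⟩
  rw [← Real.norm_eq_abs]
  refine norm_integral_le_of_norm_le (((rpow_intOn ha₁ hz₂).const_mul K).mul_const Kg) ?_
  filter_upwards [ae_restrict_mem measurableSet_Ioo] with x₂ hx₂
  obtain ⟨p, q⟩ := h t ht x₁ hx hx' x₂ hx₂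
  rw [norm_mul, Real.norm_of_nonneg p.le]
  exact mul_le_mul q (hKg _ hx₂) (norm_nonneg _) (p.le.trans q)

lemma besR_int_tendsto {c a₁ a₂ z₁ z₂ u : ℝ} (hc0 : 0 < c) (hc1 : c < 1) (ha₁ : 0 < a₁) (ha₂ : 0 < a₂)
    (hz₁ : 0 < z₁) (hz₂ : 0 < z₂) {g : ℝ → ℝ} (hg : Measurable g) {Kg : ℝ}
    (hKg : ∀ x ∈ Ioo 0 z₂, |g x| ≤ Kg) (hu : 0 < u) :
    Tendsto (fun ε => ∫ x₂ in Ioo 0 z₂, besR c a₁ a₂ z₁ z₂ (1 - ε) (ε * u) x₂ * g x₂) (𝓝[>] 0)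
      (𝓝 (∫ x₂ in Ioo 0 z₂, besR c a₁ a₂ z₁ z₂ 1 0 x₂ * g x₂)) := by
  obtain ⟨K, hK, h⟩ := besR_bound hc0 hc1 ha₁ ha₂ hz₁ hz₂
  have hid : Tendsto (fun ε : ℝ => ε * u) (𝓝[>] 0) (𝓝 0) := by
    have : Tendsto (fun ε : ℝ => ε * u) (𝓝 0) (𝓝 (0 * u)) :=
      (continuous_id.mul continuous_const).tendsto 0
    rw [zero_mul] at this
    exact this.mono_left nhdsWithin_le_nhds
  refine tendsto_integral_filter_of_dominated_convergence (fun x₂ => K * x₂ ^ (a₁ - 1) * Kg) ?_ ?_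
    (((rpow_intOn ha₁ hz₂).const_mul K).mul_const Kg) ?_
  · filter_upwards with ε
    refine Measurable.aestronglyMeasurable (Measurable.mul ?_ hg)
    exact (besR_measurable ha₁ ha₂).comp (measurable_const.prodMk measurable_id)
  · have h1 : (0:ℝ) < min (1 / 2) (z₁ / u) := by positivity
    filter_upwards [Ioo_mem_nhdsGT h1] with ε hε
    have h2 := lt_of_lt_of_le hε.2 (min_le_left _ _)
    have h3 := (lt_div_iff₀ hu).mp (lt_of_lt_of_le hε.2 (min_le_right _ _))
    filter_upwards [ae_restrict_mem measurableSet_Ioo] with x₂ hx₂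
    obtain ⟨p, q⟩ := h (1 - ε) (by linarith) (ε * u) (mul_pos hε.1 hu).le h3.le x₂ hx₂
    rw [norm_mul, Real.norm_of_nonneg p.le]
    exact mul_le_mul q (hKg _ hx₂) (norm_nonneg _) (p.le.trans q)
  · filter_upwards with x₂
    refine Tendsto.mul_const _ ?_
    unfold besR
    exact (besP_tendsto ha₁ hid).mul (besP_tendsto ha₂ ((hid.const_mul c).const_sub z₁))

/-- Outer limit for a bounded weight `g`. -/
lemma outer_tendsto {c a₁ a₂ z₁ z₂ : ℝ} (hc0 : 0 < c) (hc1 : c < 1) (ha₁ : 0 < a₁) (ha₂ : 0 < a₂)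
    (hz₁ : 0 < z₁) (hz₂ : 0 < z₂) {g : ℝ → ℝ} (hg : Measurable g) {Kg : ℝ} (hK0 : 0 ≤ Kg)
    (hKg : ∀ x ∈ Ioo 0 z₂, |g x| ≤ Kg) :
    Tendsto (fun ε => ε ^ (-a₁) * ∫ x in Ioo 0 z₁, x ^ (a₁ - 1) * Real.exp (-((1 - c) / 2) * x / ε) *
      ((z₁ - c * x) ^ (a₂ - 1) * ∫ x₂ in Ioo 0 z₂, besR c a₁ a₂ z₁ z₂ (1 - ε) x x₂ * g x₂)) (𝓝[>] 0)
      (𝓝 ((∫ u in Ioi (0:ℝ), u ^ (a₁ - 1) * Real.exp (-((1 - c) / 2 * u))) *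
        (z₁ ^ (a₂ - 1) * ∫ x₂ in Ioo 0 z₂, besR c a₁ a₂ z₁ z₂ 1 0 x₂ * g x₂))) := by
  obtain ⟨K, hK⟩ := besR_int_bound hc0 hc1 ha₁ ha₂ hz₁ hz₂ hK0 hKg
  have hl : 0 < (1 - c) * z₁ := mul_pos (by linarith) hz₁
  obtain ⟨C, hC⟩ := (isCompact_Icc (a := (1 - c) * z₁) (b := z₁)).exists_bound_of_continuousOn
    (f := fun y : ℝ => y ^ (a₂ - 1))
    (ContinuousOn.rpow_const continuousOn_id (fun x hx => Or.inl (lt_of_lt_of_le hl hx.1).ne'))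
  refine laplace_aux (K := C * K) ha₁ (by linarith) hz₁
    (fun ε x => (z₁ - c * x) ^ (a₂ - 1) * ∫ x₂ in Ioo 0 z₂, besR c a₁ a₂ z₁ z₂ (1 - ε) x x₂ * g x₂)
    (fun ε => Measurable.mul (by fun_prop) (besR_int_measurable ha₁ ha₂ hg)) ?_ ?_
  · intro ε h0 h1 x hx
    rw [abs_mul]
    have h2 := hC _ (sub_mem_aux hc0 hc1 hx.1.le hx.2.le)
    exact mul_le_mul h2 (hK _ (by linarith) x hx.1.le hx.2.le) (abs_nonneg _) ((norm_nonneg _).trans h2)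
  · intro u hu
    refine Tendsto.mul ?_ (besR_int_tendsto hc0 hc1 ha₁ ha₂ hz₁ hz₂ hg hKg hu)
    have : Tendsto (fun ε : ℝ => z₁ - c * (ε * u)) (𝓝 0) (𝓝 (z₁ - c * (0 * u))) :=
      (Continuous.tendsto (by fun_prop) 0)
    rw [zero_mul, mul_zero, sub_zero] at this
    exact (this.mono_left nhdsWithin_le_nhds).rpow_const (Or.inl hz₁.ne')

lemma entrance_eq {c a₁ a₂ ε z x : ℝ} (hε : 0 < ε) :
    besP a₁ ε 0 x * besP a₂ ε 0 (z - c * x) =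
      ((2 * ε) ^ (-a₁) * (2 * ε) ^ (-a₂) * (1 / Real.Gamma a₁) * (1 / Real.Gamma a₂) *
        Real.exp (-z / (2 * ε))) *
      (x ^ (a₁ - 1) * Real.exp (-((1 - c) / 2) * x / ε) * (z - c * x) ^ (a₂ - 1)) := by
  unfold besP
  have h : Real.exp (-(0 + x) / (2 * ε)) * Real.exp (-(0 + (z - c * x)) / (2 * ε)) =
      Real.exp (-z / (2 * ε)) * Real.exp (-((1 - c) / 2) * x / ε) := by
    rw [← Real.exp_add, ← Real.exp_add]; congr 1; field_simp; ring
  simp only [zero_mul, zero_div, besB_zero]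
  calc _ = ((2 * ε) ^ (-a₁) * (2 * ε) ^ (-a₂) * (1 / Real.Gamma a₁) * (1 / Real.Gamma a₂)) *
      (x ^ (a₁ - 1) * (z - c * x) ^ (a₂ - 1)) *
      (Real.exp (-(0 + x) / (2 * ε)) * Real.exp (-(0 + (z - c * x)) / (2 * ε))) := by ring
    _ = _ := by rw [h]; ring

/-- **Theorem (Statement 10, Lemma 4.2).** For `0 < c < 1`, `δ₁, δ₂ > 0` and
`z₁, z₂, z₃ > 0`, `lim_{ε→0+} q(z₂,z₃;ε,z₁)/q(z₂;ε,z₁) = q(z₂,z₃;z₁)/q(z₂;z₁)`. -/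
theorem statement10 (c δ₁ δ₂ z₁ z₂ z₃ : ℝ) (hc0 : 0 < c) (hc1 : c < 1)
    (hδ₁ : 0 < δ₁) (hδ₂ : 0 < δ₂) (hz₁ : 0 < z₁) (hz₂ : 0 < z₂) (hz₃ : 0 < z₃) :
    Tendsto (fun ε => qThreeE c δ₁ δ₂ ε z₁ z₂ z₃ / qTwoE c δ₁ δ₂ ε z₁ z₂) (𝓝[>] 0)
      (𝓝 (qThree c δ₁ δ₂ z₁ z₂ z₃ / qTwo c δ₁ δ₂ z₁ z₂)) := by
  have ha₁ : 0 < δ₁ / 2 := by linarith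
  have ha₂ : 0 < δ₂ / 2 := by linarith
  set a₁ := δ₁ / 2 with ha₁d
  set a₂ := δ₂ / 2 with ha₂d
  have sub_pos' : ∀ {z x : ℝ}, 0 < z → x ∈ Ioo 0 z → 0 < z - c * x := by
    intro z x hz hx
    exact lt_of_lt_of_le (mul_pos (by linarith) hz) (sub_mem_aux hc0 hc1 hx.1.le hx.2.le).1
  -- the weight coming from the last transition
  let G : ℝ → ℝ := fun x₂ => ∫ x₃ in Ioo 0 z₃, besR c a₁ a₂ z₂ z₃ 1 x₂ x₃ * (1 : ℝ)
  have hGm : Measurable G := besR_int_measurable ha₁ ha₂ measurable_const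
  obtain ⟨KG, hKG⟩ := besR_int_bound (g := fun _ => (1:ℝ)) (Kg := 1) hc0 hc1 ha₁ ha₂ hz₂ hz₃ zero_le_one
    (by intro x _; simp)
  have hKG' : ∀ x ∈ Ioo 0 z₂, |G x| ≤ KG := fun x hx => hKG 1 (by norm_num) x hx.1.le hx.2.le
  have hKG0 : 0 ≤ KG := (abs_nonneg _).trans (hKG' (z₂ / 2) ⟨by linarith, by linarith⟩)
  have T3 := outer_tendsto hc0 hc1 ha₁ ha₂ hz₁ hz₂ hGm hKG0 hKG'
  have T2 := outer_tendsto (g := fun _ => (1:ℝ)) (Kg := 1) hc0 hc1 ha₁ ha₂ hz₁ hz₂ measurable_const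
    zero_le_one (by intro x _; simp)
  -- identification of the limits
  have q3 : qThree c δ₁ δ₂ z₁ z₂ z₃ = ∫ x₂ in Ioo 0 z₂, besR c a₁ a₂ z₁ z₂ 1 0 x₂ * G x₂ := by
    unfold qThree
    refine setIntegral_congr_fun measurableSet_Ioo (fun x₂ hx₂ => ?_)
    simp only [G]
    rw [← integral_const_mul]
    refine setIntegral_congr_fun measurableSet_Ioo (fun x₃ hx₃ => ?_)
    have h2 := sub_pos' hz₂ hx₂
    have h3 := sub_pos' hz₃ hx₃
    simp only [besR]
    rw [sqBesselP0_eq one_pos, sqBesselP_eq one_pos hz₁ h2, sqBesselP_eq one_pos hx₂.1 hx₃.1,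
      sqBesselP_eq one_pos h2 h3, mul_zero, sub_zero]
    ring
  have q2 : qTwo c δ₁ δ₂ z₁ z₂ = ∫ x₂ in Ioo 0 z₂, besR c a₁ a₂ z₁ z₂ 1 0 x₂ * 1 := by
    unfold qTwo
    refine setIntegral_congr_fun measurableSet_Ioo (fun x₂ hx₂ => ?_)
    have h2 := sub_pos' hz₂ hx₂
    simp only [besR]
    rw [sqBesselP0_eq one_pos, sqBesselP_eq one_pos hz₁ h2, mul_zero, sub_zero, mul_one]
  have q2pos : 0 < ∫ x₂ in Ioo 0 z₂, besR c a₁ a₂ z₁ z₂ 1 0 x₂ * 1 := by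
    obtain ⟨K, hK, h⟩ := besR_bound hc0 hc1 ha₁ ha₂ hz₁ hz₂
    have h' := h 1 (by norm_num) 0 le_rfl hz₁.le
    rw [setIntegral_pos_iff_support_of_nonneg_ae]
    · refine lt_of_lt_of_le (b := volume (Ioo 0 z₂)) (by simp [hz₂]) (measure_mono ?_)
      intro x hx
      refine ⟨?_, hx⟩
      simpa using (h' x hx).1.ne'
    · filter_upwards [ae_restrict_mem measurableSet_Ioo] with x hx
      simpa using (h' x hx).1.le
    · refine Integrable.mono' ((rpow_intOn ha₁ hz₂).const_mul K) ?_ ?_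
      · refine Measurable.aestronglyMeasurable (Measurable.mul ?_ measurable_const)
        exact (besR_measurable ha₁ ha₂).comp (measurable_const.prodMk measurable_id)
      · filter_upwards [ae_restrict_mem measurableSet_Ioo] with x hx
        rw [mul_one, Real.norm_of_nonneg (h' x hx).1.le]
        exact (h' x hx).2
  set J := ∫ u in Ioi (0:ℝ), u ^ (a₁ - 1) * Real.exp (-((1 - c) / 2 * u)) with hJ
  have hJpos : 0 < J := by
    rw [hJ, Real.integral_rpow_mul_exp_neg_mul_Ioi ha₁ (by linarith)]
    have := Real.Gamma_pos_of_pos ha₁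
    have h1 : 0 < (1 - c) / 2 := by linarith
    positivity
  have hzp : 0 < z₁ ^ (a₂ - 1) := Real.rpow_pos_of_pos hz₁ _
  have T := T3.div T2 (mul_pos hJpos (mul_pos hzp q2pos)).ne'
  rw [mul_div_mul_left _ _ hJpos.ne', mul_div_mul_left _ _ hzp.ne', ← q3, ← q2] at T
  refine T.congr' ?_
  filter_upwards [Ioo_mem_nhdsGT (show (0:ℝ) < 1 by norm_num)] with ε hε
  have h0 := hε.1
  have h1 : 0 < 1 - ε := by linarith [hε.2]
  have hG1 := Real.Gamma_pos_of_pos ha₁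
  have hG2 := Real.Gamma_pos_of_pos ha₂
  let D : ℝ := (2 * ε) ^ (-a₁) * (2 * ε) ^ (-a₂) * (1 / Real.Gamma a₁) * (1 / Real.Gamma a₂) *
        Real.exp (-z₁ / (2 * ε))
  have hD : 0 < D := by simp only [D]; positivity
  have e3 : qThreeE c δ₁ δ₂ ε z₁ z₂ z₃ = D * ∫ x in Ioo 0 z₁, x ^ (a₁ - 1) *
      Real.exp (-((1 - c) / 2) * x / ε) * ((z₁ - c * x) ^ (a₂ - 1) *
        ∫ x₂ in Ioo 0 z₂, besR c a₁ a₂ z₁ z₂ (1 - ε) x x₂ * G x₂) := by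
    unfold qThreeE
    rw [← integral_const_mul]
    refine setIntegral_congr_fun measurableSet_Ioo (fun x₁ hx₁ => ?_)
    have p1 := sub_pos' hz₁ hx₁
    have e := entrance_eq (c := c) (a₁ := a₁) (a₂ := a₂) (z := z₁) (x := x₁) h0
    have e' : ∀ I : ℝ, D * (x₁ ^ (a₁ - 1) * Real.exp (-((1 - c) / 2) * x₁ / ε) *
        ((z₁ - c * x₁) ^ (a₂ - 1) * I)) = besP a₁ ε 0 x₁ * besP a₂ ε 0 (z₁ - c * x₁) * I := by
      intro I; rw [e]; simp only [D]; ring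
    rw [e', ← integral_const_mul]
    refine setIntegral_congr_fun measurableSet_Ioo (fun x₂ hx₂ => ?_)
    have p2 := sub_pos' hz₂ hx₂
    simp only [G]
    rw [← mul_assoc, ← integral_const_mul]
    refine setIntegral_congr_fun measurableSet_Ioo (fun x₃ hx₃ => ?_)
    have p3 := sub_pos' hz₃ hx₃
    simp only [besR]
    rw [sqBesselP0_eq h0, sqBesselP0_eq h0, sqBesselP_eq h1 hx₁.1 hx₂.1, sqBesselP_eq h1 p1 p2,
      sqBesselP_eq one_pos hx₂.1 hx₃.1, sqBesselP_eq one_pos p2 p3]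
    ring
  have e2 : qTwoE c δ₁ δ₂ ε z₁ z₂ = D * ∫ x in Ioo 0 z₁, x ^ (a₁ - 1) *
      Real.exp (-((1 - c) / 2) * x / ε) * ((z₁ - c * x) ^ (a₂ - 1) *
        ∫ x₂ in Ioo 0 z₂, besR c a₁ a₂ z₁ z₂ (1 - ε) x x₂ * 1) := by
    unfold qTwoE
    rw [← integral_const_mul]
    refine setIntegral_congr_fun measurableSet_Ioo (fun x₁ hx₁ => ?_)
    have p1 := sub_pos' hz₁ hx₁
    have e := entrance_eq (c := c) (a₁ := a₁) (a₂ := a₂) (z := z₁) (x := x₁) h0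
    have e' : ∀ I : ℝ, D * (x₁ ^ (a₁ - 1) * Real.exp (-((1 - c) / 2) * x₁ / ε) *
        ((z₁ - c * x₁) ^ (a₂ - 1) * I)) = besP a₁ ε 0 x₁ * besP a₂ ε 0 (z₁ - c * x₁) * I := by
      intro I; rw [e]; simp only [D]; ring
    rw [e', ← integral_const_mul]
    refine setIntegral_congr_fun measurableSet_Ioo (fun x₂ hx₂ => ?_)
    have p2 := sub_pos' hz₂ hx₂
    simp only [besR]
    rw [sqBesselP0_eq h0, sqBesselP0_eq h0, sqBesselP_eq h1 hx₁.1 hx₂.1, sqBesselP_eq h1 p1 p2]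
    ring
  rw [e3, e2, mul_div_mul_left _ _ hD.ne']
  exact mul_div_mul_left _ _ (Real.rpow_pos_of_pos h0 _).ne'
end

section
/- Let 0 < c < 1, δ₁, δ₂ > 0 and z₁, z₂ > 0. Then lim_{z₃→0+} z₃^{1−(δ₁+δ₂)/2}·q(z₂,z₃;z₁) = C₁·q̃(z₂;z₁), where C₁ = ∫₀¹ u^{δ₁/2−1}(1−c·u)^{δ₂/2−1} du and q(z₂,z₃;z₁) and q̃(z₂;z₁) are defined in the context. -/
open MeasureTheory Filter Set Topology

noncomputable def besF (a s : ℝ) : ℝ :=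
  ∑' k : ℕ, s ^ k / ((Nat.factorial k : ℝ) * Real.Gamma ((k : ℝ) + a))

lemma gamma_lower (a : ℝ) (ha : 0 < a) : ∃ m : ℝ, 0 < m ∧ ∀ k : ℕ, m ≤ Real.Gamma ((k : ℝ) + a) := by
  refine ⟨min (Real.Gamma a) (Real.Gamma (1 + a)),
    lt_min (Real.Gamma_pos_of_pos ha) (Real.Gamma_pos_of_pos (by linarith)), ?_⟩
  intro k
  rcases k with _ | k
  · simp
  · refine le_trans (min_le_right _ _) ?_
    induction k with
    | zero => simp
    | succ n ih =>
      have h : ((n + 1 + 1 : ℕ) : ℝ) + a = (((n + 1 : ℕ) : ℝ) + a) + 1 := by push_cast; ring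
      have hp : 0 < (((n + 1 : ℕ) : ℝ) + a) := by positivity
      rw [h, Real.Gamma_add_one hp.ne']
      have h1 : 1 ≤ (((n + 1 : ℕ) : ℝ) + a) := by
        push_cast; have : (0 : ℝ) ≤ n := by positivity
        linarith
      have := Real.Gamma_pos_of_pos hp
      nlinarith

lemma besF_continuous (a : ℝ) (ha : 0 < a) : Continuous (besF a) := by
  obtain ⟨m, hm, hk⟩ := gamma_lower a ha
  rw [continuous_iff_continuousAt]
  intro x
  have hcont : ContinuousOn (besF a) (Metric.closedBall 0 (|x| + 1)) := by
    unfold besF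
    refine continuousOn_tsum (u := fun k : ℕ => (|x| + 1) ^ k / (Nat.factorial k : ℝ) / m) ?_ ?_ ?_
    · intro k; fun_prop
    · exact (Real.summable_pow_div_factorial _).div_const m
    · intro k s hs
      have hs' : |s| ≤ |x| + 1 := by simpa using hs
      have hf : (0 : ℝ) < Nat.factorial k := by positivity
      rw [norm_div, norm_pow, div_div, Real.norm_eq_abs, Real.norm_of_nonneg]
      · gcongr
        exact hk k
      · exact mul_nonneg hf.le (hm.le.trans (hk k))
  refine hcont.continuousAt (Metric.closedBall_mem_nhds_of_mem ?_)
  simp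

lemma besF_zero (a : ℝ) : besF a 0 = 1 / Real.Gamma a := by
  unfold besF
  rw [tsum_eq_single 0]
  · simp
  · intro k hk; simp [hk]

lemma sqBesselP_eq_s11 (δ x y : ℝ) (hx : 0 < x) (hy : 0 < y) :
    sqBesselP δ 1 x y = y ^ (δ / 2 - 1) *
      ((2 : ℝ) ^ (-(δ / 2)) * Real.exp (-(x + y) / 2) * besF (δ / 2) (x * y / 4)) := by
  have hX := Real.sqrt_pos.2 hx
  have hY := Real.sqrt_pos.2 hy
  have hs : 0 < √(x * y) / 2 := by positivity
  have hB : besselI ((δ - 2) / 2) (√(x * y) / 1) =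
      (√(x * y) / 2) ^ ((δ - 2) / 2) * besF (δ / 2) (x * y / 4) := by
    unfold besselI besF
    rw [← tsum_mul_left]
    congr 1; ext k
    have h1 : (√(x * y) / 1 / 2) ^ (2 * (k : ℝ) + (δ - 2) / 2) =
        (√(x * y) / 2) ^ ((δ - 2) / 2) * (x * y / 4) ^ k := by
      rw [div_one, Real.rpow_add hs, mul_comm, Real.rpow_mul hs.le, Real.rpow_natCast]
      congr 2
      rw [Real.rpow_two, div_pow, Real.sq_sqrt (by positivity)]; norm_num
    rw [h1, mul_div_assoc]
    congr 4; ring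
  have hpow : (2 : ℝ)⁻¹ * (y / x) ^ ((δ - 2) / 4) * (√(x * y) / 2) ^ ((δ - 2) / 2) =
      y ^ (δ / 2 - 1) * (2 : ℝ) ^ (-(δ / 2)) := by
    have e1 : (√(x * y) / 2) ^ ((δ - 2) / 2) = (x * y / 4) ^ ((δ - 2) / 4) := by
      have : x * y / 4 = (√(x * y) / 2) ^ (2 : ℝ) := by
        rw [Real.rpow_two, div_pow, Real.sq_sqrt (by positivity)]; norm_num
      rw [this, ← Real.rpow_mul hs.le]; congr 1; ring
    have e2 : (y / x) * (x * y / 4) = (y / 2) ^ (2 : ℝ) := by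
      rw [Real.rpow_two]; field_simp; norm_num
    rw [e1, mul_assoc, ← Real.mul_rpow (by positivity) (by positivity), e2,
      ← Real.rpow_mul (by positivity), Real.div_rpow hy.le (by norm_num),
      show (2 : ℝ) * ((δ - 2) / 4) = δ / 2 - 1 by ring, show -(δ / 2) = - (δ / 2 - 1) + (-1) by ring,
      Real.rpow_add (by norm_num), Real.rpow_neg (by norm_num), Real.rpow_neg_one]
    ring
  unfold sqBesselP
  rw [hB, mul_one]
  calc _ = ((2 : ℝ)⁻¹ * (y / x) ^ ((δ - 2) / 4) * (√(x * y) / 2) ^ ((δ - 2) / 2)) *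
        Real.exp (-(x + y) / 2) * besF (δ / 2) (x * y / 4) := by ring
    _ = _ := by rw [hpow]; ring

lemma weighted_cont {X : Type*} [TopologicalSpace X] [FirstCountableTopology X]
    [LocallyCompactSpace X] (Z : ℝ) (w : ℝ → ℝ) (hw : IntegrableOn w (Ioo 0 Z))
    (G : X → ℝ → ℝ) (hG : Continuous (fun p : X × ℝ => G p.1 p.2)) :
    Continuous (fun x => ∫ u in Ioo 0 Z, w u * G x u) := by
  rw [continuous_iff_continuousAt]
  intro x
  obtain ⟨K, hK, hxK⟩ := exists_compact_mem_nhds x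
  obtain ⟨M, hM⟩ := (hK.prod (isCompact_Icc (a := (0 : ℝ)) (b := Z))).exists_bound_of_continuousOn
    hG.continuousOn
  refine continuousAt_of_dominated (bound := fun u => ‖w u‖ * M) ?_ ?_ ?_ ?_
  · refine Eventually.of_forall fun y => ?_
    refine hw.aestronglyMeasurable.mul ?_
    have : Continuous (G y) := hG.comp (by fun_prop : Continuous (fun u : ℝ => (y, u)))
    exact this.aestronglyMeasurable
  · filter_upwards [hxK] with y hy
    refine (ae_restrict_mem measurableSet_Ioo).mono fun u hu => ?_
    rw [norm_mul]
    gcongr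
    exact hM (y, u) ⟨hy, Ioo_subset_Icc_self hu⟩
  · exact hw.norm.mul_const M
  · refine Eventually.of_forall fun u => ?_
    have : Continuous (fun y => G y u) := hG.comp (by fun_prop : Continuous (fun y : X => (y, u)))
    exact (continuous_const.mul this).continuousAt

lemma weight_integrable (c a b Z : ℝ) (hc1 : c < 1) (hc0 : 0 < c) (ha : 0 < a) (hZ : 0 < Z) :
    IntegrableOn (fun u => u ^ (a - 1) * (Z - c * u) ^ (b - 1)) (Ioo 0 Z) := by
  have h1 : IntegrableOn (fun u : ℝ => u ^ (a - 1)) (Icc 0 Z) := by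
    rw [integrableOn_Icc_iff_integrableOn_Ioc, ← intervalIntegrable_iff_integrableOn_Ioc_of_le hZ.le]
    exact intervalIntegral.intervalIntegrable_rpow' (by linarith)
  refine (h1.mul_continuousOn ?_ isCompact_Icc).mono_set Ioo_subset_Icc_self
  refine ContinuousOn.rpow_const (by fun_prop) fun u hu => Or.inl ?_
  have : c * u < Z := by nlinarith [hu.1, hu.2]
  linarith

/-- smooth factor in the transition density -/
noncomputable def gF (δ x y : ℝ) : ℝ :=
  (2 : ℝ) ^ (-(δ / 2)) * Real.exp (-(x + y) / 2) * besF (δ / 2) (x * y / 4)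

lemma gF_continuous (δ : ℝ) (hδ : 0 < δ) : Continuous (fun p : ℝ × ℝ => gF δ p.1 p.2) := by
  have := besF_continuous (δ / 2) (by linarith)
  unfold gF
  fun_prop

lemma P0_eq (δ x : ℝ) : sqBesselP0 δ 1 x = x ^ (δ / 2 - 1) * gF δ x 0 := by
  unfold gF sqBesselP0
  rw [mul_zero, zero_div, besF_zero, Real.rpow_neg (by norm_num)]
  simp only [mul_one, add_zero]
  rw [div_eq_mul_inv, mul_inv, one_div]
  ring

lemma gF_zero (δ x : ℝ) (hx : 0 < x) : gF δ x 0 = x ^ (1 - δ / 2) * sqBesselP0 δ 1 x := by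
  have h : x ^ (1 - δ / 2) * x ^ (δ / 2 - 1) = 1 := by
    rw [← Real.rpow_add hx]; simp
  rw [P0_eq, ← mul_assoc, h, one_mul]

/-- **Theorem (Statement 11, Lemma 4.3).** For `0 < c < 1`, `δ₁, δ₂ > 0` and `z₁, z₂ > 0`,
`lim_{z₃→0+} z₃^{1−(δ₁+δ₂)/2} q(z₂,z₃;z₁) = C₁ q̃(z₂;z₁)` with
`C₁ = ∫₀¹ u^{δ₁/2−1}(1−cu)^{δ₂/2−1} du`. -/
theorem statement11 (c δ₁ δ₂ z₁ z₂ : ℝ) (hc0 : 0 < c) (hc1 : c < 1)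
    (hδ₁ : 0 < δ₁) (hδ₂ : 0 < δ₂) (hz₁ : 0 < z₁) (hz₂ : 0 < z₂) :
    Tendsto (fun z₃ => z₃ ^ (1 - (δ₁ + δ₂) / 2) * qThree c δ₁ δ₂ z₁ z₂ z₃) (𝓝[>] 0)
      (𝓝 ((∫ u in Ioo (0 : ℝ) 1, u ^ (δ₁ / 2 - 1) * (1 - c * u) ^ (δ₂ / 2 - 1)) *
        qTilde c δ₁ δ₂ z₁ z₂)) := by
  have pos : ∀ Z x : ℝ, x ∈ Ioo 0 Z → 0 < Z - c * x := fun Z x hx => by nlinarith [hx.1, hx.2]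
  have c1 := gF_continuous δ₁ hδ₁
  have c2 := gF_continuous δ₂ hδ₂
  set W : ℝ → ℝ → ℝ := fun Z u => u ^ (δ₁ / 2 - 1) * (Z - c * u) ^ (δ₂ / 2 - 1) with hW
  set G : ℝ × ℝ → ℝ → ℝ := fun p u =>
    gF δ₁ p.2 (p.1 * u) * gF δ₂ (z₂ - c * p.2) (p.1 * (1 - c * u)) with hG
  set K : ℝ → ℝ := fun x => gF δ₁ x 0 * gF δ₂ z₁ (z₂ - c * x) with hK
  have cG : Continuous (fun p : (ℝ × ℝ) × ℝ => G p.1 p.2) := by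
    refine Continuous.mul ?_ ?_
    · exact c1.comp (by fun_prop : Continuous fun p : (ℝ × ℝ) × ℝ => (p.1.2, p.1.1 * p.2))
    · exact c2.comp (by fun_prop : Continuous fun p : (ℝ × ℝ) × ℝ =>
        (z₂ - c * p.1.2, p.1.1 * (1 - c * p.2)))
  have cK : Continuous K := by
    refine Continuous.mul ?_ ?_
    · exact c1.comp (by fun_prop : Continuous fun x : ℝ => (x, (0 : ℝ)))
    · exact c2.comp (by fun_prop : Continuous fun x : ℝ => (z₁, z₂ - c * x))
  have cH := weighted_cont 1 (W 1)
    (weight_integrable c (δ₁ / 2) (δ₂ / 2) 1 hc1 hc0 (by linarith) one_pos) G cG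
  have cKH : Continuous (fun p : ℝ × ℝ => K p.2 * ∫ u in Ioo 0 1, W 1 u * G p u) :=
    (cK.comp continuous_snd).mul cH
  have cT := weighted_cont z₂ (W z₂)
    (weight_integrable c (δ₁ / 2) (δ₂ / 2) z₂ hc1 hc0 (by linarith) hz₂)
    (fun z x => K x * ∫ u in Ioo 0 1, W 1 u * G (z, x) u) cKH
  have hT := (cT.tendsto 0).mono_left (nhdsWithin_le_nhds (s := Ioi 0))
  have hlim : (∫ x in Ioo 0 z₂, W z₂ x * (K x * ∫ u in Ioo 0 1, W 1 u * G (0, x) u)) =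
      (∫ u in Ioo (0 : ℝ) 1, u ^ (δ₁ / 2 - 1) * (1 - c * u) ^ (δ₂ / 2 - 1)) *
        qTilde c δ₁ δ₂ z₁ z₂ := by
    unfold qTilde
    rw [← integral_const_mul]
    refine setIntegral_congr_fun measurableSet_Ioo fun x hx => ?_
    have hp := pos _ _ hx
    simp only [hG, zero_mul, integral_mul_const]
    rw [gF_zero δ₁ x hx.1, gF_zero δ₂ _ hp, sqBesselP_eq_s11 δ₂ z₁ _ hz₁ hp]
    simp only [hK, hW]
    have e := P0_eq δ₁ x
    change _ = _ * (_ * _ * sqBesselP0 δ₁ 1 x ^ 2 * ((z₂ - c * x) ^ (δ₂ / 2 - 1) * gF δ₂ z₁ (z₂ - c * x)) * _)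
    rw [pow_two]
    nth_rewrite 3 [e]
    ring
  rw [hlim] at hT
  refine hT.congr' ?_
  filter_upwards [self_mem_nhdsWithin] with z hz
  have hz : 0 < z := hz
  unfold qThree
  rw [← integral_const_mul]
  refine setIntegral_congr_fun measurableSet_Ioo fun x hx => ?_
  have hp := pos _ _ hx
  have hsub : ∀ f : ℝ → ℝ, ∫ y in Ioo 0 z, f y = z * ∫ u in Ioo 0 1, f (z * u) := by
    intro f
    rw [← integral_Ioc_eq_integral_Ioo, ← integral_Ioc_eq_integral_Ioo,
      ← intervalIntegral.integral_of_le hz.le, ← intervalIntegral.integral_of_le zero_le_one,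
      intervalIntegral.mul_integral_comp_mul_left]
    simp
  rw [hsub, ← integral_const_mul, ← integral_const_mul, ← integral_const_mul, ← integral_const_mul]
  refine setIntegral_congr_fun measurableSet_Ioo fun u hu => ?_
  have hq := pos _ _ hu
  have hy : 0 < z * u := mul_pos hz hu.1
  have e3 : z - c * (z * u) = z * (1 - c * u) := by ring
  have hy3 : 0 < z * (1 - c * u) := mul_pos hz hq
  rw [e3, sqBesselP_eq_s11 δ₁ x _ hx.1 hy, sqBesselP_eq_s11 δ₂ _ _ hp hy3, sqBesselP_eq_s11 δ₂ _ _ hz₁ hp,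
    P0_eq, Real.mul_rpow hz.le hu.1.le, Real.mul_rpow hz.le hq.le]
  have hzz : z ^ (1 - (δ₁ + δ₂) / 2) * (z * (z ^ (δ₁ / 2 - 1) * z ^ (δ₂ / 2 - 1))) = 1 := by
    nth_rewrite 2 [← Real.rpow_one z]
    rw [← Real.rpow_add hz, ← Real.rpow_add hz, ← Real.rpow_add hz, ← Real.rpow_zero z]
    congr 1; ring
  simp only [hW, hK, hG]
  change _ = z ^ (1 - (δ₁ + δ₂) / 2) * (z * (x ^ (δ₁ / 2 - 1) * gF δ₁ x 0 *
    ((z₂ - c * x) ^ (δ₂ / 2 - 1) * gF δ₂ z₁ (z₂ - c * x)) *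
    (z ^ (δ₁ / 2 - 1) * u ^ (δ₁ / 2 - 1) * gF δ₁ x (z * u)) *
    (z ^ (δ₂ / 2 - 1) * (1 - c * u) ^ (δ₂ / 2 - 1) * gF δ₂ (z₂ - c * x) (z * (1 - c * u)))))
  generalize z ^ (1 - (δ₁ + δ₂) / 2) = A at hzz ⊢
  generalize z ^ (δ₁ / 2 - 1) = B at hzz ⊢
  generalize z ^ (δ₂ / 2 - 1) = D at hzz ⊢
  generalize gF δ₁ x 0 = g1
  generalize gF δ₂ z₁ (z₂ - c * x) = g2
  generalize gF δ₁ x (z * u) = g3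
  generalize gF δ₂ (z₂ - c * x) (z * (1 - c * u)) = g4
  generalize x ^ (δ₁ / 2 - 1) = r1
  generalize (z₂ - c * x) ^ (δ₂ / 2 - 1) = r2
  generalize u ^ (δ₁ / 2 - 1) = r3
  generalize (1 - c * u) ^ (δ₂ / 2 - 1) = r4
  linear_combination (- (r1 * r2 * r3 * r4 * g1 * g2 * g3 * g4)) * hzz
end

section
/- Let 0 < c < 1 and δ₁, δ₂ > 0. Then there exists a positive constant C₂, depending only on δ₁ and δ₂, such that for every r > 0, q̃(z₂·1; z₂·r)/q(z₂; z₂·r) ∼ C₂·D(r)^{−δ₁/2}·e^{−z₂/2} as z₂ → ∞, i.e. lim_{z₂→∞} e^{z₂/2}·q̃(z₂; z₂·r)/q(z₂; z₂·r) = C₂·D(r)^{−δ₁/2}, where D(r) = 1 + (1−c)/(1−c+c·√r) and q(z₂;z₁), q̃(z₂;z₁) are defined in the context. -/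
open MeasureTheory Filter Set Topology

/-- Coefficients of the reduced Bessel series. -/
noncomputable def bco (b : ℝ) (k : ℕ) : ℝ := 1 / ((Nat.factorial k : ℝ) * Real.Gamma ((k : ℝ) + b))

/-- Reduced Bessel series. -/
noncomputable def bJ (b w : ℝ) : ℝ := ∑' k : ℕ, bco b k * w ^ k

/-- Mean of the index under the weights of the reduced Bessel series. -/
noncomputable def bm (b w : ℝ) : ℝ := (∑' k : ℕ, (k : ℝ) * (bco b k * w ^ k)) / bJ b w

lemma bco_pos {b : ℝ} (hb : 0 < b) (k : ℕ) : 0 < bco b k := by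
  unfold bco
  have : 0 < Real.Gamma ((k : ℝ) + b) := Real.Gamma_pos_of_pos (by positivity)
  positivity

lemma bco_succ {b : ℝ} (hb : 0 < b) (k : ℕ) :
    bco b (k + 1) * (((k : ℝ) + 1) * ((k : ℝ) + b)) = bco b k := by
  unfold bco
  have h0 : (k : ℝ) + b ≠ 0 := by positivity
  have : 0 < Real.Gamma ((k : ℝ) + b) := Real.Gamma_pos_of_pos (by positivity)
  have h1 : (((k + 1 : ℕ) : ℝ) + b) = ((k : ℝ) + b) + 1 := by push_cast; ring
  rw [h1, Real.Gamma_add_one h0, Nat.factorial_succ]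
  push_cast
  field_simp

lemma bco_le {b : ℝ} (hb : 0 < b) (k : ℕ) :
    bco b k ≤ bco b 0 * ((1 / b) ^ k / (Nat.factorial k : ℝ)) := by
  induction k with
  | zero => simp
  | succ k ih =>
    have h1 : bco b (k + 1) = bco b k / (((k : ℝ) + 1) * ((k : ℝ) + b)) := by
      rw [eq_div_iff (by positivity)]; exact bco_succ hb k
    rw [h1]
    have hk := bco_pos hb k
    calc bco b k / (((k : ℝ) + 1) * ((k : ℝ) + b)) ≤ bco b k / (((k : ℝ) + 1) * b) := by
          gcongr
          linarith [Nat.cast_nonneg (α := ℝ) k]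
      _ ≤ (bco b 0 * ((1 / b) ^ k / (Nat.factorial k : ℝ))) / (((k : ℝ) + 1) * b) := by
          gcongr
      _ = _ := by
          rw [Nat.factorial_succ, pow_succ]; push_cast
          field_simp

lemma bsum0 {b : ℝ} (hb : 0 < b) {w : ℝ} (hw : 0 ≤ w) : Summable (fun k => bco b k * w ^ k) := by
  have h := (Real.summable_pow_div_factorial (w / b)).mul_left (bco b 0)
  refine Summable.of_nonneg_of_le (fun k => ?_) (fun k => ?_) h
  · have := bco_pos hb k; positivity
  · calc bco b k * w ^ k ≤ (bco b 0 * ((1 / b) ^ k / (Nat.factorial k : ℝ))) * w ^ k := by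
          gcongr; exact bco_le hb k
      _ = _ := by rw [div_pow, div_pow]; ring

lemma bJ_pos {b : ℝ} (hb : 0 < b) {w : ℝ} (hw : 0 ≤ w) : 0 < bJ b w := by
  refine (bsum0 hb hw).tsum_pos (fun k => ?_) 0 ?_
  · have := bco_pos hb k; positivity
  · simpa using bco_pos hb 0

lemma bJ_mono {b : ℝ} (hb : 0 < b) {v w : ℝ} (hv : 0 ≤ v) (h : v ≤ w) : bJ b v ≤ bJ b w := by
  refine (bsum0 hb hv).tsum_le_tsum (fun k => ?_) (bsum0 hb (hv.trans h))
  have := bco_pos hb k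
  gcongr

/-- Second moment relation. -/
lemma bsumA {b : ℝ} (hb : 0 < b) {w : ℝ} (hw : 0 ≤ w) :
    HasSum (fun k : ℕ => (k : ℝ) * ((k : ℝ) + (b - 1)) * (bco b k * w ^ k)) (w * bJ b w) := by
  rw [← hasSum_nat_add_iff' 1]
  simp only [Finset.range_one, Finset.sum_singleton, Nat.cast_zero, zero_mul, sub_zero]
  have h := (bsum0 hb hw).hasSum.mul_left w
  have he : (fun k : ℕ => ((k + 1 : ℕ) : ℝ) * (((k + 1 : ℕ) : ℝ) + (b - 1)) *
      (bco b (k + 1) * w ^ (k + 1))) = fun k => w * (bco b k * w ^ k) := by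
    funext k
    rw [← bco_succ hb k]
    push_cast
    ring
  rw [he]
  exact h

lemma bsum1 {b : ℝ} (hb : 0 < b) {w : ℝ} (hw : 0 ≤ w) :
    Summable (fun k : ℕ => (k : ℝ) * (bco b k * w ^ k)) := by
  refine Summable.of_nonneg_of_le (fun k => ?_) (fun k => ?_) ((bsumA hb hw).summable.mul_left (1 / b))
  · have := bco_pos hb k; positivity
  · have := bco_pos hb k
    rcases Nat.eq_zero_or_pos k with rfl | hk
    · simp
    · have h1 : (1 : ℝ) ≤ k := by exact_mod_cast hk
      have h2 : 1 ≤ 1 / b * ((k : ℝ) + (b - 1)) := by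
        rw [div_mul_eq_mul_div, le_div_iff₀ hb]; linarith
      have h3 : 0 ≤ (k : ℝ) * (bco b k * w ^ k) := by positivity
      nlinarith [mul_le_mul_of_nonneg_right h2 h3]

lemma bsum1' {b : ℝ} (hb : 0 < b) {w : ℝ} (hw : 0 ≤ w) :
    HasSum (fun k : ℕ => (k : ℝ) * (bco b k * w ^ k)) (bm b w * bJ b w) := by
  have := (bsum1 hb hw).hasSum
  rwa [bm, div_mul_cancel₀ _ (bJ_pos hb hw).ne']

lemma bm_nonneg {b : ℝ} (hb : 0 < b) {w : ℝ} (hw : 0 ≤ w) : 0 ≤ bm b w := by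
  refine div_nonneg (tsum_nonneg fun k => ?_) (bJ_pos hb hw).le
  have := bco_pos hb k; positivity

lemma bm_upper {b : ℝ} (hb : 0 < b) {w : ℝ} (hw : 0 ≤ w) :
    bm b w * (bm b w + (b - 1)) ≤ w := by
  set m := bm b w with hm
  have hJ := bJ_pos hb hw
  have h1 := bsum1' hb hw
  rw [← hm] at h1
  have h0 := (bsum0 hb hw).hasSum
  have h2 := ((bsumA hb hw).sub (h1.mul_left (2 * m + (b - 1)))).add (h0.mul_left (m ^ 2))
  have h3 := h2.nonneg (fun k => by
    have h4 : 0 ≤ ((k : ℝ) - m) ^ 2 * (bco b k * w ^ k) := by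
      have := bco_pos hb k; positivity
    show (0 : ℝ) ≤ _
    nlinarith [h4])
  change 0 ≤ w * bJ b w - (2 * m + (b - 1)) * (m * bJ b w) + m ^ 2 * bJ b w at h3
  by_contra hc
  push Not at hc
  nlinarith [mul_lt_mul_of_pos_right hc hJ]

lemma bm_lower {b : ℝ} (hb : 0 < b) {w : ℝ} (hw : 0 ≤ w) :
    w ≤ bm b w * (bm b w + b) := by
  have hm0 := bm_nonneg hb hw
  set m := bm b w with hm
  have hJ := bJ_pos hb hw
  have h1 := bsum1' hb hw
  rw [← hm] at h1
  have h0 := (bsum0 hb hw).hasSum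
  change HasSum _ (bJ b w) at h0
  have hs : HasSum (fun k : ℕ => w * (bco b k * w ^ k) / ((k : ℝ) + b)) (m * bJ b w) := by
    have h5 := h1
    rw [← hasSum_nat_add_iff' 1] at h5
    simp only [Finset.range_one, Finset.sum_singleton, Nat.cast_zero, zero_mul, sub_zero] at h5
    have he : (fun k : ℕ => w * (bco b k * w ^ k) / ((k : ℝ) + b)) =
        fun k => ((k + 1 : ℕ) : ℝ) * (bco b (k + 1) * w ^ (k + 1)) := by
      funext k
      rw [← bco_succ hb k]
      have : (k : ℝ) + b ≠ 0 := by positivity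
      push_cast
      field_simp
      ring
    rw [he]
    exact h5
  set M := m + b with hM
  have hMp : 0 < M := by positivity
  have h2 := (((h0.mul_left (M + m)).sub h1).mul_left (w / M ^ 2))
  have h3 := hasSum_le (fun k => by
    show w / M ^ 2 * ((M + m) * (bco b k * w ^ k) - (k : ℝ) * (bco b k * w ^ k)) ≤
      w * (bco b k * w ^ k) / ((k : ℝ) + b)
    have := bco_pos hb k
    have hkb : 0 < (k : ℝ) + b := by positivity
    have hA : 0 ≤ w * (bco b k * w ^ k) := by positivity
    have hB : (M + m - k) / M ^ 2 ≤ 1 / ((k : ℝ) + b) := by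
      rw [div_le_div_iff₀ (by positivity) hkb]
      nlinarith [sq_nonneg ((k : ℝ) + b - M)]
    have := mul_le_mul_of_nonneg_left hB hA
    calc _ = w * (bco b k * w ^ k) * ((M + m - k) / M ^ 2) := by ring
      _ ≤ _ := this
      _ = _ := by ring) h2 hs
  have h4 : w / M ^ 2 * ((M + m) * bJ b w - m * bJ b w) = w / M * bJ b w := by
    field_simp; ring
  rw [h4] at h3
  have h5 := le_of_mul_le_mul_right h3 hJ
  rwa [div_le_iff₀ hMp] at h5

lemma bm_abs {b : ℝ} (hb : 0 < b) {w : ℝ} (hw : 0 ≤ w) : |bm b w - √w| ≤ b + 1 := by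
  have hm0 := bm_nonneg hb hw
  have h1 := bm_upper hb hw
  have h2 := bm_lower hb hw
  have hs := Real.sqrt_nonneg w
  have hsq := Real.mul_self_sqrt hw
  rw [abs_le]
  constructor
  · by_contra hc
    push Not at hc
    nlinarith
  · by_contra hc
    push Not at hc
    nlinarith

lemma bJ_jensen {b : ℝ} (hb : 0 < b) {w t : ℝ} (hw : 0 ≤ w) (ht : 0 < t) :
    Real.exp (Real.log t * bm b w) * bJ b w ≤ bJ b (w * t) := by
  set m := bm b w with hm
  set L := Real.log t with hL
  have h1 := bsum1' hb hw
  rw [← hm] at h1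
  have h0 := (bsum0 hb hw).hasSum
  change HasSum _ (bJ b w) at h0
  have h00 := (bsum0 hb (mul_nonneg hw ht.le)).hasSum
  change HasSum _ (bJ b (w * t)) at h00
  have h2 := ((h0.mul_left (1 - L * m)).add (h1.mul_left L)).mul_left (Real.exp (L * m))
  have h3 := hasSum_le (fun k => by
    show Real.exp (L * m) * ((1 - L * m) * (bco b k * w ^ k) + L * ((k : ℝ) * (bco b k * w ^ k))) ≤
      bco b k * (w * t) ^ k
    have := bco_pos hb k
    have hA : 0 ≤ bco b k * w ^ k := by positivity
    have hB : Real.exp (L * m) * (1 + (L * k - L * m)) ≤ t ^ k := by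
      have h5 : t ^ k = Real.exp (L * m) * Real.exp (L * k - L * m) := by
        rw [← Real.exp_add, add_sub_cancel, hL, ← Real.rpow_natCast, Real.rpow_def_of_pos ht]
      rw [h5]
      gcongr
      linarith [Real.add_one_le_exp (L * k - L * m)]
    have := mul_le_mul_of_nonneg_left hB hA
    calc _ = bco b k * w ^ k * (Real.exp (L * m) * (1 + (L * k - L * m))) := by ring
      _ ≤ _ := this
      _ = _ := by rw [mul_pow]; ring) h2 h00
  calc _ = Real.exp (L * m) * ((1 - L * m) * bJ b w + L * (m * bJ b w)) := by ring
    _ ≤ _ := h3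

lemma bm_tendsto {b : ℝ} (hb : 0 < b) {v : ℝ → ℝ} {l : ℝ} (hv : ∀ᶠ z in atTop, 0 ≤ v z)
    (h : Tendsto (fun z => √(v z) / z) atTop (𝓝 l)) :
    Tendsto (fun z => bm b (v z) / z) atTop (𝓝 l) := by
  have h1 : Tendsto (fun z => bm b (v z) / z - √(v z) / z) atTop (𝓝 0) := by
    refine squeeze_zero_norm' (a := fun z => (b + 1) / z) ?_ (tendsto_const_nhds.div_atTop tendsto_id)
    filter_upwards [hv, eventually_gt_atTop 0] with z hz hz0
    rw [← sub_div, Real.norm_eq_abs, abs_div, abs_of_pos hz0]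
    gcongr
    exact bm_abs hb hz
  simpa using h1.add h

lemma bJ_ratio {b c r x : ℝ} (hb : 0 < b) (hr : 0 < r) :
    Tendsto (fun z => bJ b (z ^ 2 * r / 4 * (1 - c * x / z)) / bJ b (z ^ 2 * r / 4)) atTop
      (𝓝 (Real.exp (-(c * √r / 2 * x)))) := by
  have hx0 : Tendsto (fun z : ℝ => 1 - c * x / z) atTop (𝓝 1) := by
    have : Tendsto (fun z : ℝ => c * x / z) atTop (𝓝 0) := tendsto_const_nhds.div_atTop tendsto_id
    simpa using (tendsto_const_nhds (x := (1 : ℝ))).sub this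
  have hL : Tendsto (fun z : ℝ => z * Real.log (1 - c * x / z)) atTop (𝓝 (-(c * x))) := by
    have := Real.tendsto_mul_log_one_add_div_atTop (-(c * x))
    refine this.congr (fun z => ?_)
    rw [neg_div, ← sub_eq_add_neg]
  have hpos : ∀ᶠ z : ℝ in atTop, 0 < 1 - c * x / z := hx0.eventually (lt_mem_nhds one_pos)
  have hs : ∀ z : ℝ, 0 < z → √(z ^ 2 * r / 4) = z * (√r / 2) := by
    intro z hz
    rw [Real.sqrt_eq_iff_mul_self_eq (by positivity) (by positivity)]
    have := Real.mul_self_sqrt hr.le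
    nlinarith
  have hm1 : Tendsto (fun z => bm b (z ^ 2 * r / 4) / z) atTop (𝓝 (√r / 2)) := by
    refine bm_tendsto hb (Eventually.of_forall fun z => by positivity) ?_
    refine tendsto_const_nhds.congr' ?_
    filter_upwards [eventually_gt_atTop 0] with z hz
    rw [hs z hz]; field_simp
  have hm2 : Tendsto (fun z => bm b (z ^ 2 * r / 4 * (1 - c * x / z)) / z) atTop (𝓝 (√r / 2)) := by
    refine bm_tendsto hb ?_ ?_
    · filter_upwards [hpos] with z hz
      positivity
    have h3 : Tendsto (fun z : ℝ => √r / 2 * √(1 - c * x / z)) atTop (𝓝 (√r / 2 * √1)) :=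
      (hx0.sqrt).const_mul _
    rw [Real.sqrt_one, mul_one] at h3
    refine h3.congr' ?_
    filter_upwards [eventually_gt_atTop 0] with z hz
    rw [Real.sqrt_mul (by positivity), hs z hz]; field_simp
  have key : ∀ f : ℝ → ℝ, Tendsto (fun z => f z / z) atTop (𝓝 (√r / 2)) →
      Tendsto (fun z => Real.exp (Real.log (1 - c * x / z) * f z)) atTop
        (𝓝 (Real.exp (-(c * √r / 2 * x)))) := by
    intro f hf
    refine (Real.continuous_exp.tendsto _).comp ?_
    have := hL.mul hf
    have he : -(c * x) * (√r / 2) = -(c * √r / 2 * x) := by ring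
    rw [he] at this
    refine this.congr' ?_
    filter_upwards [eventually_gt_atTop 0] with z hz
    field_simp
  refine tendsto_of_tendsto_of_tendsto_of_le_of_le' (key _ hm1) (key _ hm2) ?_ ?_
  · filter_upwards [hpos] with z hz
    rw [le_div_iff₀ (bJ_pos hb (by positivity))]
    exact bJ_jensen hb (by positivity) hz
  · filter_upwards [hpos] with z hz
    rw [div_le_iff₀ (bJ_pos hb (by positivity))]
    have h := bJ_jensen hb (w := z ^ 2 * r / 4 * (1 - c * x / z)) (by positivity) (inv_pos.2 hz)
    rw [mul_assoc (z ^ 2 * r / 4), mul_inv_cancel₀ hz.ne', mul_one, Real.log_inv, neg_mul,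
      Real.exp_neg, inv_mul_le_iff₀ (Real.exp_pos _)] at h
    exact h

lemma bG_tendsto {b c r a p : ℝ} (hb : 0 < b) (hc0 : 0 < c) (hc1 : c < 1) (hr : 0 < r) (ha : 0 < a)
    (hp : 0 < p) :
    Tendsto (fun z => ∫ x in Ioo (0 : ℝ) z, x ^ (p - 1) * Real.exp (-(a * x)) *
      ((1 - c * x / z) ^ (b - 1) *
      (bJ b (z ^ 2 * r / 4 * (1 - c * x / z)) / bJ b (z ^ 2 * r / 4)))) atTop
      (𝓝 ((1 / (a + c * √r / 2)) ^ p * Real.Gamma p)) := by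
  rw [← Real.integral_rpow_mul_exp_neg_mul_Ioi hp (by positivity : 0 < a + c * √r / 2)]
  have hconv : ∀ z : ℝ, (∫ x in Ioo (0 : ℝ) z, x ^ (p - 1) * Real.exp (-(a * x)) *
      ((1 - c * x / z) ^ (b - 1) *
      (bJ b (z ^ 2 * r / 4 * (1 - c * x / z)) / bJ b (z ^ 2 * r / 4)))) =
      ∫ x in Ioi (0 : ℝ), (Iio z).indicator (fun x => x ^ (p - 1) * Real.exp (-(a * x)) *
      ((1 - c * x / z) ^ (b - 1) *
      (bJ b (z ^ 2 * r / 4 * (1 - c * x / z)) / bJ b (z ^ 2 * r / 4)))) x := by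
    intro z
    rw [setIntegral_indicator measurableSet_Iio, Ioi_inter_Iio]
  simp_rw [hconv]
  have hpow : ∀ t : ℝ, 1 - c ≤ t → t ≤ 1 → t ^ (b - 1) ≤ 1 + (1 - c) ^ (b - 1) := by
    intro t h1 h2
    have h0 : 0 < 1 - c := by linarith
    have h3 : 0 < (1 - c) ^ (b - 1) := Real.rpow_pos_of_pos h0 _
    rcases le_total 0 (b - 1) with h | h
    · linarith [Real.rpow_le_one (by linarith : 0 ≤ t) h2 h]
    · linarith [Real.rpow_le_rpow_of_nonpos h0 h1 h]
  refine tendsto_integral_filter_of_dominated_convergence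
    (fun x => x ^ (p - 1) * Real.exp (-(a * x)) * (1 + (1 - c) ^ (b - 1))) ?_ ?_ ?_ ?_
  · filter_upwards [eventually_gt_atTop 0] with z hz
    have hJm : Measurable (fun w => bJ b (max w 0)) := by
      refine Monotone.measurable (fun v w h => bJ_mono hb (le_max_right _ _) ?_)
      exact max_le_max_right _ h
    have hmeas : Measurable ((Iio z).indicator (fun x => x ^ (p - 1) * Real.exp (-(a * x)) *
      ((1 - c * x / z) ^ (b - 1) *
      (bJ b (max (z ^ 2 * r / 4 * (1 - c * x / z)) 0) / bJ b (z ^ 2 * r / 4))))) := by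
      refine Measurable.indicator ?_ measurableSet_Iio
      have h1 : Measurable (fun x : ℝ => bJ b (max (z ^ 2 * r / 4 * (1 - c * x / z)) 0)) :=
        hJm.comp (by fun_prop)
      have h2 : Measurable (fun x : ℝ => x ^ (p - 1)) := by fun_prop
      have h3 : Measurable (fun x : ℝ => (1 - c * x / z) ^ (b - 1)) := by fun_prop
      have h4 : Measurable (fun x : ℝ => Real.exp (-(a * x))) := by fun_prop
      exact (h2.mul h4).mul (h3.mul (h1.div_const _))
    refine hmeas.aestronglyMeasurable.congr ?_
    filter_upwards [ae_restrict_mem measurableSet_Ioi] with x hx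
    by_cases hxz : x ∈ Iio z
    · rw [indicator_of_mem hxz, indicator_of_mem hxz]
      have h5 : 0 ≤ 1 - c * x / z := by
        rw [sub_nonneg, div_le_one hz]
        have : x < z := hxz
        have : 0 < x := hx
        nlinarith
      rw [max_eq_left (by positivity)]
    · rw [indicator_of_notMem hxz, indicator_of_notMem hxz]
  · filter_upwards [eventually_gt_atTop 0] with z hz
    filter_upwards [ae_restrict_mem measurableSet_Ioi] with x hx
    have hx : 0 < x := hx
    have h00 : 0 ≤ (1 - c) ^ (b - 1) := Real.rpow_nonneg (by linarith) _
    by_cases hxz : x ∈ Iio z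
    · rw [indicator_of_mem hxz]
      have hxz' : x < z := hxz
      have h5 : 1 - c ≤ 1 - c * x / z := by
        have : c * x / z ≤ c := by
          rw [div_le_iff₀ hz]; gcongr
        linarith
      have h6 : 1 - c * x / z ≤ 1 := by
        have : 0 ≤ c * x / z := by positivity
        linarith
      have h7 : 0 ≤ 1 - c * x / z := by linarith
      have hJ1 := bJ_pos hb (by positivity : 0 ≤ z ^ 2 * r / 4)
      have hJ2 := bJ_pos hb (by positivity : 0 ≤ z ^ 2 * r / 4 * (1 - c * x / z))
      have hJ3 : bJ b (z ^ 2 * r / 4 * (1 - c * x / z)) / bJ b (z ^ 2 * r / 4) ≤ 1 := by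
        rw [div_le_one hJ1]
        refine bJ_mono hb (by positivity) ?_
        exact mul_le_of_le_one_right (by positivity) h6
      rw [Real.norm_of_nonneg (by positivity)]
      have h8 := hpow _ h5 h6
      have h9 : 0 ≤ (1 - c * x / z) ^ (b - 1) := Real.rpow_nonneg h7 _
      gcongr
      calc _ ≤ (1 - c * x / z) ^ (b - 1) * 1 := by gcongr
        _ ≤ _ := by linarith
    · rw [indicator_of_notMem hxz, norm_zero]
      positivity
  · refine Integrable.mul_const ?_ _
    have := integrableOn_rpow_mul_exp_neg_mul_rpow (p := 1) (s := p - 1) (b := a) (by linarith) one_pos ha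
    simpa [IntegrableOn] using this
  · filter_upwards [ae_restrict_mem measurableSet_Ioi] with x hx
    have hx0 : Tendsto (fun z : ℝ => 1 - c * x / z) atTop (𝓝 1) := by
      have : Tendsto (fun z : ℝ => c * x / z) atTop (𝓝 0) := tendsto_const_nhds.div_atTop tendsto_id
      simpa using (tendsto_const_nhds (x := (1 : ℝ))).sub this
    have h1 := (hx0.rpow_const (p := b - 1) (Or.inl one_ne_zero)).mul
      (bJ_ratio (c := c) (x := x) hb hr)
    have h2 := h1.const_mul (x ^ (p - 1) * Real.exp (-(a * x)))
    have he : x ^ (p - 1) * Real.exp (-(a * x)) * ((1 : ℝ) ^ (b - 1) * Real.exp (-(c * √r / 2 * x)))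
        = x ^ (p - 1) * Real.exp (-((a + c * √r / 2) * x)) := by
      rw [Real.one_rpow, one_mul, mul_assoc, ← Real.exp_add]
      ring_nf
    rw [he] at h2
    refine h2.congr' ?_
    filter_upwards [eventually_gt_atTop x] with z hz
    rw [indicator_of_mem (show x ∈ Iio z from hz)]

lemma besselI_eq_s12 {b s : ℝ} (hs : 0 < s) :
    besselI (b - 1) s = (s / 2) ^ (b - 1) * bJ b (s ^ 2 / 4) := by
  unfold besselI bJ
  rw [← tsum_mul_left]
  refine tsum_congr fun k => ?_
  have h2 : 0 < s / 2 := by positivity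
  rw [Real.rpow_add h2, bco, show (k : ℝ) + (b - 1) + 1 = k + b by ring,
    show (2 : ℝ) * k = ((2 * k : ℕ) : ℝ) by push_cast; ring, Real.rpow_natCast, pow_mul,
    show (s / 2) ^ 2 = s ^ 2 / 4 by ring]
  ring

lemma sqBesselP_eq_s12 {b c r z x : ℝ} (hb : 0 < b) (hc0 : 0 < c) (hc1 : c < 1) (hr : 0 < r) (hx : 0 < x) (hz : x < z) :
    sqBesselP (2 * b) 1 (z * r) (z - c * x) =
      (1 / 2 * (z / 2) ^ (b - 1) * Real.exp (-(z * r + z) / 2) * bJ b (z ^ 2 * r / 4)) *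
      (Real.exp (c * x / 2) * ((1 - c * x / z) ^ (b - 1) *
      (bJ b (z ^ 2 * r / 4 * (1 - c * x / z)) / bJ b (z ^ 2 * r / 4)))) := by
  have hz0 : 0 < z := hx.trans hz
  have hJ1 := bJ_pos hb (by positivity : 0 ≤ z ^ 2 * r / 4)
  have ht : 0 < 1 - c * x / z := by
    rw [sub_pos, div_lt_one hz0]; nlinarith
  have hy : z - c * x = z * (1 - c * x / z) := by field_simp
  have hexp : Real.exp (-(z * r + (z - c * x)) / (2 * 1)) =
      Real.exp (-(z * r + z) / 2) * Real.exp (c * x / 2) := by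
    rw [← Real.exp_add]; ring_nf
  unfold sqBesselP
  rw [hexp, hy]
  set t := 1 - c * x / z with htd
  have hsq : 0 < √(z * r * (z * t)) := Real.sqrt_pos.2 (by positivity)
  rw [show (2 * b - 2) / 2 = b - 1 by ring, div_one, besselI_eq_s12 hsq, Real.sq_sqrt (by positivity),
    show z * r * (z * t) / 4 = z ^ 2 * r / 4 * t by ring]
  have hpw : (z * t / (z * r)) ^ ((2 * b - 2) / 4) * (√(z * r * (z * t)) / 2) ^ (b - 1) =
      (z / 2) ^ (b - 1) * t ^ (b - 1) := by
    have h1 : (z * t / (z * r)) ^ ((2 * b - 2) / 4) = (√(z * t / (z * r))) ^ (b - 1) := by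
      rw [Real.sqrt_eq_rpow, ← Real.rpow_mul (by positivity)]
      ring_nf
    rw [h1, ← Real.mul_rpow (by positivity) (by positivity), ← Real.mul_rpow (by positivity) ht.le]
    congr 1
    rw [← mul_div_assoc, ← Real.sqrt_mul (by positivity),
      show z * t / (z * r) * (z * r * (z * t)) = (z * t) ^ 2 by field_simp,
      Real.sqrt_sq (by positivity)]
    ring
  rw [mul_one]
  calc _ = (2 : ℝ)⁻¹ * ((z * t / (z * r)) ^ ((2 * b - 2) / 4) * (√(z * r * (z * t)) / 2) ^ (b - 1)) *
      (Real.exp (-(z * r + z) / 2) * Real.exp (c * x / 2)) * bJ b (z ^ 2 * r / 4 * t) := by ring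
    _ = _ := by
      rw [hpw]
      field_simp
/-- **Theorem (Statement 12, Lemma 4.4).** For `δ₁, δ₂ > 0` there is a positive constant
`C₂`, depending only on `δ₁` and `δ₂`, such that for every `0 < c < 1` and `r > 0`,
`q̃(z₂; z₂r)/q(z₂; z₂r) ∼ C₂ D(r)^{−δ₁/2} e^{−z₂/2}` as `z₂ → ∞`, where
`D(r) = 1 + (1−c)/(1−c+c√r)`. -/
theorem statement12 (δ₁ δ₂ : ℝ) (hδ₁ : 0 < δ₁) (hδ₂ : 0 < δ₂) :
    ∃ C₂ : ℝ, 0 < C₂ ∧ ∀ c : ℝ, 0 < c → c < 1 → ∀ r : ℝ, 0 < r →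
      Tendsto (fun z₂ => Real.exp (z₂ / 2) * qTilde c δ₁ δ₂ (z₂ * r) z₂ /
          qTwo c δ₁ δ₂ (z₂ * r) z₂) atTop
        (𝓝 (C₂ * (1 + (1 - c) / (1 - c + c * Real.sqrt r)) ^ (-(δ₁ / 2)))) := by
  obtain ⟨b, rfl⟩ : ∃ b, δ₂ = 2 * b := ⟨δ₂ / 2, by ring⟩
  obtain ⟨p, rfl⟩ : ∃ p, δ₁ = 2 * p := ⟨δ₁ / 2, by ring⟩
  have hb : 0 < b := by linarith
  have hp : 0 < p := by linarith
  have hGb := Real.Gamma_pos_of_pos hb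
  have hGp := Real.Gamma_pos_of_pos hp
  have h2b : (0 : ℝ) < 2 ^ b := by positivity
  have h2p : (0 : ℝ) < 2 ^ p := by positivity
  refine ⟨1 / (2 ^ p * Real.Gamma p) * (1 / (2 ^ b * Real.Gamma b)), by positivity, ?_⟩
  intro c hc0 hc1 r hr
  have hc : 0 < 1 - c := by linarith
  have hsr : 0 < √r := Real.sqrt_pos.2 hr
  have T1 := bG_tendsto (a := 1 - c) hb hc0 hc1 hr hc hp
  have T2 := bG_tendsto (a := (1 - c) / 2) hb hc0 hc1 hr (by linarith) hp
  have T := (T1.div T2 (by positivity)).const_mul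
    (1 / (2 ^ p * Real.Gamma p) * (1 / (2 ^ b * Real.Gamma b)))
  have hlim : (1 / (1 - c + c * √r / 2)) ^ p * Real.Gamma p /
      ((1 / ((1 - c) / 2 + c * √r / 2)) ^ p * Real.Gamma p) =
      (1 + (1 - c) / (1 - c + c * √r)) ^ (-(2 * p / 2)) := by
    rw [mul_div_mul_right _ _ hGp.ne', ← Real.div_rpow (by positivity) (by positivity),
      show 2 * p / 2 = p by ring, Real.rpow_neg (by positivity), ← Real.inv_rpow (by positivity)]
    congr 1
    have : 0 < c * √r := by positivity
    field_simp
    ring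
  rw [hlim] at T
  refine T.congr' ?_
  filter_upwards [eventually_gt_atTop 0] with z hz
  have hJ1 := bJ_pos hb (by positivity : 0 ≤ z ^ 2 * r / 4)
  set A := 1 / 2 * (z / 2) ^ (b - 1) * Real.exp (-(z * r + z) / 2) * bJ b (z ^ 2 * r / 4) with hA
  have hApos : 0 < A := by positivity
  have hq : qTwo c (2 * p) (2 * b) (z * r) z = (1 / (2 ^ p * Real.Gamma p) * A) *
      ∫ x in Ioo (0 : ℝ) z, x ^ (p - 1) * Real.exp (-((1 - c) / 2 * x)) *
      ((1 - c * x / z) ^ (b - 1) *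
      (bJ b (z ^ 2 * r / 4 * (1 - c * x / z)) / bJ b (z ^ 2 * r / 4))) := by
    unfold qTwo
    rw [← integral_const_mul]
    refine setIntegral_congr_fun measurableSet_Ioo (fun x hx => ?_)
    rw [sqBesselP_eq_s12 hb hc0 hc1 hr hx.1 hx.2, ← hA]
    unfold sqBesselP0
    rw [show 2 * p / 2 = p by ring, mul_one,
      show Real.exp (-((1 - c) / 2 * x)) = Real.exp (-x / 2) * Real.exp (c * x / 2) by
        rw [← Real.exp_add]; ring_nf]
    ring
  have hqt : Real.exp (z / 2) * qTilde c (2 * p) (2 * b) (z * r) z =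
      ((1 / (2 ^ p * Real.Gamma p)) ^ 2 * (1 / (2 ^ b * Real.Gamma b)) * A) *
      ∫ x in Ioo (0 : ℝ) z, x ^ (p - 1) * Real.exp (-((1 - c) * x)) *
      ((1 - c * x / z) ^ (b - 1) *
      (bJ b (z ^ 2 * r / 4 * (1 - c * x / z)) / bJ b (z ^ 2 * r / 4))) := by
    unfold qTilde
    rw [← integral_const_mul, ← integral_const_mul]
    refine setIntegral_congr_fun measurableSet_Ioo (fun x hx => ?_)
    rw [sqBesselP_eq_s12 hb hc0 hc1 hr hx.1 hx.2, ← hA]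
    unfold sqBesselP0
    have hx0 : 0 < x := hx.1
    have hy : 0 < z - c * x := by nlinarith [hx.1, hx.2]
    have e1 : x ^ (1 - p) = (x ^ (p - 1))⁻¹ := by rw [← Real.rpow_neg hx0.le]; ring_nf
    have e2 : (z - c * x) ^ (1 - b) = ((z - c * x) ^ (b - 1))⁻¹ := by
      rw [← Real.rpow_neg hy.le]; ring_nf
    have p1 : 0 < x ^ (p - 1) := Real.rpow_pos_of_pos hx0 _
    have p2 : 0 < (z - c * x) ^ (b - 1) := Real.rpow_pos_of_pos hy _
    have e3 : Real.exp (-((1 - c) * x)) = Real.exp (z / 2) * Real.exp (-x / 2) ^ 2 *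
        Real.exp (c * x / 2) * Real.exp (-(z - c * x) / 2) := by
      rw [← Real.exp_nat_mul, ← Real.exp_add, ← Real.exp_add, ← Real.exp_add]
      push_cast
      ring_nf
    rw [show 2 * p / 2 = p by ring, show 2 * b / 2 = b by ring, mul_one, e1, e2, e3]
    generalize x ^ (p - 1) = X at *
    generalize (z - c * x) ^ (b - 1) = Y at *
    generalize ((1 - c * x / z) ^ (b - 1) *
      (bJ b (z ^ 2 * r / 4 * (1 - c * x / z)) / bJ b (z ^ 2 * r / 4))) = Z
    generalize Real.exp (z / 2) = E1
    generalize Real.exp (-x / 2) = E2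
    generalize Real.exp (c * x / 2) = E3
    generalize Real.exp (-(z - c * x) / 2) = E4
    field_simp
  rw [hqt, hq]
  simp only [Pi.div_apply]
  generalize (∫ x in Ioo (0 : ℝ) z, x ^ (p - 1) * Real.exp (-((1 - c) * x)) *
      ((1 - c * x / z) ^ (b - 1) *
      (bJ b (z ^ 2 * r / 4 * (1 - c * x / z)) / bJ b (z ^ 2 * r / 4)))) = U
  generalize (∫ x in Ioo (0 : ℝ) z, x ^ (p - 1) * Real.exp (-((1 - c) / 2 * x)) *
      ((1 - c * x / z) ^ (b - 1) *
      (bJ b (z ^ 2 * r / 4 * (1 - c * x / z)) / bJ b (z ^ 2 * r / 4)))) = V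
  field_simp
end

section
/- Let 0 < c < 1 and δ₁, δ₂ > 0. Then there exists a positive constant C, depending only on δ₁ and δ₂, such that for every r > 0, setting a₁ = (√r−1)²/2 + 1/2 and b₁ = 1−c, one has q̃(z₂; z₂·r) ∼ C·r^{(1−δ₂)/4}·(b₁ + c√r/2)^{−δ₁/2}·z₂^{−1/2}·e^{−a₁·z₂} as z₂ → ∞, where q̃(z₂;z₁) is defined in the context. -/
open MeasureTheory Filter Set Topology

lemma beta_real_aux (α β : ℝ) (hα : 0 < α) (hβ : 0 < β) :
    ∫ s in Ioo (0:ℝ) 1, s ^ (α - 1) * (1 - s) ^ (β - 1)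
      = Real.Gamma α * Real.Gamma β / Real.Gamma (α + β) := by
  have h := Complex.betaIntegral_eq_Gamma_mul_div (α : ℂ) (β : ℂ) (by simpa) (by simpa)
  rw [Complex.betaIntegral, intervalIntegral.integral_of_le zero_le_one,
    integral_Ioc_eq_integral_Ioo] at h
  have h2 : ∫ x in Ioo (0:ℝ) 1, (x : ℂ) ^ ((α : ℂ) - 1) * (1 - (x : ℂ)) ^ ((β : ℂ) - 1)
      = ∫ x in Ioo (0:ℝ) 1, ((x ^ (α - 1) * (1 - x) ^ (β - 1) : ℝ) : ℂ) := by
    refine setIntegral_congr_fun measurableSet_Ioo fun x hx => ?_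
    have h1 : (0:ℝ) ≤ x := hx.1.le
    have h2 : (0:ℝ) ≤ 1 - x := by linarith [hx.2]
    push_cast
    rw [Complex.ofReal_cpow h1, Complex.ofReal_cpow h2]
    push_cast
    rfl
  rw [h2, integral_complex_ofReal, ← Complex.ofReal_add, Complex.Gamma_ofReal,
    Complex.Gamma_ofReal, Complex.Gamma_ofReal] at h
  exact_mod_cast h

lemma beta_sq_aux (p : ℝ) (hp : -1 < p) (k : ℕ) :
    ∫ t in Ioo (0:ℝ) 1, t ^ (2 * k) * (1 - t ^ 2) ^ p
      = (1 / 2) * (Real.Gamma (k + 1 / 2) * Real.Gamma (p + 1) / Real.Gamma (k + p + 3 / 2)) := by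
  have hb := beta_real_aux (k + 1 / 2) (p + 1) (by positivity) (by linarith)
  have himg : (fun t : ℝ => t ^ 2) '' Ioo 0 1 = Ioo 0 1 := by
    ext y
    constructor
    · rintro ⟨t, ht, rfl⟩
      exact ⟨by have := ht.1; positivity, by have := ht.1; have := ht.2; nlinarith⟩
    · intro hy
      refine ⟨√y, ⟨Real.sqrt_pos.2 hy.1, ?_⟩, Real.sq_sqrt hy.1.le⟩
      rw [Real.sqrt_lt' one_pos]; simpa using hy.2
  have hinj : InjOn (fun t : ℝ => t ^ 2) (Ioo 0 1) := by
    intro a ha b hb hab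
    exact (pow_left_inj₀ ha.1.le hb.1.le two_ne_zero).1 hab
  have hc := integral_image_eq_integral_abs_deriv_smul (s := Ioo (0:ℝ) 1)
    (f := fun t : ℝ => t ^ 2) (f' := fun t => 2 * t) measurableSet_Ioo
    (fun x _ => by simpa using (hasDerivAt_pow 2 x).hasDerivWithinAt) hinj
    (fun s => s ^ ((k : ℝ) + 1 / 2 - 1) * (1 - s) ^ (p + 1 - 1))
  rw [himg, hb] at hc
  rw [show (k : ℝ) + p + 3 / 2 = k + 1 / 2 + (p + 1) by ring, hc, ← integral_const_mul]
  refine setIntegral_congr_fun measurableSet_Ioo fun t ht => ?_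
  have ht0 := ht.1
  simp only [smul_eq_mul, add_sub_cancel_right]
  rw [abs_of_pos (by linarith), ← Real.rpow_natCast t 2, ← Real.rpow_mul ht0.le]
  have : t ^ (2 * k) = t * t ^ (((2:ℕ):ℝ) * ((k:ℝ) + 1 / 2 - 1)) := by
    rw [← Real.rpow_natCast, mul_comm t, ← Real.rpow_add_one ht0.ne']
    congr 1; push_cast; ring
  rw [this]; ring

lemma bessel_term_aux (ν x : ℝ) (hν : -(1/2) < ν) (hx : 0 < x) (k : ℕ) :
    (x / 2) ^ (2 * (k : ℝ) + ν) / ((Nat.factorial k : ℝ) * Real.Gamma ((k : ℝ) + ν + 1))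
    = (x / 2) ^ ν * (2 / (√Real.pi * Real.Gamma (ν + 1 / 2))) *
      ∫ t in Ioo (0:ℝ) 1, (1 - t ^ 2) ^ (ν - 1 / 2) * ((x * t) ^ (2 * k) / (Nat.factorial (2 * k))) := by
  have h1 : ∫ t in Ioo (0:ℝ) 1, (1 - t ^ 2) ^ (ν - 1 / 2) * ((x * t) ^ (2 * k) / (Nat.factorial (2 * k)))
     = x ^ (2 * k) / (Nat.factorial (2 * k)) * ∫ t in Ioo (0:ℝ) 1, t ^ (2 * k) * (1 - t ^ 2) ^ (ν - 1 / 2) := by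
    rw [← integral_const_mul]
    congr 1; ext t; rw [mul_pow]; ring
  rw [h1, beta_sq_aux _ (by linarith), show ν - 1 / 2 + 1 = ν + 1 / 2 by ring,
    show (k : ℝ) + (ν - 1 / 2) + 3 / 2 = k + ν + 1 by ring, Real.rpow_add (by positivity)]
  have hL := Real.Gamma_mul_Gamma_add_half ((k : ℝ) + 1 / 2)
  rw [show (k : ℝ) + 1 / 2 + 1 / 2 = k + 1 by ring, Real.Gamma_nat_eq_factorial,
    show 2 * ((k : ℝ) + 1 / 2) = ((2 * k : ℕ) : ℝ) + 1 by push_cast; ring,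
    Real.Gamma_nat_eq_factorial, show (1 : ℝ) - (((2 * k : ℕ) : ℝ) + 1) = -((2 * k : ℕ) : ℝ) by ring,
    Real.rpow_neg (by norm_num), Real.rpow_natCast] at hL
  have e1 : (x / 2) ^ (2 * (k : ℝ)) = x ^ (2 * k) / 2 ^ (2 * k) := by
    rw [← div_pow, ← Real.rpow_natCast]; push_cast; rfl
  rw [e1]
  have g1 : Real.Gamma (ν + 1 / 2) ≠ 0 := (Real.Gamma_pos_of_pos (by linarith)).ne'
  have g2 : Real.Gamma (k + ν + 1) ≠ 0 :=
    (Real.Gamma_pos_of_pos (by have : (0:ℝ) ≤ k := by positivity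
                               linarith)).ne'
  have g3 : √Real.pi ≠ 0 := by positivity
  have g4 : ((Nat.factorial k : ℕ) : ℝ) ≠ 0 := by positivity
  have g5 : ((Nat.factorial (2 * k) : ℕ) : ℝ) ≠ 0 := by positivity
  have hL' : Real.Gamma ((k : ℝ) + 1 / 2) = (Nat.factorial (2 * k)) * (2 ^ (2 * k))⁻¹ * √Real.pi / (Nat.factorial k) := by
    rw [eq_div_iff g4]; exact hL
  rw [hL']
  generalize Real.Gamma (ν + 1 / 2) = G1 at *
  generalize Real.Gamma (k + ν + 1) = G2 at *
  field_simp

lemma bessel_summable (ν x : ℝ) (hν : -1 < ν) (hx : 0 < x) :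
    Summable fun k : ℕ =>
      (x / 2) ^ (2 * (k : ℝ) + ν) / ((Nat.factorial k : ℝ) * Real.Gamma ((k : ℝ) + ν + 1)) := by
  have hG : ∀ k : ℕ, 0 < Real.Gamma ((k : ℝ) + ν + 1) := fun k =>
    Real.Gamma_pos_of_pos (by have : (0:ℝ) ≤ k := by positivity
                              linarith)
  have hpos : ∀ k : ℕ, 0 < (x / 2) ^ (2 * (k : ℝ) + ν) /
      ((Nat.factorial k : ℝ) * Real.Gamma ((k : ℝ) + ν + 1)) := fun k => by
    have := hG k
    positivity
  refine summable_of_ratio_test_tendsto_lt_one (l := 0) one_pos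
    (Eventually.of_forall fun k => (hpos k).ne') ?_
  have hlim : Tendsto (fun k : ℕ => ((x / 2) ^ 2) / (((k : ℝ) + 1) * ((k : ℝ) + (ν + 1)))) atTop (𝓝 0) := by
    refine Tendsto.const_div_atTop ?_ _
    exact (tendsto_atTop_add_const_right _ _ tendsto_natCast_atTop_atTop).atTop_mul_atTop₀
      (tendsto_atTop_add_const_right _ _ tendsto_natCast_atTop_atTop)
  refine hlim.congr fun k => ?_
  rw [Real.norm_of_nonneg (hpos _).le, Real.norm_of_nonneg (hpos _).le]
  have hk : (0:ℝ) < (k : ℝ) + ν + 1 := by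
    have : (0:ℝ) ≤ k := by positivity
    linarith
  have e : (x / 2) ^ (2 * ((k + 1 : ℕ) : ℝ) + ν) = (x / 2) ^ 2 * (x / 2) ^ (2 * (k : ℝ) + ν) := by
    rw [← Real.rpow_natCast (x / 2) 2, ← Real.rpow_add (by positivity)]
    congr 1; push_cast; ring
  have e2 : Real.Gamma (((k + 1 : ℕ) : ℝ) + ν + 1) = (k + ν + 1) * Real.Gamma (k + ν + 1) := by
    rw [← Real.Gamma_add_one hk.ne']; congr 1; push_cast; ring
  rw [e, e2, Nat.factorial_succ]
  have := hG k
  have h3 : (x / 2) ^ (2 * (k : ℝ) + ν) ≠ 0 := by positivity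
  rw [show (k : ℝ) + (ν + 1) = k + ν + 1 by ring]
  push_cast
  field_simp

lemma bessel_integral (ν x : ℝ) (hν : -(1/2) < ν) (hx : 0 < x) :
    besselI ν x = (x / 2) ^ ν * (2 / (√Real.pi * Real.Gamma (ν + 1 / 2))) *
      ∫ t in Ioo (0:ℝ) 1, (1 - t ^ 2) ^ (ν - 1 / 2) * Real.cosh (x * t) := by
  set A := (x / 2) ^ ν * (2 / (√Real.pi * Real.Gamma (ν + 1 / 2))) with hA
  have hA0 : 0 < A := by
    have := Real.Gamma_pos_of_pos (show 0 < ν + 1 / 2 by linarith)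
    positivity
  set F : ℕ → ℝ → ℝ := fun k t => (1 - t ^ 2) ^ (ν - 1 / 2) *
    ((x * t) ^ (2 * k) / (Nat.factorial (2 * k))) with hF
  have hterm := bessel_term_aux ν x hν hx
  have hs := bessel_summable ν x (by linarith) hx
  have hne : ∀ k : ℕ, ∫ t in Ioo (0:ℝ) 1, F k t ≠ 0 := by
    intro k h0
    have h := hterm k
    rw [h0, mul_zero] at h
    have : 0 < Real.Gamma ((k : ℝ) + ν + 1) := Real.Gamma_pos_of_pos (by
      have : (0:ℝ) ≤ k := by positivity
      linarith)
    have : 0 < (x / 2) ^ (2 * (k : ℝ) + ν) /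
      ((Nat.factorial k : ℝ) * Real.Gamma ((k : ℝ) + ν + 1)) := by positivity
    linarith
  have hint : ∀ k : ℕ, Integrable (F k) (volume.restrict (Ioo 0 1)) :=
    fun k => Integrable.of_integral_ne_zero (hne k)
  have hnorm : ∀ k : ℕ, ∫ t in Ioo (0:ℝ) 1, ‖F k t‖ = ∫ t in Ioo (0:ℝ) 1, F k t := by
    intro k
    refine setIntegral_congr_fun measurableSet_Ioo fun t ht => ?_
    have : 0 ≤ 1 - t ^ 2 := by nlinarith [ht.1, ht.2]
    have := ht.1
    exact Real.norm_of_nonneg (by positivity)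
  have hsum : Summable fun k => ∫ t in Ioo (0:ℝ) 1, ‖F k t‖ := by
    simp_rw [hnorm]
    have : (fun k : ℕ => A * ∫ t in Ioo (0:ℝ) 1, F k t) = fun k : ℕ =>
      (x / 2) ^ (2 * (k : ℝ) + ν) / ((Nat.factorial k : ℝ) * Real.Gamma ((k : ℝ) + ν + 1)) := by
      ext k; exact (hterm k).symm
    rw [← this] at hs
    exact (summable_mul_left_iff hA0.ne').1 hs
  have key := hasSum_integral_of_summable_integral_norm hint hsum
  have hF2 : ∀ t, ∑' k, F k t = (1 - t ^ 2) ^ (ν - 1 / 2) * Real.cosh (x * t) := by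
    intro t
    rw [hF]; simp only
    rw [tsum_mul_left, Real.cosh_eq_tsum]
  simp_rw [hF2] at key
  rw [besselI, ← key.tsum_eq, ← tsum_mul_left]
  exact tsum_congr fun k => hterm k

lemma rpow_le_add_aux {a b s : ℝ} (p : ℝ) (ha : 0 < a) (h1 : a ≤ s) (h2 : s ≤ b) :
    s ^ p ≤ a ^ p + b ^ p := by
  have hs : 0 < s := ha.trans_le h1
  have hb : 0 < b := hs.trans_le h2
  have ha' : 0 < a ^ p := by positivity
  have hb' : 0 < b ^ p := by positivity
  rcases le_total 0 p with h | h
  · have := Real.rpow_le_rpow hs.le h2 h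
    linarith
  · have := Real.rpow_le_rpow_of_nonpos ha h1 h
    linarith

lemma bessel_recurrence (ν x : ℝ) (hν : -1 < ν) (hx : 0 < x) :
    besselI ν x = 2 * (ν + 1) / x * besselI (ν + 1) x + besselI (ν + 2) x := by
  have s0 := bessel_summable ν x hν hx
  have s1 := (bessel_summable (ν + 1) x (by linarith) hx).mul_left (2 * (ν + 1) / x)
  have s2 := bessel_summable (ν + 2) x (by linarith) hx
  unfold besselI
  rw [← tsum_mul_left, s0.tsum_eq_zero_add, s1.tsum_eq_zero_add]
  rw [add_assoc (2 * (ν + 1) / x * _), ← Summable.tsum_add ((summable_nat_add_iff 1).2 s1) s2]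
  have hx2 : 0 < x / 2 := by positivity
  have hterm : ∀ k : ℕ, 2 * (ν + 1) / x * ((x / 2) ^ (2 * (k : ℝ) + (ν + 1)) /
      ((Nat.factorial k : ℝ) * Real.Gamma ((k : ℝ) + (ν + 1) + 1))) =
      (ν + 1) / (k + ν + 1) * ((x / 2) ^ (2 * (k : ℝ) + ν) /
        ((Nat.factorial k : ℝ) * Real.Gamma ((k : ℝ) + ν + 1))) := by
    intro k
    have hk : (0:ℝ) < (k : ℝ) + ν + 1 := by
      have : (0:ℝ) ≤ k := by positivity
      linarith
    have hG := Real.Gamma_pos_of_pos hk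
    rw [show (k : ℝ) + (ν + 1) + 1 = k + ν + 1 + 1 by ring, Real.Gamma_add_one hk.ne',
      ← add_assoc, Real.rpow_add_one hx2.ne']
    field_simp
  congr 1
  · rw [hterm 0]
    have : (ν + 1) ≠ 0 := by linarith
    simp [div_self this]
  · refine tsum_congr fun k => ?_
    rw [hterm (k + 1)]
    have hk : (0:ℝ) < (k : ℝ) + 1 + ν + 1 := by
      have : (0:ℝ) ≤ k := by positivity
      linarith
    have hG := Real.Gamma_pos_of_pos hk
    have e1 : Real.Gamma ((k : ℝ) + (ν + 2) + 1) = (k + 1 + ν + 1) * Real.Gamma (k + 1 + ν + 1) := by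
      rw [← Real.Gamma_add_one hk.ne']; congr 1; ring
    have e2 : (x / 2) ^ (2 * (k : ℝ) + (ν + 2)) = (x / 2) ^ (2 * ((k : ℝ) + 1) + ν) := by
      congr 1; ring
    rw [e1, e2, Nat.factorial_succ]
    push_cast
    generalize Real.Gamma ((k : ℝ) + 1 + ν + 1) = G at *
    generalize (x / 2) ^ (2 * ((k : ℝ) + 1) + ν) = P at *
    field_simp
    ring

lemma bessel_measurable (ν : ℝ) (hν : -1 < ν) :
    ∃ g : ℝ → ℝ, Measurable g ∧ ∀ x, 0 < x → besselI ν x = g x := by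
  refine ⟨fun x => (∑' k : ℕ, ENNReal.ofReal ((x / 2) ^ (2 * (k : ℝ) + ν) /
    ((Nat.factorial k : ℝ) * Real.Gamma ((k : ℝ) + ν + 1)))).toReal, ?_, ?_⟩
  · refine Measurable.ennreal_toReal (Measurable.tsum fun k => ?_)
    fun_prop
  · intro x hx
    have hpos : ∀ k : ℕ, 0 ≤ (x / 2) ^ (2 * (k : ℝ) + ν) /
      ((Nat.factorial k : ℝ) * Real.Gamma ((k : ℝ) + ν + 1)) := fun k => by
      have := Real.Gamma_pos_of_pos (show (0:ℝ) < (k : ℝ) + ν + 1 by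
        have : (0:ℝ) ≤ k := by positivity
        linarith)
      positivity
    simp only
    rw [← ENNReal.ofReal_tsum_of_nonneg hpos (bessel_summable ν x hν hx),
      ENNReal.toReal_ofReal (tsum_nonneg hpos), besselI]

lemma bessel_rescale (ν x : ℝ) (hν : -(1/2) < ν) (hx : 0 < x) :
    besselI ν x * Real.exp (-x) * √x =
      2 ^ (-ν) * (2 / (√Real.pi * Real.Gamma (ν + 1 / 2))) *
      ∫ w in Ioi (0:ℝ), (Ioo 0 x).indicator (fun w => w ^ (ν - 1 / 2) * (2 - w / x) ^ (ν - 1 / 2) *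
        ((Real.exp (-w) + Real.exp (w - 2 * x)) / 2)) w := by
  rw [bessel_integral ν x hν hx]
  have h1 : ∫ t in Ioo (0:ℝ) 1, (1 - t ^ 2) ^ (ν - 1 / 2) * Real.cosh (x * t)
      = x⁻¹ * ∫ w in Ioo (0:ℝ) x,
        (1 - (1 - w / x) ^ 2) ^ (ν - 1 / 2) * Real.cosh (x * (1 - w / x)) := by
    have := intervalIntegral.integral_comp_sub_div (a := 0) (b := x) (c := x)
      (f := fun t => (1 - t ^ 2) ^ (ν - 1 / 2) * Real.cosh (x * t)) hx.ne' 1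
    rw [div_self hx.ne', zero_div, sub_self, sub_zero,
      intervalIntegral.integral_of_le hx.le, intervalIntegral.integral_of_le zero_le_one,
      integral_Ioc_eq_integral_Ioo, integral_Ioc_eq_integral_Ioo, smul_eq_mul] at this
    rw [this, inv_mul_cancel_left₀ hx.ne']
  rw [h1, setIntegral_indicator measurableSet_Ioo,
    show Ioi (0:ℝ) ∩ Ioo 0 x = Ioo 0 x from inter_eq_right.2 (fun y hy => hy.1)]
  have h2 : ∫ w in Ioo (0:ℝ) x,
        (1 - (1 - w / x) ^ 2) ^ (ν - 1 / 2) * Real.cosh (x * (1 - w / x))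
      = ∫ w in Ioo (0:ℝ) x, (x ^ (-(ν - 1 / 2)) * Real.exp x) *
       (w ^ (ν - 1 / 2) * (2 - w / x) ^ (ν - 1 / 2) *
        ((Real.exp (-w) + Real.exp (w - 2 * x)) / 2)) := by
    refine setIntegral_congr_fun measurableSet_Ioo fun w hw => ?_
    have hw0 := hw.1
    have hwx : w / x < 1 := (div_lt_one hx).2 hw.2
    rw [show 1 - (1 - w / x) ^ 2 = x⁻¹ * (w * (2 - w / x)) by field_simp; ring,
      Real.mul_rpow (by positivity) (by apply mul_nonneg <;> linarith),
      Real.mul_rpow hw0.le (by linarith), Real.inv_rpow hx.le, ← Real.rpow_neg hx.le,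
      Real.cosh_eq, show x * (1 - w / x) = x - w by field_simp]
    rw [show Real.exp (x - w) = Real.exp x * Real.exp (-w) by rw [← Real.exp_add]; ring_nf,
      show Real.exp (-(x - w)) = Real.exp x * Real.exp (w - 2 * x) by
        rw [← Real.exp_add]; ring_nf]
    ring
  rw [h2, integral_const_mul]
  have e1 : (x / 2) ^ ν = 2 ^ (-ν) * x ^ ν := by
    rw [Real.div_rpow hx.le (by norm_num), Real.rpow_neg (by norm_num)]; field_simp
  have e2 : x ^ ν * x⁻¹ * x ^ (-(ν - 1 / 2)) * √x = 1 := by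
    rw [← Real.rpow_neg_one, Real.sqrt_eq_rpow, ← Real.rpow_add hx, ← Real.rpow_add hx,
      ← Real.rpow_add hx]
    ring_nf; simp
  have e3 : Real.exp x * Real.exp (-x) = 1 := by rw [← Real.exp_add]; simp
  rw [e1]
  generalize (∫ w in Ioo (0:ℝ) x, (_ : ℝ)) = J
  linear_combination (2 ^ (-ν) * (2 / (√Real.pi * Real.Gamma (ν + 1 / 2))) * J) *
    (e2 * (Real.exp x * Real.exp (-x)) + e3)

lemma bessel_asymp_aux (ν : ℝ) (hν : -(1/2) < ν) :
    ∃ L : ℝ, 0 < L ∧ Tendsto (fun x => besselI ν x * Real.exp (-x) * √x) atTop (𝓝 L) := by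
  set p := ν - 1 / 2 with hp
  have hp1 : -1 < p := by linarith
  have hB0 : 0 < 2 ^ (-ν) * (2 / (√Real.pi * Real.Gamma (ν + 1 / 2))) := by
    have := Real.Gamma_pos_of_pos (show 0 < ν + 1 / 2 by linarith)
    positivity
  have hgam := Real.GammaIntegral_convergent (show 0 < p + 1 by linarith)
  simp only [add_sub_cancel_right] at hgam
  have hlim : Tendsto (fun x : ℝ => ∫ w in Ioi (0:ℝ), (Ioo 0 x).indicator (fun w =>
      w ^ p * (2 - w / x) ^ p * ((Real.exp (-w) + Real.exp (w - 2 * x)) / 2)) w) atTop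
      (𝓝 (∫ w in Ioi (0:ℝ), (2 ^ p / 2) * (Real.exp (-w) * w ^ p))) := by
    refine tendsto_integral_filter_of_dominated_convergence
      (fun w => (1 ^ p + 2 ^ p) * (Real.exp (-w) * w ^ p)) ?_ ?_ (hgam.const_mul _) ?_
    · refine Eventually.of_forall fun x => ?_
      refine Measurable.aestronglyMeasurable ?_
      exact Measurable.indicator (by fun_prop) measurableSet_Ioo
    · filter_upwards [eventually_gt_atTop 0] with x hx
      refine (ae_restrict_iff' measurableSet_Ioi).2 (Eventually.of_forall fun w hw => ?_)
      have hw0 : 0 < w := hw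
      by_cases hwx : w ∈ Ioo 0 x
      · rw [indicator_of_mem hwx]
        have h1 : w / x < 1 := (div_lt_one hx).2 hwx.2
        have h1' : 0 < w / x := by positivity
        have h2 : 0 < 2 - w / x := by linarith
        rw [Real.norm_of_nonneg (by positivity)]
        have h3 : (2 - w / x) ^ p ≤ 1 ^ p + 2 ^ p :=
          rpow_le_add_aux p one_pos (by linarith) (by linarith)
        have h4 : (Real.exp (-w) + Real.exp (w - 2 * x)) / 2 ≤ Real.exp (-w) := by
          have : Real.exp (w - 2 * x) ≤ Real.exp (-w) := Real.exp_le_exp.2 (by linarith [hwx.2])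
          linarith
        calc w ^ p * (2 - w / x) ^ p * ((Real.exp (-w) + Real.exp (w - 2 * x)) / 2)
            ≤ w ^ p * (1 ^ p + 2 ^ p) * Real.exp (-w) := by gcongr
          _ = _ := by ring
      · rw [indicator_of_notMem hwx, norm_zero]
        positivity
    · refine (ae_restrict_iff' measurableSet_Ioi).2 (Eventually.of_forall fun w hw => ?_)
      have hw0 : 0 < w := hw
      have t1 : Tendsto (fun x : ℝ => w / x) atTop (𝓝 0) := tendsto_id.const_div_atTop w
      have t2 : Tendsto (fun x : ℝ => (2 - w / x) ^ p) atTop (𝓝 (2 ^ p)) := by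
        have := (tendsto_const_nhds (x := (2:ℝ))).sub t1
        rw [sub_zero] at this
        exact this.rpow_const (Or.inl two_ne_zero)
      have t3 : Tendsto (fun x : ℝ => Real.exp (w - 2 * x)) atTop (𝓝 0) := by
        refine Real.tendsto_exp_atBot.comp ?_
        simp only [sub_eq_add_neg]
        exact tendsto_atBot_add_const_left _ _
          (tendsto_neg_atTop_atBot.comp (tendsto_id.const_mul_atTop two_pos))
      have t4 := ((t2.const_mul (w ^ p)).mul
        ((t3.const_add (Real.exp (-w))).div_const 2))
      rw [show w ^ p * 2 ^ p * ((Real.exp (-w) + 0) / 2) =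
        (2 ^ p / 2) * (Real.exp (-w) * w ^ p) by ring] at t4
      refine t4.congr' ?_
      filter_upwards [eventually_gt_atTop w] with x hx
      rw [indicator_of_mem (show w ∈ Ioo 0 x from ⟨hw0, hx⟩)]
  rw [integral_const_mul] at hlim
  have hG : ∫ w in Ioi (0:ℝ), Real.exp (-w) * w ^ p = Real.Gamma (p + 1) := by
    rw [Real.Gamma_eq_integral (by linarith)]; simp
  rw [hG] at hlim
  refine ⟨_, ?_, (hlim.const_mul
    (2 ^ (-ν) * (2 / (√Real.pi * Real.Gamma (ν + 1 / 2))))).congr' ?_⟩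
  · have := Real.Gamma_pos_of_pos (show 0 < p + 1 by linarith)
    positivity
  · filter_upwards [eventually_gt_atTop 0] with x hx
    rw [bessel_rescale ν x hν hx]

lemma bessel_asymp (ν : ℝ) (hν : -1 < ν) :
    ∃ L : ℝ, 0 < L ∧ Tendsto (fun x => besselI ν x * Real.exp (-x) * √x) atTop (𝓝 L) := by
  obtain ⟨L1, _, h1⟩ := bessel_asymp_aux (ν + 1) (by linarith)
  obtain ⟨L2, hL2, h2⟩ := bessel_asymp_aux (ν + 2) (by linarith)
  refine ⟨L2, hL2, ?_⟩
  have t1 : Tendsto (fun x : ℝ => 2 * (ν + 1) / x) atTop (𝓝 0) := tendsto_id.const_div_atTop _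
  have := (t1.mul h1).add h2
  rw [zero_mul, zero_add] at this
  refine this.congr' ?_
  filter_upwards [eventually_gt_atTop 0] with x hx
  rw [bessel_recurrence ν x hν hx]; ring

lemma qTilde_integrand (c δ₁ δ₂ r z x : ℝ) (hc : 0 < c) (hc1 : c < 1) (hδ₁ : 0 < δ₁)
    (hδ₂ : 0 < δ₂) (hr : 0 < r) (hx : x ∈ Ioo 0 z) :
    x ^ (1 - δ₁ / 2) * (z - c * x) ^ (1 - δ₂ / 2) *
      sqBesselP0 δ₁ 1 x ^ 2 * sqBesselP δ₂ 1 (z * r) (z - c * x) * sqBesselP0 δ₂ 1 (z - c * x)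
    = ((2 ^ (δ₁ / 2) * Real.Gamma (δ₁ / 2)) ^ 2)⁻¹ * (2 ^ (δ₂ / 2) * Real.Gamma (δ₂ / 2))⁻¹ * 2⁻¹ *
      r ^ ((1 - δ₂) / 4) * z ^ (-(1 : ℝ) / 2) *
            Real.exp (-((Real.sqrt r - 1) ^ 2 / 2 + 1 / 2) * z) *
      (x ^ (δ₁ / 2 - 1) * (1 - c * x / z) ^ ((δ₂ - 3) / 4) *
        Real.exp (-(1 - c) * x + √r * (z * (√(1 - c * x / z) - 1))) *
        (besselI ((δ₂ - 2) / 2) (z * √r * √(1 - c * x / z)) *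
          Real.exp (-(z * √r * √(1 - c * x / z))) * √(z * √r * √(1 - c * x / z)))) := by
  obtain ⟨hx0, hxz⟩ := hx
  have hz : 0 < z := hx0.trans hxz
  obtain ⟨s, hs⟩ : ∃ s, s = 1 - c * x / z := ⟨_, rfl⟩
  have hzs : z - c * x = z * s := by rw [hs]; field_simp
  have hs0 : 0 < s := by
    have : 0 < z * s := by rw [← hzs]; nlinarith
    exact (mul_pos_iff_of_pos_left hz).1 this
  rw [← hs, hzs]
  obtain ⟨u, hu⟩ : ∃ u, u = z * √r * √s := ⟨_, rfl⟩
  have hu0 : 0 < u := by rw [hu]; positivity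
  rw [← hu]
  have hsu : √(z * r * (z * s)) = u := by
    rw [hu, Real.sqrt_eq_iff_mul_self_eq (by positivity) (by positivity)]
    linear_combination -z ^ 2 * √s ^ 2 * Real.sq_sqrt hr.le - z ^ 2 * r * Real.sq_sqrt hs0.le
  unfold sqBesselP sqBesselP0
  simp only [mul_one, div_one]
  rw [hsu]
  have e1 : x ^ (1 - δ₁ / 2) * (x ^ (δ₁ / 2 - 1)) ^ 2 = x ^ (δ₁ / 2 - 1) := by
    rw [pow_two, ← mul_assoc, ← Real.rpow_add hx0, ← Real.rpow_add hx0]; ring_nf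
  have hzs0 : 0 < z * s := by positivity
  have e2 : (z * s) ^ (1 - δ₂ / 2) * (z * s) ^ (δ₂ / 2 - 1) = 1 := by
    rw [← Real.rpow_add hzs0]; ring_nf; simp
  have e3 : (z * s / (z * r)) ^ ((δ₂ - 2) / 4) = s ^ ((δ₂ - 2) / 4) * r ^ (-((δ₂ - 2) / 4)) := by
    rw [mul_div_mul_left _ _ hz.ne', Real.div_rpow hs0.le hr.le, Real.rpow_neg hr.le,
      div_eq_mul_inv]
  have e4 : z ^ (-(1 : ℝ) / 2) * r ^ (-(1 : ℝ) / 4) * s ^ (-(1 : ℝ) / 4) * √u = 1 := by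
    rw [hu, Real.sqrt_eq_rpow, Real.sqrt_eq_rpow, Real.sqrt_eq_rpow,
      Real.mul_rpow (by positivity) (by positivity),
      Real.mul_rpow (by positivity) (by positivity), ← Real.rpow_mul hr.le,
      ← Real.rpow_mul hs0.le]
    have a1 : z ^ (-(1 : ℝ) / 2) * z ^ ((1 : ℝ) / 2) = 1 := by
      rw [← Real.rpow_add hz]; norm_num
    have a2 : r ^ (-(1 : ℝ) / 4) * r ^ ((1 : ℝ) / 2 * (1 / 2)) = 1 := by
      rw [← Real.rpow_add hr]; norm_num
    have a3 : s ^ (-(1 : ℝ) / 4) * s ^ ((1 : ℝ) / 2 * (1 / 2)) = 1 := by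
      rw [← Real.rpow_add hs0]; norm_num
    calc _ = (z ^ (-(1 : ℝ) / 2) * z ^ ((1 : ℝ) / 2)) *
        (r ^ (-(1 : ℝ) / 4) * r ^ ((1 : ℝ) / 2 * (1 / 2))) *
        (s ^ (-(1 : ℝ) / 4) * s ^ ((1 : ℝ) / 2 * (1 / 2))) := by ring
      _ = 1 := by rw [a1, a2, a3]; norm_num
  have e5 : r ^ ((1 - δ₂) / 4) = r ^ (-((δ₂ - 2) / 4)) * r ^ (-(1 : ℝ) / 4) := by
    rw [← Real.rpow_add hr]; ring_nf
  have e6 : s ^ ((δ₂ - 3) / 4) = s ^ ((δ₂ - 2) / 4) * s ^ (-(1 : ℝ) / 4) := by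
    rw [← Real.rpow_add hs0]; ring_nf
  have e7 : Real.exp (-x / 2) ^ 2 * Real.exp (-(z * r + z * s) / 2) * Real.exp (-(z * s) / 2)
      = Real.exp (-((Real.sqrt r - 1) ^ 2 / 2 + 1 / 2) * z) *
        Real.exp (-(1 - c) * x + √r * (z * (√s - 1))) * Real.exp (-u) := by
    rw [pow_two, ← Real.exp_add, ← Real.exp_add, ← Real.exp_add, ← Real.exp_add, ← Real.exp_add]
    congr 1
    rw [hu]
    linear_combination hzs + (z / 2) * Real.sq_sqrt hr.le
  rw [e3, e5, e6]
  have g1 : Real.Gamma (δ₁ / 2) ≠ 0 := (Real.Gamma_pos_of_pos (by positivity)).ne'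
  have g2 : Real.Gamma (δ₂ / 2) ≠ 0 := (Real.Gamma_pos_of_pos (by positivity)).ne'
  generalize hK1 : (2:ℝ) ^ (δ₁ / 2) * Real.Gamma (δ₁ / 2) = K1
  generalize hK2 : (2:ℝ) ^ (δ₂ / 2) * Real.Gamma (δ₂ / 2) = K2
  generalize besselI ((δ₂ - 2) / 2) u = B
  calc _ = (x ^ (1 - δ₁ / 2) * (x ^ (δ₁ / 2 - 1)) ^ 2) *
        ((z * s) ^ (1 - δ₂ / 2) * (z * s) ^ (δ₂ / 2 - 1)) *
        (Real.exp (-x / 2) ^ 2 * Real.exp (-(z * r + z * s) / 2) * Real.exp (-(z * s) / 2)) *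
        ((K1 ^ 2)⁻¹ * K2⁻¹ * 2⁻¹ * s ^ ((δ₂ - 2) / 4) * r ^ (-((δ₂ - 2) / 4)) * B) := by
          ring
    _ = (x ^ (δ₁ / 2 - 1)) *
        (Real.exp (-((Real.sqrt r - 1) ^ 2 / 2 + 1 / 2) * z) *
        Real.exp (-(1 - c) * x + √r * (z * (√s - 1))) * Real.exp (-u)) *
        ((K1 ^ 2)⁻¹ * K2⁻¹ * 2⁻¹ * s ^ ((δ₂ - 2) / 4) * r ^ (-((δ₂ - 2) / 4)) * B) *
        (z ^ (-(1 : ℝ) / 2) * r ^ (-(1 : ℝ) / 4) * s ^ (-(1 : ℝ) / 4) * √u) := by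
          rw [e1, e2, e7, e4]; ring
    _ = _ := by ring

lemma main_limit (c δ₁ q r ν L : ℝ) (hc : 0 < c) (hc1 : c < 1) (hδ₁ : 0 < δ₁)
    (hr : 0 < r) (hν : -1 < ν) (hL : 0 < L)
    (hφ : Tendsto (fun x => besselI ν x * Real.exp (-x) * √x) atTop (𝓝 L)) :
    Tendsto (fun z : ℝ => ∫ x in Ioi (0:ℝ), (Ioo 0 z).indicator (fun x =>
      x ^ (δ₁ / 2 - 1) * (1 - c * x / z) ^ q *
        Real.exp (-(1 - c) * x + √r * (z * (√(1 - c * x / z) - 1))) *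
        (besselI ν (z * √r * √(1 - c * x / z)) *
          Real.exp (-(z * √r * √(1 - c * x / z))) * √(z * √r * √(1 - c * x / z)))) x) atTop
      (𝓝 (L * (((1 - c) + c * √r / 2) ^ (-(δ₁ / 2)) * Real.Gamma (δ₁ / 2)))) := by
  set b := (1 - c) + c * √r / 2 with hb
  have hr0 : 0 < √r := Real.sqrt_pos.2 hr
  have hb0 : 0 < b := by
    have : 0 < c * √r / 2 := by positivity
    linarith
  have hgam : ∫ x in Ioi (0:ℝ), x ^ (δ₁ / 2 - 1) * Real.exp (-(b * x)) =
      b ^ (-(δ₁ / 2)) * Real.Gamma (δ₁ / 2) := by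
    rw [Real.integral_rpow_mul_exp_neg_mul_Ioi (by positivity) hb0, one_div,
      Real.inv_rpow hb0.le, Real.rpow_neg hb0.le]
  have hG0 := Real.Gamma_pos_of_pos (show 0 < δ₁ / 2 by positivity)
  have hint : Integrable (fun x => x ^ (δ₁ / 2 - 1) * Real.exp (-(b * x)))
      (volume.restrict (Ioi (0:ℝ))) := by
    apply Integrable.of_integral_ne_zero
    rw [hgam]; positivity
  rw [← hgam, ← integral_const_mul]
  obtain ⟨g, hg, hgB⟩ := bessel_measurable ν hν
  have hspos : ∀ {z x : ℝ}, x ∈ Ioo 0 z → 1 - c ≤ 1 - c * x / z ∧ 1 - c * x / z ≤ 1 := by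
    intro z x hx
    have hz : 0 < z := hx.1.trans hx.2
    have h1 : x / z < 1 := (div_lt_one hz).2 hx.2
    have h2 : 0 < x / z := div_pos hx.1 hz
    rw [mul_div_assoc]
    constructor <;> nlinarith
  have h1c : 0 < 1 - c := by linarith
  refine tendsto_integral_filter_of_dominated_convergence
    (fun x => (((1 - c) ^ q + 1 ^ q) * (L + 1)) * (x ^ (δ₁ / 2 - 1) * Real.exp (-(b * x))))
    ?_ ?_ (hint.const_mul _) ?_
  · filter_upwards [eventually_gt_atTop 0] with z hz
    have : (Ioo 0 z).indicator (fun x =>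
      x ^ (δ₁ / 2 - 1) * (1 - c * x / z) ^ q *
        Real.exp (-(1 - c) * x + √r * (z * (√(1 - c * x / z) - 1))) *
        (besselI ν (z * √r * √(1 - c * x / z)) *
          Real.exp (-(z * √r * √(1 - c * x / z))) * √(z * √r * √(1 - c * x / z))))
       = (Ioo 0 z).indicator (fun x =>
      x ^ (δ₁ / 2 - 1) * (1 - c * x / z) ^ q *
        Real.exp (-(1 - c) * x + √r * (z * (√(1 - c * x / z) - 1))) *
        (g (z * √r * √(1 - c * x / z)) *
          Real.exp (-(z * √r * √(1 - c * x / z))) * √(z * √r * √(1 - c * x / z)))) := by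
      refine indicator_congr fun x hx => ?_
      have := Real.sqrt_pos.2 (h1c.trans_le (hspos hx).1)
      rw [hgB _ (by positivity)]
    rw [this]
    refine Measurable.aestronglyMeasurable ?_
    exact Measurable.indicator (by fun_prop) measurableSet_Ioo
  · have hφb : ∀ᶠ u in atTop, ‖besselI ν u * Real.exp (-u) * √u‖ ≤ L + 1 := by
      have := hφ.norm
      rw [Real.norm_of_nonneg hL.le] at this
      exact this.eventually_le_const (by linarith)
    obtain ⟨u0, hu0⟩ := eventually_atTop.1 hφb
    have hlarge : ∀ᶠ z : ℝ in atTop, u0 ≤ z * √r * √(1 - c) := by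
      have hk : 0 < √r * √(1 - c) := mul_pos hr0 (Real.sqrt_pos.2 h1c)
      have : Tendsto (fun z : ℝ => z * (√r * √(1 - c))) atTop atTop :=
        tendsto_id.atTop_mul_const hk
      filter_upwards [this.eventually_ge_atTop u0] with z hz
      linarith
    filter_upwards [eventually_gt_atTop 0, hlarge] with z hz hzl
    refine (ae_restrict_iff' measurableSet_Ioi).2 (Eventually.of_forall fun x hx => ?_)
    have hx0 : 0 < x := hx
    by_cases hxz : x ∈ Ioo 0 z
    · rw [indicator_of_mem hxz]
      obtain ⟨hs1, hs2⟩ := hspos hxz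
      have hs0 : 0 < 1 - c * x / z := h1c.trans_le hs1
      have h1 : (1 - c * x / z) ^ q ≤ (1 - c) ^ q + 1 ^ q := rpow_le_add_aux q h1c hs1 hs2
      have h2 : Real.exp (-(1 - c) * x + √r * (z * (√(1 - c * x / z) - 1))) ≤
          Real.exp (-(b * x)) := by
        refine Real.exp_le_exp.2 ?_
        have h3 : √(1 - c * x / z) ≤ 1 - c * x / z / 2 := by
          refine Real.sqrt_le_iff.2 ⟨by linarith, ?_⟩
          nlinarith [sq_nonneg (c * x / z)]
        have h4 : z * (√(1 - c * x / z) - 1) ≤ - (c * x / 2) := by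
          calc z * (√(1 - c * x / z) - 1) ≤ z * (- (c * x / z / 2)) := by gcongr; linarith
            _ = _ := by field_simp
        have h5 := mul_le_mul_of_nonneg_left h4 hr0.le
        rw [hb]
        linarith
      have h3 := hu0 (z * √r * √(1 - c * x / z)) (hzl.trans (by gcongr))
      rw [norm_mul, Real.norm_of_nonneg (by positivity)]
      calc _ ≤ x ^ (δ₁ / 2 - 1) * ((1 - c) ^ q + 1 ^ q) * Real.exp (-(b * x)) * (L + 1) := by
            gcongr
        _ = _ := by ring
    · rw [indicator_of_notMem hxz, norm_zero]
      positivity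
  · refine (ae_restrict_iff' measurableSet_Ioi).2 (Eventually.of_forall fun x hx => ?_)
    have hx0 : 0 < x := hx
    have t1 : Tendsto (fun z : ℝ => 1 - c * x / z) atTop (𝓝 1) := by
      have := (tendsto_id (α := ℝ) (x := atTop)).const_div_atTop (c * x)
      simpa using this.const_sub 1
    have t2 : Tendsto (fun z : ℝ => √(1 - c * x / z)) atTop (𝓝 1) := by
      simpa using t1.sqrt
    have t3 : Tendsto (fun z : ℝ => (1 - c * x / z) ^ q) atTop (𝓝 1) := by
      simpa using t1.rpow_const (p := q) (Or.inl one_ne_zero)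
    have t4 : Tendsto (fun z : ℝ => z * (√(1 - c * x / z) - 1)) atTop (𝓝 (-(c * x / 2))) := by
      have h : Tendsto (fun z : ℝ => -(c * x / (√(1 - c * x / z) + 1))) atTop
          (𝓝 (-(c * x / (1 + 1)))) :=
        ((tendsto_const_nhds).div (t2.add_const 1) (by norm_num)).neg
      rw [one_add_one_eq_two] at h
      refine h.congr' ?_
      filter_upwards [eventually_gt_atTop x] with z hz
      have hz0 : 0 < z := hx0.trans hz
      obtain ⟨hs1, hs2⟩ := hspos (show x ∈ Ioo 0 z from ⟨hx0, hz⟩)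
      have hsq := Real.sq_sqrt (h1c.le.trans hs1)
      have hp : 0 < √(1 - c * x / z) + 1 := by positivity
      have hzz : z * (c * x / z) = c * x := by field_simp
      rw [← neg_div, div_eq_iff hp.ne']
      linear_combination -z * hsq + hzz
    have t5 : Tendsto (fun z : ℝ => z * √r * √(1 - c * x / z)) atTop atTop :=
      (tendsto_id.atTop_mul_const hr0).atTop_mul_pos one_pos t2
    have t6 := hφ.comp t5
    have t7 := (Real.continuous_exp.tendsto _).comp ((t4.const_mul √r).const_add (-(1 - c) * x))
    have t8 := ((t3.const_mul (x ^ (δ₁ / 2 - 1))).mul t7).mul t6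
    rw [show x ^ (δ₁ / 2 - 1) * 1 * Real.exp (-(1 - c) * x + √r * -(c * x / 2)) * L =
      L * (x ^ (δ₁ / 2 - 1) * Real.exp (-(b * x))) by rw [hb]; ring_nf] at t8
    refine t8.congr' ?_
    filter_upwards [eventually_gt_atTop x] with z hz
    rw [indicator_of_mem (show x ∈ Ioo 0 z from ⟨hx0, hz⟩)]
    rfl

/-- **Theorem (Statement 13, eq. (4.5)).** For `δ₁, δ₂ > 0` there is a positive constant
`C`, depending only on `δ₁` and `δ₂`, such that for every `0 < c < 1` and `r > 0`,
with `a₁ = (√r−1)²/2 + 1/2` and `b₁ = 1−c`,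
`q̃(z₂; z₂r) ∼ C r^{(1−δ₂)/4} (b₁ + c√r/2)^{−δ₁/2} z₂^{−1/2} e^{−a₁z₂}` as `z₂ → ∞`. -/
theorem statement13 (δ₁ δ₂ : ℝ) (hδ₁ : 0 < δ₁) (hδ₂ : 0 < δ₂) :
    ∃ C : ℝ, 0 < C ∧ ∀ c : ℝ, 0 < c → c < 1 → ∀ r : ℝ, 0 < r →
      Tendsto (fun z₂ => qTilde c δ₁ δ₂ (z₂ * r) z₂ /
          (C * r ^ ((1 - δ₂) / 4) * ((1 - c) + c * Real.sqrt r / 2) ^ (-(δ₁ / 2)) *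
            z₂ ^ (-(1 : ℝ) / 2) *
            Real.exp (-((Real.sqrt r - 1) ^ 2 / 2 + 1 / 2) * z₂))) atTop (𝓝 1) := by
  obtain ⟨L, hL, hφ⟩ := bessel_asymp ((δ₂ - 2) / 2) (by linarith)
  have hG1 := Real.Gamma_pos_of_pos (show 0 < δ₁ / 2 by positivity)
  have hG2 := Real.Gamma_pos_of_pos (show 0 < δ₂ / 2 by positivity)
  obtain ⟨K, hK⟩ : ∃ K, K = ((2 ^ (δ₁ / 2) * Real.Gamma (δ₁ / 2)) ^ 2)⁻¹ *
    (2 ^ (δ₂ / 2) * Real.Gamma (δ₂ / 2))⁻¹ * 2⁻¹ := ⟨_, rfl⟩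
  have hK0 : 0 < K := by rw [hK]; positivity
  refine ⟨K * (L * Real.Gamma (δ₁ / 2)), by positivity, fun c hc hc1 r hr => ?_⟩
  have hlim := main_limit c δ₁ ((δ₂ - 3) / 4) r _ L hc hc1 hδ₁ hr (by linarith) hL hφ
  have hr0 : 0 < √r := Real.sqrt_pos.2 hr
  have hb0 : 0 < (1 - c) + c * √r / 2 := by
    have : 0 < c * √r / 2 := by positivity
    linarith
  have hne : L * (((1 - c) + c * √r / 2) ^ (-(δ₁ / 2)) * Real.Gamma (δ₁ / 2)) ≠ 0 := by positivity
  have h1 := hlim.div_const (L * (((1 - c) + c * √r / 2) ^ (-(δ₁ / 2)) * Real.Gamma (δ₁ / 2)))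
  rw [div_self hne] at h1
  refine h1.congr' ?_
  filter_upwards [eventually_gt_atTop 0] with z hz
  unfold qTilde
  rw [setIntegral_congr_fun measurableSet_Ioo (fun x hx =>
    qTilde_integrand c δ₁ δ₂ r z x hc hc1 hδ₁ hδ₂ hr hx), integral_const_mul, ← hK,
    setIntegral_indicator measurableSet_Ioo,
    show Ioi (0:ℝ) ∩ Ioo 0 z = Ioo 0 z from inter_eq_right.2 (fun y hy => hy.1)]
  generalize (∫ x in Ioo (0:ℝ) z, (_ : ℝ)) = J
  have p1 : 0 < r ^ ((1 - δ₂) / 4) := by positivity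
  have p2 : 0 < z ^ (-(1 : ℝ) / 2) := by positivity
  have p3 : 0 < (1 - c + c * √r / 2) ^ (-(δ₁ / 2)) := by positivity
  have p4 : 0 < Real.exp (-((√r - 1) ^ 2 / 2 + 1 / 2) * z) := Real.exp_pos _
  generalize r ^ ((1 - δ₂) / 4) = P1 at *
  generalize z ^ (-(1 : ℝ) / 2) = P2 at *
  generalize (1 - c + c * √r / 2) ^ (-(δ₁ / 2)) = P3 at *
  generalize Real.exp (-((√r - 1) ^ 2 / 2 + 1 / 2) * z) = P4 at *
  generalize Real.Gamma (δ₁ / 2) = G at *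
  rw [div_eq_div_iff (by positivity) (by positivity)]
  ring
end

section
/- Let 0 < c < 1 and δ₁, δ₂ > 0. Then there exists a positive constant C, depending only on δ₁ and δ₂, such that for every r > 0, setting a₂ = (√r−1)²/2 and b₂ = (1−c)/2, one has q(z₂; z₂·r) ∼ C·r^{(1−δ₂)/4}·(b₂ + c√r/2)^{−δ₁/2}·z₂^{−1/2}·e^{−a₂·z₂} as z₂ → ∞, where q(z₂;z₁) is defined in the context. -/
open MeasureTheory Filter Set Topology

lemma aux_beta_ioi (k : ℕ) {a : ℝ} (ha : 0 < a) :
    ∫ t in Ioo (0:ℝ) 1, t ^ (2 * k) * (1 - t ^ 2) ^ (a - 1) =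
      Real.Gamma (k + 1 / 2) * Real.Gamma a / Real.Gamma (k + 1 / 2 + a) / 2 := by
  have hk : (0:ℝ) < k + 1 / 2 := by positivity
  have hB := ProbabilityTheory.beta_pos hk ha
  have h1 : ∫ u, ProbabilityTheory.betaPDFReal (k + 1 / 2) a u = 1 := by
    rw [integral_eq_lintegral_of_nonneg_ae]
    · have := ProbabilityTheory.lintegral_betaPDF_eq_one hk ha
      simp only [ProbabilityTheory.betaPDF] at this
      rw [this]; simp
    · refine ae_of_all _ fun u => ?_
      by_cases hu : 0 < u ∧ u < 1
      · exact (ProbabilityTheory.betaPDFReal_pos hu.1 hu.2 hk ha).le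
      · simp [ProbabilityTheory.betaPDFReal, hu]
    · exact (ProbabilityTheory.measurable_betaPDFReal _ _).aestronglyMeasurable
  have h2 : ∫ u in Ioi (0:ℝ), ProbabilityTheory.betaPDFReal (k + 1 / 2) a u = 1 := by
    rw [setIntegral_eq_integral_of_forall_compl_eq_zero, h1]
    intro u hu
    have : ¬ (0 < u ∧ u < 1) := fun h => hu h.1
    simp [ProbabilityTheory.betaPDFReal, this]
  rw [← integral_comp_rpow_Ioi_of_pos (p := 2) two_pos] at h2
  have h3 : ∫ t in Ioi (0:ℝ), (2 * t ^ ((2:ℝ) - 1)) •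
      ProbabilityTheory.betaPDFReal (k + 1 / 2) a (t ^ (2:ℝ)) =
      ∫ t in Ioo (0:ℝ) 1, (2 / ProbabilityTheory.beta (k + 1 / 2) a) *
        (t ^ (2 * k) * (1 - t ^ 2) ^ (a - 1)) := by
    rw [← integral_indicator measurableSet_Ioi, ← integral_indicator measurableSet_Ioo]
    congr 1
    ext t
    by_cases ht : t ∈ Ioo (0:ℝ) 1
    · have ht0 : (0:ℝ) < t := ht.1
      have ht1 : t < 1 := ht.2
      have ht2 : 0 < t ^ 2 ∧ t ^ 2 < 1 := ⟨by positivity, by nlinarith⟩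
      rw [indicator_of_mem (by exact ht0), indicator_of_mem ht]
      simp only [Real.rpow_two, ProbabilityTheory.betaPDFReal, if_pos ht2, smul_eq_mul]
      have e1 : (t ^ 2) ^ ((k:ℝ) + 1 / 2 - 1) * t = t ^ (2 * k) := by
        rw [← Real.rpow_two, ← Real.rpow_mul ht0.le, ← Real.rpow_natCast]
        nth_rw 2 [← Real.rpow_one t]
        rw [← Real.rpow_add ht0]
        congr 1
        push_cast
        ring
      have e2 : t ^ ((2:ℝ) - 1) = t := by
        rw [show (2:ℝ) - 1 = 1 by norm_num, Real.rpow_one]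
      rw [e2, ← e1]
      ring
    · rw [indicator_of_notMem ht]
      by_cases h0 : t ∈ Ioi (0:ℝ)
      · rw [indicator_of_mem h0]
        have h0' : 0 < t := h0
        have ht1 : 1 ≤ t := by
          by_contra h
          exact ht ⟨h0', lt_of_not_ge h⟩
        have : ¬ (0 < t ^ 2 ∧ t ^ 2 < 1) := by
          rintro ⟨_, h⟩
          nlinarith
        simp only [Real.rpow_two, ProbabilityTheory.betaPDFReal, if_neg this, smul_zero]
      · rw [indicator_of_notMem h0]
  rw [h3, integral_const_mul] at h2
  have h4 : ProbabilityTheory.beta (k + 1 / 2) a =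
    Real.Gamma (k + 1 / 2) * Real.Gamma a / Real.Gamma (k + 1 / 2 + a) := rfl
  rw [← h4]
  generalize ProbabilityTheory.beta (k + 1 / 2) a = B at *
  field_simp at h2
  linarith

lemma aux_gamma_half (k : ℕ) : Real.Gamma (k + 1 / 2) * (4 ^ k * (k.factorial : ℝ)) =
    ((2 * k).factorial : ℝ) * √Real.pi := by
  induction k with
  | zero =>
    have := Real.Gamma_one_half_eq
    rw [one_div] at this
    simp [this]
  | succ n ih =>
    have e : (((n + 1 : ℕ) : ℝ) + 1 / 2) = (n + 1 / 2 : ℝ) + 1 := by push_cast; ring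
    rw [e, Real.Gamma_add_one (by positivity)]
    rw [show 2 * (n + 1) = (2 * n + 1) + 1 by ring, Nat.factorial_succ, Nat.factorial_succ,
      Nat.factorial_succ]
    push_cast
    linear_combination (2 * n + 2) * (2 * n + 1) * ih

lemma aux_int (k : ℕ) {a : ℝ} (ha : 0 < a) :
    IntegrableOn (fun t : ℝ => t ^ (2 * k) * (1 - t ^ 2) ^ (a - 1)) (Ioo 0 1) := by
  by_contra h
  have h1 := integral_undef h
  rw [aux_beta_ioi k ha] at h1
  have h2 : (0:ℝ) < k + 1 / 2 := by positivity
  have := Real.Gamma_pos_of_pos h2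
  have := Real.Gamma_pos_of_pos ha
  have := Real.Gamma_pos_of_pos (add_pos h2 ha)
  have : 0 < Real.Gamma (k + 1 / 2) * Real.Gamma a / Real.Gamma (k + 1 / 2 + a) / 2 := by
    positivity
  linarith

lemma bessel_hasSum {ν x : ℝ} (hν : -1 / 2 < ν) (hx : 0 < x) :
    HasSum (fun k : ℕ => (x / 2) ^ (2 * (k : ℝ) + ν) /
      ((Nat.factorial k : ℝ) * Real.Gamma ((k : ℝ) + ν + 1)))
      ((x / 2) ^ ν * (2 / (√Real.pi * Real.Gamma (ν + 1 / 2))) *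
        ∫ t in Ioo (0:ℝ) 1, Real.cosh (x * t) * (1 - t ^ 2) ^ (ν + 1 / 2 - 1)) := by
  have ha : 0 < ν + 1 / 2 := by linarith
  have hG := Real.Gamma_pos_of_pos ha
  have hpi : 0 < √Real.pi := Real.sqrt_pos.2 Real.pi_pos
  have hnn : ∀ k : ℕ, ∀ t ∈ Ioo (0:ℝ) 1,
      0 ≤ t ^ (2 * k) * (1 - t ^ 2) ^ (ν + 1 / 2 - 1) := by
    intro k t ht
    have : 0 ≤ 1 - t ^ 2 := by nlinarith [ht.1, ht.2]
    have := ht.1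
    positivity
  have key := hasSum_integral_of_summable_integral_norm (μ := volume.restrict (Ioo (0:ℝ) 1))
    (F := fun (k : ℕ) (t : ℝ) => (x ^ (2 * k) / ((2 * k).factorial : ℝ)) *
      (t ^ (2 * k) * (1 - t ^ 2) ^ (ν + 1 / 2 - 1)))
    (fun k => (aux_int k ha).const_mul _) ?_
  · have e1 : ∫ t in Ioo (0:ℝ) 1, (∑' k : ℕ, (x ^ (2 * k) / ((2 * k).factorial : ℝ)) *
      (t ^ (2 * k) * (1 - t ^ 2) ^ (ν + 1 / 2 - 1))) =
      ∫ t in Ioo (0:ℝ) 1, Real.cosh (x * t) * (1 - t ^ 2) ^ (ν + 1 / 2 - 1) := by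
      congr 1
      ext t
      refine HasSum.tsum_eq ?_
      refine ((Real.hasSum_cosh (x * t)).mul_right ((1 - t ^ 2) ^ (ν + 1 / 2 - 1))).congr_fun ?_
      intro k
      rw [mul_pow]; ring
    rw [e1] at key
    refine (key.mul_left ((x / 2) ^ ν * (2 / (√Real.pi * Real.Gamma (ν + 1 / 2))))).congr_fun ?_
    intro k
    rw [integral_const_mul, aux_beta_ioi k ha]
    have hg := aux_gamma_half k
    have hx2 : 0 < x / 2 := by positivity
    rw [Real.rpow_add hx2, show (k:ℝ) + 1 / 2 + (ν + 1 / 2) = k + ν + 1 by ring,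
      show (2 * (k:ℝ)) = ((2 * k : ℕ) : ℝ) by push_cast; ring, Real.rpow_natCast]
    have hG2 : 0 < Real.Gamma (k + ν + 1) :=
      Real.Gamma_pos_of_pos (by have : (0:ℝ) ≤ k := Nat.cast_nonneg k
                                linarith)
    have e4 : x ^ (2 * k) = (x / 2) ^ (2 * k) * 4 ^ k := by
      rw [div_pow, show (4:ℝ) = 2 ^ 2 by norm_num, ← pow_mul]; field_simp
    rw [e4]
    have hf : (0:ℝ) < k.factorial := by positivity
    have hf2 : (0:ℝ) < (2 * k).factorial := by positivity
    generalize Real.Gamma (k + ν + 1) = A at *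
    generalize Real.Gamma (k + 1 / 2) = B at *
    generalize Real.Gamma (ν + 1 / 2) = D at *
    field_simp
    linear_combination -hg
  · have hs : Summable (fun k : ℕ => (x ^ (2 * k) / ((2 * k).factorial : ℝ)) *
      ∫ t in Ioo (0:ℝ) 1, t ^ (2 * 0) * (1 - t ^ 2) ^ (ν + 1 / 2 - 1)) :=
      (Real.hasSum_cosh x).summable.mul_right _
    refine Summable.of_nonneg_of_le ?_ ?_ hs
    · intro k; exact integral_nonneg fun t => norm_nonneg _
    · intro k
      rw [← integral_const_mul]
      refine setIntegral_mono_on ((aux_int k ha).const_mul _).norm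
        ((aux_int 0 ha).const_mul _) measurableSet_Ioo ?_
      intro t ht
      rw [Real.norm_of_nonneg (mul_nonneg (by positivity) (hnn k t ht))]
      have : 0 ≤ (1 - t ^ 2) ^ (ν + 1 / 2 - 1) := by simpa using hnn 0 t ht
      have : t ^ (2 * k) ≤ t ^ (2 * 0) :=
        pow_le_pow_of_le_one ht.1.le ht.2.le (by simp)
      gcongr

lemma bessel_rec {ν x : ℝ} (hν : -1 < ν) (hx : 0 < x) :
    besselI ν x = besselI (ν + 2) x + 2 * (ν + 1) / x * besselI (ν + 1) x := by
  have h1 := (bessel_hasSum (ν := ν + 1) (by linarith) hx).summable.hasSum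
  have h2 := (bessel_hasSum (ν := ν + 2) (by linarith) hx).summable.hasSum
  have h3 : HasSum (fun k : ℕ => k * (x / 2) ^ (2 * (k : ℝ) + ν) /
      ((Nat.factorial k : ℝ) * Real.Gamma ((k : ℝ) + ν + 2))) (besselI (ν + 2) x) := by
    rw [← hasSum_nat_add_iff' 1]
    simp only [Finset.range_one, Finset.sum_singleton, Nat.cast_zero, zero_mul, zero_div, sub_zero]
    refine h2.congr_fun ?_
    intro k
    rw [Nat.factorial_succ]
    push_cast
    rw [show 2 * ((k:ℝ) + 1) + ν = 2 * k + (ν + 2) by ring,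
      show (k:ℝ) + 1 + ν + 2 = k + (ν + 2) + 1 by ring]
    have : (k:ℝ) + 1 ≠ 0 := by positivity
    rw [mul_assoc, mul_div_mul_left _ _ this]
  refine HasSum.tsum_eq ?_
  refine (h3.add (h1.mul_left (2 * (ν + 1) / x))).congr_fun ?_
  intro k
  have hk : (0:ℝ) < k + ν + 1 := by
    have : (0:ℝ) ≤ k := Nat.cast_nonneg k
    linarith
  have hG := Real.Gamma_pos_of_pos hk
  rw [show (k:ℝ) + ν + 2 = k + ν + 1 + 1 by ring, show (k:ℝ) + (ν + 1) + 1 = k + ν + 1 + 1 by ring,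
    Real.Gamma_add_one hk.ne', show 2 * (k:ℝ) + (ν + 1) = 2 * k + ν + 1 by ring,
    Real.rpow_add_one (by positivity)]
  have hf : (0:ℝ) < k.factorial := by positivity
  field_simp
  ring

lemma bessel_meas (ν : ℝ) : Measurable (besselI ν) := by
  unfold besselI
  exact Measurable.tsum (fun k => by fun_prop)

lemma rpow_bound {w M p : ℝ} (hw : M⁻¹ ≤ w) (hw2 : w ≤ M) (hM : 1 ≤ M) :
    w ^ p ≤ M ^ |p| := by
  have hM0 : 0 < M := by linarith
  have hw0 : 0 < w := lt_of_lt_of_le (by positivity) hw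
  rcases le_total 0 p with hp | hp
  · rw [abs_of_nonneg hp]
    exact Real.rpow_le_rpow hw0.le hw2 hp
  · rw [abs_of_nonpos hp]
    rw [show w ^ p = (w⁻¹) ^ (-p) by rw [Real.inv_rpow hw0.le, Real.rpow_neg hw0.le, inv_inv]]
    refine Real.rpow_le_rpow (by positivity) ?_ (by linarith)
    exact inv_le_of_inv_le₀ hM0 hw

lemma bessel_subst {ν x : ℝ} (hx : 0 < x) :
    ∫ t in Ioo (0:ℝ) 1, Real.cosh (x * t) * (1 - t ^ 2) ^ (ν + 1 / 2 - 1) =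
      x⁻¹ * x ^ (-(ν + 1 / 2 - 1)) * ∫ s in Ioo (0:ℝ) x,
        Real.cosh (x - s) * (s ^ (ν + 1 / 2 - 1) * (2 - s / x) ^ (ν + 1 / 2 - 1)) := by
  rw [← integral_Ioc_eq_integral_Ioo, ← intervalIntegral.integral_of_le zero_le_one]
  have h := intervalIntegral.integral_comp_sub_div (a := 0) (b := x)
    (fun t => Real.cosh (x * t) * (1 - t ^ 2) ^ (ν + 1 / 2 - 1)) hx.ne' 1
  rw [div_self hx.ne', sub_self, zero_div, sub_zero, smul_eq_mul,
    intervalIntegral.integral_of_le hx.le, integral_Ioc_eq_integral_Ioo] at h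
  have h2 : ∫ s in Ioo 0 x, Real.cosh (x * (1 - s / x)) * (1 - (1 - s / x) ^ 2) ^ (ν + 1 / 2 - 1)
      = ∫ s in Ioo (0:ℝ) x, x ^ (-(ν + 1 / 2 - 1)) *
        (Real.cosh (x - s) * (s ^ (ν + 1 / 2 - 1) * (2 - s / x) ^ (ν + 1 / 2 - 1))) := by
    refine setIntegral_congr_fun measurableSet_Ioo ?_
    intro s hs
    have hs0 : 0 < s := hs.1
    have hsx : s / x < 1 := (div_lt_one hx).2 hs.2
    have e1 : 1 - (1 - s / x) ^ 2 = x⁻¹ * s * (2 - s / x) := by field_simp; ring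
    have e2 : x * (1 - s / x) = x - s := by field_simp
    simp only []
    rw [e1, e2, Real.mul_rpow (by positivity) (by linarith), Real.mul_rpow (by positivity) hs0.le,
      Real.inv_rpow hx.le, Real.rpow_neg hx.le]
    ring
  rw [h2, integral_const_mul] at h
  rw [mul_assoc, h]
  field_simp

lemma bessel_lim_half {ν : ℝ} (hν : -1 / 2 < ν) :
    ∃ L : ℝ, 0 < L ∧ Tendsto (fun x => √x * Real.exp (-x) * besselI ν x) atTop (𝓝 L) := by
  set p := ν + 1 / 2 - 1 with hp
  have ha : 0 < ν + 1 / 2 := by linarith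
  have hG := Real.Gamma_pos_of_pos ha
  have hpi : 0 < √Real.pi := Real.sqrt_pos.2 Real.pi_pos
  set F : ℝ → ℝ → ℝ := fun x s => (Ioo (0:ℝ) x).indicator
    (fun s => Real.exp (-x) * (Real.cosh (x - s) * (s ^ p * (2 - s / x) ^ p))) s with hF
  have hlim : Tendsto (fun x => ∫ s in Ioi (0:ℝ), F x s) atTop
      (𝓝 (∫ s in Ioi (0:ℝ), 2 ^ p / 2 * (s ^ p * Real.exp (-(1 * s))))) := by
    refine tendsto_integral_filter_of_dominated_convergence
      (fun s => 2 ^ |p| * (s ^ p * Real.exp (-(1 * s)))) ?_ ?_ ?_ ?_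
    · refine Eventually.of_forall fun x => ?_
      refine (Measurable.indicator ?_ measurableSet_Ioo).aestronglyMeasurable
      have := Real.continuous_cosh.measurable
      fun_prop
    · filter_upwards [eventually_gt_atTop 0] with x hx
      rw [ae_restrict_iff' measurableSet_Ioi]
      refine ae_of_all _ fun s hs => ?_
      have hs0 : 0 < s := hs
      by_cases h : s ∈ Ioo (0:ℝ) x
      · simp only [hF, indicator_of_mem h]
        have hsx : s / x < 1 := (div_lt_one hx).2 h.2
        have hsx0 : 0 < s / x := by positivity
        have h2 : (2 - s / x) ^ p ≤ 2 ^ |p| :=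
          rpow_bound (by norm_num; linarith) (by linarith) (by norm_num)
        have h20 : 0 < 2 - s / x := by linarith
        have hc : Real.exp (-x) * Real.cosh (x - s) ≤ Real.exp (-(1 * s)) := by
          have : Real.cosh (x - s) ≤ Real.exp (x - s) := by
            rw [Real.cosh_eq]
            have : Real.exp (-(x - s)) ≤ Real.exp (x - s) :=
              Real.exp_le_exp.2 (by linarith [h.2])
            linarith
          calc _ ≤ Real.exp (-x) * Real.exp (x - s) := by gcongr
            _ = _ := by rw [← Real.exp_add]; congr 1; ring
        have hc0 := Real.cosh_pos (x - s)
        rw [Real.norm_of_nonneg (by positivity)]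
        calc _ = (Real.exp (-x) * Real.cosh (x - s)) * s ^ p * (2 - s / x) ^ p := by ring
          _ ≤ Real.exp (-(1 * s)) * s ^ p * 2 ^ |p| := by gcongr
          _ = _ := by ring
      · simp only [hF, indicator_of_notMem h, norm_zero]
        positivity
    · refine Integrable.const_mul ?_ _
      have := integrableOn_rpow_mul_exp_neg_mul_rpow (p := 1) (s := p) (b := 1) (by linarith)
        one_pos one_pos
      simpa [IntegrableOn] using this
    · rw [ae_restrict_iff' measurableSet_Ioi]
      refine ae_of_all _ fun s hs => ?_
      have hs0 : 0 < s := hs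
      have h1 : Tendsto (fun x : ℝ => (Real.exp (-s) + Real.exp (s - 2 * x)) / 2 *
          (s ^ p * (2 - s / x) ^ p)) atTop (𝓝 ((Real.exp (-s) + 0) / 2 * (s ^ p * (2 - 0) ^ p))) := by
        refine Tendsto.mul (Tendsto.div_const (tendsto_const_nhds.add ?_) _)
          (tendsto_const_nhds.mul ?_)
        · refine Real.tendsto_exp_atBot.comp ?_
          refine tendsto_atBot_add_const_left _ s ?_ |>.congr (fun x => (sub_eq_add_neg _ _).symm)
          exact tendsto_neg_atTop_atBot.comp (tendsto_id.const_mul_atTop two_pos)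
        · refine Tendsto.rpow_const ?_ (Or.inl (by norm_num))
          exact tendsto_const_nhds.sub (tendsto_const_nhds.div_atTop tendsto_id)
      have e : (Real.exp (-s) + 0) / 2 * (s ^ p * (2 - 0) ^ p) =
        2 ^ p / 2 * (s ^ p * Real.exp (-(1 * s))) := by
        rw [sub_zero, one_mul]; ring
      rw [e] at h1
      refine h1.congr' ?_
      filter_upwards [eventually_gt_atTop s] with x hx
      simp only [hF, indicator_of_mem (show s ∈ Ioo (0:ℝ) x from ⟨hs0, hx⟩)]
      have : (Real.exp (-s) + Real.exp (s - 2 * x)) / 2 = Real.exp (-x) * Real.cosh (x - s) := by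
        rw [Real.cosh_eq, mul_div_assoc', mul_add, ← Real.exp_add, ← Real.exp_add]
        congr 3 <;> ring
      rw [this]; ring
  rw [integral_const_mul, Real.integral_rpow_mul_exp_neg_mul_Ioi ha one_pos] at hlim
  refine ⟨2 ^ (-ν) * (2 / (√Real.pi * Real.Gamma (ν + 1 / 2))) *
    (2 ^ p / 2 * ((1 / 1) ^ (ν + 1 / 2) * Real.Gamma (ν + 1 / 2))), by positivity, ?_⟩
  refine (hlim.const_mul (2 ^ (-ν) * (2 / (√Real.pi * Real.Gamma (ν + 1 / 2))))).congr' ?_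
  filter_upwards [eventually_gt_atTop 0] with x hx
  have hb : besselI ν x = _ := (bessel_hasSum hν hx).tsum_eq
  rw [hb, bessel_subst hx]
  have e1 : ∫ s in Ioi (0:ℝ), F x s = Real.exp (-x) * ∫ s in Ioo (0:ℝ) x,
      Real.cosh (x - s) * (s ^ p * (2 - s / x) ^ p) := by
    rw [← integral_const_mul, setIntegral_indicator measurableSet_Ioo,
      inter_eq_right.2 Ioo_subset_Ioi_self]
  rw [e1, ← hp, Real.div_rpow hx.le two_pos.le, Real.rpow_neg two_pos.le, Real.sqrt_eq_rpow x]
  have e2 : x ^ (1 / 2 : ℝ) * x ^ ν * (x⁻¹ * x ^ (-p)) = 1 := by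
    rw [← Real.rpow_neg_one x, ← Real.rpow_add hx, ← Real.rpow_add hx, ← Real.rpow_add hx,
      hp, show 1 / 2 + ν + (-1 + -(ν + 1 / 2 - 1)) = 0 by ring, Real.rpow_zero]
  generalize (∫ s in Ioo (0:ℝ) x, Real.cosh (x - s) * (s ^ p * (2 - s / x) ^ p)) = J
  linear_combination (-(Real.exp (-x) * J * (2 ^ ν)⁻¹ *
    (2 / (√Real.pi * Real.Gamma (ν + 1 / 2))))) * e2

lemma bessel_lim {ν : ℝ} (hν : -1 < ν) :
    ∃ L : ℝ, 0 < L ∧ Tendsto (fun x => √x * Real.exp (-x) * besselI ν x) atTop (𝓝 L) := by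
  obtain ⟨L1, hL1, h1⟩ := bessel_lim_half (ν := ν + 1) (by linarith)
  obtain ⟨L2, hL2, h2⟩ := bessel_lim_half (ν := ν + 2) (by linarith)
  refine ⟨L2, hL2, ?_⟩
  have h3 : Tendsto (fun x : ℝ => 2 * (ν + 1) / x) atTop (𝓝 0) :=
    tendsto_const_nhds.div_atTop tendsto_id
  have h4 := h2.add (h3.mul h1)
  rw [zero_mul, add_zero] at h4
  refine h4.congr' ?_
  filter_upwards [eventually_gt_atTop 0] with x hx
  rw [bessel_rec hν hx]
  ring

/-- The rescaled integrand. -/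
lemma integrand_eq {c δ₁ δ₂ r z x : ℝ} (hc0 : 0 < c) (hc : c < 1) (hr : 0 < r)
    (hz : 0 < z) (hx : 0 < x) (hxz : x < z) (w y : ℝ) (hw : w = 1 - c * x / z)
    (hy : y = z * √r * √w) :
    sqBesselP0 δ₁ 1 x * sqBesselP δ₂ 1 (z * r) (z - c * x) =
      (1 / 2 / (2 ^ (δ₁ / 2) * Real.Gamma (δ₁ / 2)) * r ^ ((1 - δ₂) / 4) *
        (z ^ (-(1 : ℝ) / 2) * Real.exp (-((√r - 1) ^ 2 / 2) * z))) *
      (x ^ (δ₁ / 2 - 1) * w ^ ((δ₂ - 2) / 4 - 1 / 4) *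
        (√y * Real.exp (-y) * besselI ((δ₂ - 2) / 2) y) *
        Real.exp (-(x * ((1 - c) / 2 + c * √r / (1 + √w))))) := by
  have hw0 : 0 < w := by
    rw [hw]
    have : c * x / z < 1 := by rw [div_lt_one hz]; nlinarith
    linarith
  have hsr : 0 < √r := Real.sqrt_pos.2 hr
  have hsw : 0 < √w := Real.sqrt_pos.2 hw0
  have hy0 : 0 < y := by rw [hy]; positivity
  have hrr : √r ^ 2 = r := Real.sq_sqrt hr.le
  have hww : √w ^ 2 = w := Real.sq_sqrt hw0.le
  have hzw : z - c * x = z * w := by rw [hw]; field_simp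
  have e1 : √(z * r * (z - c * x)) = y := by
    rw [hzw, hy, Real.sqrt_eq_iff_mul_self_eq (by positivity) (by positivity)]
    linear_combination -(z ^ 2 * √w ^ 2 * hrr + z ^ 2 * r * hww)
  have e2 : (z - c * x) / (z * r) = w / r := by
    rw [hzw]; field_simp
  have e3 : √y = z ^ (1 / 2 : ℝ) * r ^ (1 / 4 : ℝ) * w ^ (1 / 4 : ℝ) := by
    rw [hy, Real.sqrt_eq_rpow, Real.mul_rpow (by positivity) hsw.le,
      Real.mul_rpow hz.le hsr.le, Real.sqrt_eq_rpow, Real.sqrt_eq_rpow,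
      ← Real.rpow_mul hr.le, ← Real.rpow_mul hw0.le]
    norm_num
  have e4 : Real.exp (-x / (2 * 1)) * Real.exp (-(z * r + (z - c * x)) / (2 * 1)) =
      Real.exp (-((√r - 1) ^ 2 / 2) * z) * Real.exp (-y) *
        Real.exp (-(x * ((1 - c) / 2 + c * √r / (1 + √w)))) := by
    rw [← Real.exp_add, ← Real.exp_add, ← Real.exp_add]
    congr 1
    have h1 : c * x = z * (1 - √w) * (1 + √w) := by linear_combination -hzw + z * hww
    have h2 : x * (c * √r / (1 + √w)) = √r * (z * (1 - √w)) := by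
      rw [mul_div_assoc', div_eq_iff (by positivity)]
      linear_combination √r * h1
    rw [hy]
    linear_combination h2 + z / 2 * hrr
  have e5 : r ^ ((1 - δ₂) / 4) * r ^ (1 / 4 : ℝ) = (r ^ ((δ₂ - 2) / 4))⁻¹ := by
    rw [← Real.rpow_add hr, ← Real.rpow_neg hr.le]; congr 1; ring
  have e6 : z ^ (-(1:ℝ) / 2) * z ^ (1 / 2 : ℝ) = 1 := by
    rw [← Real.rpow_add hz]; norm_num
  have e7 : w ^ ((δ₂ - 2) / 4 - 1 / 4) * w ^ (1 / 4 : ℝ) = w ^ ((δ₂ - 2) / 4) := by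
    rw [← Real.rpow_add hw0]; congr 1; ring
  unfold sqBesselP0 sqBesselP
  rw [e1, e2, div_one, e3, Real.div_rpow hw0.le hr.le, div_eq_mul_inv (w ^ _), ← e5, ← e7]
  rw [mul_one] at *
  generalize besselI ((δ₂ - 2) / 2) y = I
  calc _ = x ^ (δ₁ / 2 - 1) / (2 ^ (δ₁ / 2) * Real.Gamma (δ₁ / 2)) * 2⁻¹ *
      (w ^ ((δ₂ - 2) / 4 - 1 / 4) * w ^ (1 / 4 : ℝ)) * (r ^ ((1 - δ₂) / 4) * r ^ (1 / 4 : ℝ)) * I *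
      (Real.exp (-x / 2) * Real.exp (-(z * r + (z - c * x)) / 2)) := by ring
    _ = _ := by
      rw [e4]
      linear_combination (-(x ^ (δ₁ / 2 - 1) / (2 ^ (δ₁ / 2) * Real.Gamma (δ₁ / 2)) * 2⁻¹ *
      (w ^ ((δ₂ - 2) / 4 - 1 / 4) * w ^ (1 / 4 : ℝ)) * (r ^ ((1 - δ₂) / 4) * r ^ (1 / 4 : ℝ)) * I *
      (Real.exp (-((√r - 1) ^ 2 / 2) * z) * Real.exp (-y) *
        Real.exp (-(x * ((1 - c) / 2 + c * √r / (1 + √w))))))) * e6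

lemma main_lim {c δ₁ δ₂ r L : ℝ} (hδ₁ : 0 < δ₁) (hc0 : 0 < c) (hc : c < 1) (hr : 0 < r)
    (hL : Tendsto (fun x => √x * Real.exp (-x) * besselI ((δ₂ - 2) / 2) x) atTop (𝓝 L)) :
    Tendsto (fun z => ∫ x in Ioi (0:ℝ), (Ioo (0:ℝ) z).indicator (fun x =>
      (x ^ (δ₁ / 2 - 1) * (1 - c * x / z) ^ ((δ₂ - 2) / 4 - 1 / 4) *
        (√(z * √r * √(1 - c * x / z)) * Real.exp (-(z * √r * √(1 - c * x / z))) *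
          besselI ((δ₂ - 2) / 2) (z * √r * √(1 - c * x / z))) *
        Real.exp (-(x * ((1 - c) / 2 + c * √r / (1 + √(1 - c * x / z))))))) x) atTop
      (𝓝 (L * (((1 - c) / 2 + c * √r / 2) ^ (-(δ₁ / 2)) * Real.Gamma (δ₁ / 2)))) := by
  have hsr : 0 < √r := Real.sqrt_pos.2 hr
  have hB : 0 < (1 - c) / 2 + c * √r / 2 := by
    have : 0 < c * √r := by positivity
    linarith
  set m := (δ₂ - 2) / 4 - 1 / 4 with hm
  set G : ℝ → ℝ := fun x => √x * Real.exp (-x) * besselI ((δ₂ - 2) / 2) x with hG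
  have hGm : Measurable G := by
    have := bessel_meas ((δ₂ - 2) / 2)
    fun_prop
  have hI : L * (((1 - c) / 2 + c * √r / 2) ^ (-(δ₁ / 2)) * Real.Gamma (δ₁ / 2)) =
      ∫ x in Ioi (0:ℝ), L * (x ^ (δ₁ / 2 - 1) *
        Real.exp (-(((1 - c) / 2 + c * √r / 2) * x))) := by
    rw [integral_const_mul, Real.integral_rpow_mul_exp_neg_mul_Ioi (by positivity) hB,
      one_div, Real.inv_rpow hB.le, Real.rpow_neg hB.le]
  rw [hI]
  have h1c : 0 < 1 - c := by linarith
  obtain ⟨Y, hY⟩ : ∃ Y, ∀ y ≥ Y, |G y| ≤ |L| + 1 := by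
    have := (hL.abs).eventually (eventually_le_nhds (b := |L| + 1) (by linarith))
    exact eventually_atTop.1 this
  refine tendsto_integral_filter_of_dominated_convergence
      (fun x => ((1 - c)⁻¹ ^ |m| * (|L| + 1)) *
        (x ^ (δ₁ / 2 - 1) * Real.exp (-((1 - c) / 2 * x)))) ?_ ?_ ?_ ?_
  · refine Eventually.of_forall fun z => ?_
    refine (Measurable.indicator ?_ measurableSet_Ioo).aestronglyMeasurable
    have h2 : Measurable (fun x => G (z * √r * √(1 - c * x / z))) := hGm.comp (by fun_prop)
    exact ((by fun_prop : Measurable (fun x : ℝ => x ^ (δ₁ / 2 - 1) * (1 - c * x / z) ^ m)).mul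
      h2).mul (by fun_prop)
  · have hz1 : Tendsto (fun z => z * (√r * √(1 - c))) atTop atTop :=
      tendsto_id.atTop_mul_const (by have := Real.sqrt_pos.2 h1c; positivity)
    filter_upwards [eventually_gt_atTop 0, hz1.eventually_ge_atTop Y] with z hz hzY
    rw [ae_restrict_iff' measurableSet_Ioi]
    refine ae_of_all _ fun x hx => ?_
    have hx0 : 0 < x := hx
    by_cases h : x ∈ Ioo (0:ℝ) z
    · rw [indicator_of_mem h]
      have hxz : x / z < 1 := (div_lt_one hz).2 h.2
      have hxz0 : 0 < x / z := by positivity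
      have hw1 : 1 - c ≤ 1 - c * x / z := by rw [mul_div_assoc]; nlinarith
      have hw2 : 1 - c * x / z ≤ 1 := by rw [mul_div_assoc]; nlinarith
      set w := 1 - c * x / z with hw
      have hw0 : 0 < w := by linarith
      have hM : 1 ≤ (1 - c)⁻¹ := (one_le_inv₀ h1c).2 (by linarith)
      have hb1 : w ^ m ≤ (1 - c)⁻¹ ^ |m| := rpow_bound (by rwa [inv_inv]) (by linarith) hM
      have hb2 : |G (z * √r * √w)| ≤ |L| + 1 := by
        apply hY
        calc Y ≤ z * (√r * √(1 - c)) := hzY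
          _ ≤ z * (√r * √w) := by gcongr
          _ = _ := by ring
      have hb3 : Real.exp (-(x * ((1 - c) / 2 + c * √r / (1 + √w)))) ≤
          Real.exp (-((1 - c) / 2 * x)) := by
        apply Real.exp_le_exp.2
        have : 0 ≤ x * (c * √r / (1 + √w)) := by positivity
        linarith
      rw [norm_mul, norm_mul, Real.norm_of_nonneg (Real.exp_pos _).le,
        Real.norm_of_nonneg (r := x ^ (δ₁ / 2 - 1) * w ^ m) (by positivity)]
      change x ^ (δ₁ / 2 - 1) * w ^ m * |G (z * √r * √w)| * _ ≤ _
      calc _ ≤ x ^ (δ₁ / 2 - 1) * (1 - c)⁻¹ ^ |m| * (|L| + 1) * Real.exp (-((1 - c) / 2 * x)) := by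
            gcongr
        _ = _ := by ring
    · rw [indicator_of_notMem h, norm_zero]
      positivity
  · refine Integrable.const_mul ?_ _
    have := integrableOn_rpow_mul_exp_neg_mul_rpow (p := 1) (s := δ₁ / 2 - 1) (b := (1 - c) / 2)
      (by linarith) one_pos (by linarith)
    simpa [IntegrableOn] using this
  · rw [ae_restrict_iff' measurableSet_Ioi]
    refine ae_of_all _ fun x hx => ?_
    have hx0 : 0 < x := hx
    have hw : Tendsto (fun z : ℝ => 1 - c * x / z) atTop (𝓝 1) := by
      have := (tendsto_const_nhds (x := (1:ℝ)) (f := atTop)).sub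
        ((tendsto_const_nhds (x := c * x)).div_atTop (tendsto_id (α := ℝ)))
      simpa using this
    have hsw : Tendsto (fun z : ℝ => √(1 - c * x / z)) atTop (𝓝 1) := by
      simpa using hw.sqrt
    have hwm : Tendsto (fun z : ℝ => (1 - c * x / z) ^ m) atTop (𝓝 1) := by
      simpa using hw.rpow_const (p := m) (Or.inl one_ne_zero)
    have hy : Tendsto (fun z : ℝ => z * √r * √(1 - c * x / z)) atTop atTop :=
      (tendsto_id.atTop_mul_const hsr).atTop_mul_pos one_pos hsw
    have hGy := hL.comp hy
    have he : Tendsto (fun z : ℝ =>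
        Real.exp (-(x * ((1 - c) / 2 + c * √r / (1 + √(1 - c * x / z)))))) atTop
        (𝓝 (Real.exp (-(x * ((1 - c) / 2 + c * √r / (1 + 1)))))) := by
      refine (Real.continuous_exp.tendsto _).comp (Tendsto.neg (tendsto_const_nhds.mul
        (tendsto_const_nhds.add (tendsto_const_nhds.div (tendsto_const_nhds.add hsw) ?_))))
      norm_num
    have hfin := (((tendsto_const_nhds (x := x ^ (δ₁ / 2 - 1))).mul hwm).mul hGy).mul he
    have e : x ^ (δ₁ / 2 - 1) * 1 * L * Real.exp (-(x * ((1 - c) / 2 + c * √r / (1 + 1)))) =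
      L * (x ^ (δ₁ / 2 - 1) * Real.exp (-(((1 - c) / 2 + c * √r / 2) * x))) := by
      rw [show (1:ℝ) + 1 = 2 by norm_num, mul_comm x ((1 - c) / 2 + c * √r / 2)]
      ring
    rw [e] at hfin
    refine hfin.congr' ?_
    filter_upwards [eventually_gt_atTop x] with z hz
    rw [indicator_of_mem (show x ∈ Ioo (0:ℝ) z from ⟨hx0, hz⟩)]
    rfl

/-- **Theorem (Statement 14, eq. (4.6)).** For `δ₁, δ₂ > 0` there is a positive constant
`C`, depending only on `δ₁` and `δ₂`, such that for every `0 < c < 1` and `r > 0`,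
with `a₂ = (√r−1)²/2` and `b₂ = (1−c)/2`,
`q(z₂; z₂r) ∼ C r^{(1−δ₂)/4} (b₂ + c√r/2)^{−δ₁/2} z₂^{−1/2} e^{−a₂z₂}` as `z₂ → ∞`. -/
theorem statement14 (δ₁ δ₂ : ℝ) (hδ₁ : 0 < δ₁) (hδ₂ : 0 < δ₂) :
    ∃ C : ℝ, 0 < C ∧ ∀ c : ℝ, 0 < c → c < 1 → ∀ r : ℝ, 0 < r →
      Tendsto (fun z₂ => qTwo c δ₁ δ₂ (z₂ * r) z₂ /
          (C * r ^ ((1 - δ₂) / 4) * ((1 - c) / 2 + c * Real.sqrt r / 2) ^ (-(δ₁ / 2)) *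
            z₂ ^ (-(1 : ℝ) / 2) *
            Real.exp (-((Real.sqrt r - 1) ^ 2 / 2) * z₂))) atTop (𝓝 1) := by

  obtain ⟨L, hL0, hL⟩ := bessel_lim (ν := (δ₂ - 2) / 2) (by linarith)
  have hΓ : 0 < Real.Gamma (δ₁ / 2) := Real.Gamma_pos_of_pos (by positivity)
  refine ⟨1 / 2 / (2 ^ (δ₁ / 2) * Real.Gamma (δ₁ / 2)) * (L * Real.Gamma (δ₁ / 2)),
    by positivity, ?_⟩
  intro c hc0 hc r hr
  have hB : 0 < (1 - c) / 2 + c * √r / 2 := by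
    have := Real.sqrt_pos.2 hr
    have : 0 < c * √r := by positivity
    linarith
  have hBp : 0 < ((1 - c) / 2 + c * √r / 2) ^ (-(δ₁ / 2)) := Real.rpow_pos_of_pos hB _
  have h := (main_lim (δ₁ := δ₁) (δ₂ := δ₂) hδ₁ hc0 hc hr hL).div_const
    (L * (((1 - c) / 2 + c * √r / 2) ^ (-(δ₁ / 2)) * Real.Gamma (δ₁ / 2)))
  rw [div_self (by positivity)] at h
  refine h.congr' ?_
  filter_upwards [eventually_gt_atTop 0] with z hz
  rw [setIntegral_indicator measurableSet_Ioo, inter_eq_right.2 Ioo_subset_Ioi_self]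
  have hq : qTwo c δ₁ δ₂ (z * r) z = _ := setIntegral_congr_fun measurableSet_Ioo
    (fun x hx => integrand_eq (δ₁ := δ₁) (δ₂ := δ₂) hc0 hc hr hz hx.1 hx.2 _ _ rfl rfl)
  rw [hq, integral_const_mul]
  set J := (∫ x in Ioo (0:ℝ) z, x ^ (δ₁ / 2 - 1) * (1 - c * x / z) ^ ((δ₂ - 2) / 4 - 1 / 4) *
        (√(z * √r * √(1 - c * x / z)) * Real.exp (-(z * √r * √(1 - c * x / z))) *
          besselI ((δ₂ - 2) / 2) (z * √r * √(1 - c * x / z))) *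
        Real.exp (-(x * ((1 - c) / 2 + c * √r / (1 + √(1 - c * x / z)))))) with hJ
  clear_value J
  have h1 : 0 < r ^ ((1 - δ₂) / 4) := Real.rpow_pos_of_pos hr _
  have h2 : 0 < z ^ (-(1:ℝ) / 2) := Real.rpow_pos_of_pos hz _
  have h3 := Real.exp_pos (-((√r - 1) ^ 2 / 2) * z)
  have h4 : (0:ℝ) < 2 ^ (δ₁ / 2) := by positivity
  generalize Real.exp (-((√r - 1) ^ 2 / 2) * z) = E at *
  generalize z ^ (-(1:ℝ) / 2) = Z at *
  generalize r ^ ((1 - δ₂) / 4) = R at *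
  generalize ((1 - c) / 2 + c * √r / 2) ^ (-(δ₁ / 2)) = B at *
  generalize Real.Gamma (δ₁ / 2) = A at *
  generalize (2:ℝ) ^ (δ₁ / 2) = T at *
  field_simp
end
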